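/- For every integer n >= 2, the automorphism group Aut(F_n) of the free group F_n of rank n is acylindrically hyperbolic. -/

import Mathlib

noncomputable section

open Metric Set

universe u v

/-- A geodesic metric space: any two points are joined by an isometrically
parametrized segment. -/
def GeodesicSpace (Y : Type*) [MetricSpace Y] : Prop :=
  ∀ x y : Y, ∃ f : ℝ → Y, f 0 = x ∧ f (dist x y) = y ∧
    ∀ s ∈ Set.Icc (0:ℝ) (dist x y), ∀ t ∈ Set.Icc (0:ℝ) (dist x y),
      dist (f s) (f t) = |s - t|

/-- Gromov hyperbolicity (four-point condition) with constant `δ`. -/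
def GromovHyperbolic (Y : Type*) [MetricSpace Y] (δ : ℝ) : Prop :=
  ∀ x y z w : Y, dist x y + dist z w ≤ max (dist x z + dist y w) (dist x w + dist y z) + 2 * δ

/-- A Gromov hyperbolic geodesic metric space. -/
def HyperbolicGeodesicSpace (Y : Type*) [MetricSpace Y] : Prop :=
  GeodesicSpace Y ∧ ∃ δ : ℝ, 0 ≤ δ ∧ GromovHyperbolic Y δ

/-- An isometric action `ρ` of `G` on `Y` is acylindrical if for every `R > 0` there are
`L > 0` and `N` such that for any two points at distance `> L`, at most `N` elements of `G`
move both points by less than `R`. -/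
def IsAcylindrical {G : Type*} [Group G] {Y : Type*} [MetricSpace Y] (ρ : G →* (Y ≃ᵢ Y)) : Prop :=
  ∀ R : ℝ, 0 < R → ∃ L : ℝ, 0 < L ∧ ∃ N : ℕ, ∀ x y : Y, L < dist x y →
    ∃ s : Finset G, s.card ≤ N ∧
      ∀ g : G, dist x (ρ g x) < R → dist y (ρ g y) < R → g ∈ s

/-- A group is virtually cyclic if it has a cyclic subgroup of finite index. -/
def VirtuallyCyclic (G : Type*) [Group G] : Prop :=
  ∃ H : Subgroup G, H.FiniteIndex ∧ IsCyclic ↥H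

/-- A group is acylindrically hyperbolic if it is not virtually cyclic and admits an
acylindrical isometric action with unbounded orbits on a Gromov hyperbolic geodesic space
(this is equivalent to admitting a nonelementary acylindrical action on such a space). -/
def AcylindricallyHyperbolic (G : Type u) [Group G] : Prop :=
  ¬ VirtuallyCyclic G ∧
    ∃ (Y : Type u) (_ : MetricSpace Y) (ρ : G →* (Y ≃ᵢ Y)),
      HyperbolicGeodesicSpace Y ∧ IsAcylindrical ρ ∧
      ∃ y : Y, ¬ Bornology.IsBounded (Set.range fun g : G => ρ g y)


namespace AHc

section Prim
variable {α : Type*} [DecidableEq α]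

def lcp {β : Type*} [DecidableEq β] : List β → List β → ℕ
  | a :: l, b :: m => if a = b then lcp l m + 1 else 0
  | [], _ => 0
  | _ :: _, [] => 0

theorem lcp_ultra {β : Type*} [DecidableEq β] (L M N : List β) :
    lcp L M ≤ lcp L N ∨ lcp M N ≤ lcp L N := by
  induction L generalizing M N with
  | nil => left; simp [lcp]
  | cons a L ih =>
    cases M with
    | nil => left; simp [lcp]
    | cons b M =>
      cases N with
      | nil => right; simp [lcp]
      | cons c N =>
        simp only [lcp]
        rcases ih M N with h | h <;> split_ifs <;> simp_all

theorem norm_lcp (L M : List (α × Bool)) (hL : FreeGroup.IsReduced L) (hM : FreeGroup.IsReduced M) :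
    ((FreeGroup.mk L)⁻¹ * FreeGroup.mk M).norm + 2 * lcp L M = L.length + M.length := by
  induction L generalizing M with
  | nil =>
    have : FreeGroup.mk ([] : List (α × Bool)) = 1 := rfl
    simp [lcp, this, FreeGroup.norm, hM.reduce_eq]
  | cons a L ih =>
    cases M with
    | nil =>
      have : FreeGroup.mk ([] : List (α × Bool)) = 1 := rfl
      rw [this, mul_one, FreeGroup.norm_inv_eq]
      simp [lcp, FreeGroup.norm, hL.reduce_eq]
    | cons b M =>
      by_cases hab : a = b
      · subst hab
        have h1 : FreeGroup.IsReduced L := List.IsChain.tail hL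
        have h2 : FreeGroup.IsReduced M := List.IsChain.tail hM
        have e1 : FreeGroup.mk (a :: L) = FreeGroup.mk [a] * FreeGroup.mk L := by
          simp [FreeGroup.mul_mk]
        have e2 : FreeGroup.mk (a :: M) = FreeGroup.mk [a] * FreeGroup.mk M := by
          simp [FreeGroup.mul_mk]
        have e3 : (FreeGroup.mk (a :: L))⁻¹ * FreeGroup.mk (a :: M)
          = (FreeGroup.mk L)⁻¹ * FreeGroup.mk M := by
          rw [e1, e2]; group
        rw [e3]
        have := ih M h1 h2
        simp only [lcp, if_true, List.length_cons]
        omega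
      · simp only [lcp, hab, if_false]
        rw [FreeGroup.inv_mk, FreeGroup.mul_mk]
        have hr : FreeGroup.IsReduced (FreeGroup.invRev (a :: L) ++ b :: M) := by
          have hi : FreeGroup.IsReduced (FreeGroup.invRev (a :: L)) := by
            rw [FreeGroup.isReduced_iff_reduce_eq, FreeGroup.reduce_invRev, hL.reduce_eq]
          unfold FreeGroup.IsReduced at hi hM ⊢
          rw [List.isChain_append]
          refine ⟨hi, hM, ?_⟩
          intro x hx y hy
          simp [FreeGroup.invRev] at hx hy
          subst hx hy
          intro h
          simp at h
          obtain ⟨a1, a2⟩ := a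
          obtain ⟨b1, b2⟩ := b
          simp at h hab ⊢
          cases a2 <;> cases b2 <;> simp_all
        rw [FreeGroup.norm, FreeGroup.toWord_mk, hr.reduce_eq]
        simp [FreeGroup.invRev_length]

/-- integer length -/
def len (u : FreeGroup α) : ℤ := (u.norm : ℤ)

/-- word distance -/
def d (u v : FreeGroup α) : ℤ := len (u⁻¹ * v)

theorem len_eq (u : FreeGroup α) : len u = (u.toWord.length : ℤ) := rfl
theorem len_nonneg (u : FreeGroup α) : 0 ≤ len u := by simp [len]
@[simp] theorem len_one : len (1 : FreeGroup α) = 0 := by simp [len]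
@[simp] theorem len_inv (u : FreeGroup α) : len u⁻¹ = len u := by simp [len]
@[simp] theorem len_eq_zero {u : FreeGroup α} : len u = 0 ↔ u = 1 := by simp [len]
@[simp] theorem len_of (a : α) : len (FreeGroup.of a) = 1 := by simp [len]
theorem len_mul_le (u v : FreeGroup α) : len (u * v) ≤ len u + len v := by
  simp only [len]; exact_mod_cast FreeGroup.norm_mul_le u v
theorem len_pos {u : FreeGroup α} (h : u ≠ 1) : 1 ≤ len u := by
  have := len_nonneg u
  have : len u ≠ 0 := by simpa using h
  omega

theorem d_nonneg (u v : FreeGroup α) : 0 ≤ d u v := len_nonneg _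
@[simp] theorem d_self (u : FreeGroup α) : d u u = 0 := by simp [d]
theorem d_comm (u v : FreeGroup α) : d u v = d v u := by
  rw [d, d, ← len_inv]; congr 1; group
theorem d_tri (u v w : FreeGroup α) : d u w ≤ d u v + d v w := by
  have : u⁻¹ * w = (u⁻¹ * v) * (v⁻¹ * w) := by group
  rw [d, this]; exact len_mul_le _ _
@[simp] theorem d_mul (g u v : FreeGroup α) : d (g * u) (g * v) = d u v := by
  simp only [d]; congr 1; group
theorem d_one_left (u : FreeGroup α) : d 1 u = len u := by simp [d]
theorem d_one_right (u : FreeGroup α) : d u 1 = len u := by simp [d]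
theorem d_eq_zero {u v : FreeGroup α} : d u v = 0 ↔ u = v := by
  simp [d, inv_mul_eq_one]

theorem d_lcp (u v : FreeGroup α) : d u v + 2 * (lcp u.toWord v.toWord : ℤ) = len u + len v := by
  have := norm_lcp u.toWord v.toWord FreeGroup.isReduced_toWord FreeGroup.isReduced_toWord
  simp only [FreeGroup.mk_toWord] at this
  simp only [d, len]
  have h2 : u.toWord.length = u.norm := rfl
  have h3 : v.toWord.length = v.norm := rfl
  omega

theorem d_def (u v : FreeGroup α) : d u v = len (u⁻¹ * v) := rfl

theorem d_par (u v : FreeGroup α) : ∃ k : ℤ, d u v + 2 * k = len u + len v := ⟨_, d_lcp u v⟩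

theorem fp0 (x y z : FreeGroup α) :
    len z + d x y ≤ len x + d z y ∨ len z + d x y ≤ len y + d x z := by
  have h1 := d_lcp x y
  have h2 := d_lcp x z
  have h3 := d_lcp z y
  rcases lcp_ultra x.toWord z.toWord y.toWord with h | h
  · right; omega
  · left; omega

/-- four point condition -/
theorem fp (x y z w : FreeGroup α) :
    d x y + d z w ≤ d x z + d y w ∨ d x y + d z w ≤ d x w + d y z := by
  have := fp0 (w⁻¹ * x) (w⁻¹ * y) (w⁻¹ * z)
  simp only [d_mul] at this
  have e (u : FreeGroup α) : len (w⁻¹ * u) = d w u := (d_def _ _).symm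
  simp only [e] at this
  rw [d_comm z w, d_comm y w, d_comm x w, d_comm y z]
  rcases this with h | h
  · right; omega
  · left; omega

theorem geo0 (u : FreeGroup α) (j : ℤ) (h0 : 0 ≤ j) (h1 : j ≤ len u) :
    ∃ w, len w = j ∧ d w u = len u - j := by
  lift j to ℕ using h0
  have h1' : j ≤ u.toWord.length := by rw [len_eq] at h1; exact_mod_cast h1
  have hr : FreeGroup.IsReduced u.toWord := FreeGroup.isReduced_toWord
  have hr1 : FreeGroup.IsReduced (u.toWord.take j) := List.IsChain.take hr j
  have hr2 : FreeGroup.IsReduced (u.toWord.drop j) := List.IsChain.drop hr j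
  refine ⟨FreeGroup.mk (u.toWord.take j), ?_, ?_⟩
  · rw [len_eq, FreeGroup.toWord_mk, hr1.reduce_eq]; simp; omega
  · have : u = FreeGroup.mk (u.toWord.take j) * FreeGroup.mk (u.toWord.drop j) := by
      rw [FreeGroup.mul_mk, List.take_append_drop, FreeGroup.mk_toWord]
    rw [d_def]
    conv_lhs => rw [this]
    rw [FreeGroup.toWord_mul, FreeGroup.toWord_mk, FreeGroup.toWord_mk, hr1.reduce_eq, hr2.reduce_eq, List.take_append_drop, hr.reduce_eq]
    rw [inv_mul_cancel_left, len_eq, FreeGroup.toWord_mk, hr2.reduce_eq, len_eq]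
    simp; omega

theorem finite_ball [Finite α] (r : ℤ) : {u : FreeGroup α | len u ≤ r}.Finite := by
  have h : {l : List (α × Bool) | l.length ≤ r.toNat}.Finite := List.finite_length_le _ _
  refine (h.preimage (FreeGroup.toWord_injective.injOn)).subset ?_
  intro u hu
  simp only [mem_ofPred_eq, mem_preimage, len_eq] at *
  omega

theorem len_one_cases (w : FreeGroup α) (h : len w = 1) :
    ∃ i, w = FreeGroup.of i ∨ w = (FreeGroup.of i)⁻¹ := by
  rw [len_eq] at h
  have h : w.toWord.length = 1 := by exact_mod_cast h
  obtain ⟨⟨i, b⟩, hi⟩ := List.length_eq_one_iff.mp h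
  refine ⟨i, ?_⟩
  have : w = FreeGroup.mk [(i,b)] := by rw [← hi, FreeGroup.mk_toWord]
  cases b
  · right; rw [this]; rfl
  · left; rw [this]; rfl

end Prim
end AHc

namespace AH

/-- A group with a tree-like length function. -/
class TG (n : outParam ℕ) (F : Type) [Group F] where
  len : F → ℤ
  d : F → F → ℤ
  gen : Fin n → F
  d_def : ∀ u v, d u v = len (u⁻¹ * v)
  len_nonneg : ∀ u, 0 ≤ len u
  len_inv : ∀ u, len u⁻¹ = len u
  len_eq_zero : ∀ u, len u = 0 ↔ u = 1
  len_mul_le : ∀ u v, len (u * v) ≤ len u + len v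
  d_par : ∀ u v, ∃ k : ℤ, d u v + 2 * k = len u + len v
  fp : ∀ x y z w, d x y + d z w ≤ d x z + d y w ∨ d x y + d z w ≤ d x w + d y z
  geo0 : ∀ (u : F) (j : ℤ), 0 ≤ j → j ≤ len u → ∃ w, len w = j ∧ d w u = len u - j
  sq_one : ∀ u : F, u * u = 1 → u = 1
  finite_ball : ∀ r : ℤ, {u : F | len u ≤ r}.Finite
  len_one_cases : ∀ w, len w = 1 → ∃ i, w = gen i ∨ w = (gen i)⁻¹
  len_word : ∀ l : List (Fin n), len ((l.map gen).prod) = l.length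
  gen_comm : ∀ i j, gen i * gen j = gen j * gen i → i = j
  aut_ext : ∀ φ ψ : F ≃* F, (∀ i, φ (gen i) = ψ (gen i)) → φ = ψ

instance instTG (n : ℕ) : TG n (FreeGroup (Fin n)) where
  len := AHc.len
  d := AHc.d
  gen := FreeGroup.of
  d_def _ _ := rfl
  len_nonneg := AHc.len_nonneg
  len_inv := AHc.len_inv
  len_eq_zero _ := AHc.len_eq_zero
  len_mul_le := AHc.len_mul_le
  d_par := AHc.d_par
  fp := AHc.fp
  geo0 := AHc.geo0
  sq_one u h := by
    have : u ^ 2 = 1 ^ 2 := by simpa [pow_two] using h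
    exact pow_left_injective (two_ne_zero) this
  finite_ball := AHc.finite_ball
  len_one_cases := AHc.len_one_cases
  len_word l := by
    have h : ∀ l : List (Fin n), (l.map FreeGroup.of).prod = FreeGroup.mk (l.map fun i => (i, true)) := by
      intro l
      induction l with
      | nil => rfl
      | cons a l ih => rw [List.map_cons, List.prod_cons, ih, FreeGroup.of, FreeGroup.mul_mk]; rfl
    rw [h, AHc.len_eq, FreeGroup.toWord_mk, FreeGroup.IsReduced.reduce_eq]
    · simp
    · unfold FreeGroup.IsReduced
      rw [List.isChain_map]
      induction l with
      | nil => simp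
      | cons a l ih =>
        cases l with
        | nil => simp
        | cons b l => rw [List.isChain_cons_cons]; exact ⟨by simp, ih⟩
  gen_comm i j h := by
    have h2 := congrArg FreeGroup.toWord h
    simp [FreeGroup.toWord_mul, FreeGroup.toWord_of, FreeGroup.reduce] at h2
    exact h2.1
  aut_ext φ ψ h := by
    have : φ.toMonoidHom = ψ.toMonoidHom := FreeGroup.ext_hom _ _ h
    ext x; exact DFunLike.congr_fun this x

end AH

namespace AH
section Basic
open TG
variable {n : ℕ} {F : Type} [Group F] [TG n F]

attribute [simp] TG.len_inv TG.len_eq_zero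
@[simp] theorem len_one : len (1 : F) = 0 := by simp
theorem len_pos {u : F} (h : u ≠ 1) : 1 ≤ len u := by
  have := len_nonneg u
  have : len u ≠ 0 := by simpa using h
  lia

theorem d_nonneg (u v : F) : 0 ≤ d u v := by rw [d_def]; exact len_nonneg _
@[simp] theorem d_self (u : F) : d u u = 0 := by simp [d_def]
theorem d_comm (u v : F) : d u v = d v u := by
  rw [d_def, d_def, ← len_inv]; congr 1; group
theorem d_tri (u v w : F) : d u w ≤ d u v + d v w := by
  have : u⁻¹ * w = (u⁻¹ * v) * (v⁻¹ * w) := by group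
  rw [d_def, d_def, d_def, this]; exact len_mul_le _ _
@[simp] theorem d_mul (g u v : F) : d (g * u) (g * v) = d u v := by
  simp only [d_def]; congr 1; group
theorem d_one_left (u : F) : d 1 u = len u := by simp [d_def]
theorem d_one_right (u : F) : d u 1 = len u := by simp [d_def]
theorem d_eq_zero {u v : F} : d u v = 0 ↔ u = v := by
  simp [d_def, inv_mul_eq_one]

theorem par3 (x y z : F) : ∃ k : ℤ, d x y + d x z + d y z = 2 * k := by
  obtain ⟨k, hk⟩ := d_par (x⁻¹ * y) (x⁻¹ * z)
  simp only [d_mul] at hk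
  have e (u : F) : len (x⁻¹ * u) = d x u := (d_def _ _).symm
  simp only [e] at hk
  exact ⟨d y z + k, by lia⟩

theorem geo (x y : F) (j : ℤ) (h0 : 0 ≤ j) (h1 : j ≤ d x y) :
    ∃ w, d x w = j ∧ d w y = d x y - j := by
  obtain ⟨w, hw, hw'⟩ := geo0 (x⁻¹ * y) j h0 (by rwa [← d_def])
  refine ⟨x * w, ?_, ?_⟩
  · simp [d_def, hw]
  · have : d w (x⁻¹ * y) = d (x * w) y := by
      rw [← d_mul x]; simp
    rw [← this, hw', d_def]

/-- medians exist -/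
theorem median (x y z : F) : ∃ m, d x m + d m y = d x y ∧ d x m + d m z = d x z ∧
    d y m + d m z = d y z := by
  obtain ⟨k, hk⟩ := par3 x y z
  have t1 := d_tri x y z
  have t2 := d_tri y x z
  have t3 := d_tri x z y
  rw [d_comm y x] at t2
  rw [d_comm z y] at t3
  obtain ⟨m, h1, h2⟩ := geo x y (k - d y z) (by lia) (by lia)
  refine ⟨m, by lia, ?_, ?_⟩ <;>
  · have a1 := fp m z x y
    have a2 := d_tri x m z
    have a3 := d_tri y m z
    rw [d_comm y m] at *
    rw [d_comm m x, d_comm z y, d_comm z x] at a1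
    lia

theorem len_sq (u : F) (hu : u ≠ 1) : len u < len (u * u) := by
  by_contra hc
  push Not at hc
  have hd : d u⁻¹ u = len (u * u) := by simp [d_def]
  have hl := len_nonneg u
  obtain ⟨m, h1, h2, h3⟩ := median u⁻¹ 1 u
  simp only [d_one_left, d_one_right, len_inv] at h1 h2 h3
  obtain ⟨k, hk⟩ := d_par u⁻¹ u
  rw [len_inv] at hk
  -- points at distance j, on both sides
  have key (j : ℤ) (h0 : 0 ≤ j) (hj : j ≤ len m) :
      ∃ p, len p = j ∧ d p u = len u - j ∧ d p u⁻¹ = len u - j := by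
    obtain ⟨p, hp1, hp2⟩ := geo0 m j h0 hj
    refine ⟨p, hp1, ?_, ?_⟩
    · have a1 := d_tri p m u
      have a2 := d_tri 1 p u
      rw [d_one_left, d_one_left] at a2
      lia
    · have a1 := d_tri p m u⁻¹
      have a2 := d_tri 1 p u⁻¹
      rw [d_one_left, d_one_left, len_inv] at a2
      rw [d_comm m] at a1
      lia
  have uniq (p p' : F) (h1 : len p = len p') (h2 : d p u = len u - len p)
      (h3 : d p' u = len u - len p') : p = p' := by
    rw [← d_eq_zero]
    have := fp p p' 1 u
    simp only [d_one_left, d_one_right] at this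
    have := d_nonneg p p'
    lia
  have act (p : F) (h : d p u⁻¹ = len u - len p) (h' : d p u = len u - len p) :
      len (u * p) = len u - len p ∧ d (u * p) u = len p := by
    constructor
    · rw [← d_one_right, ← d_mul u⁻¹]; simpa using h
    · have : d (u * p) (u * 1) = d p 1 := d_mul _ _ _
      simpa [d_one_right] using this
  have hfree (p w : F) (h : w * p = p) : w = 1 := by simpa using h
  have hsq : u * u ≠ 1 := by
    intro h
    exact hu (sq_one u h)
  rcases Int.even_or_odd' (len u) with ⟨j, hj | hj⟩
  · obtain ⟨p, hp1, hp2, hp3⟩ := key j (by lia) (by lia)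
    obtain ⟨b1, b2⟩ := act p (by lia) (by lia)
    have e : u * p = p := uniq (u * p) p (by lia) (by lia) (by lia)
    exact hu (hfree p u e)
  · obtain ⟨p, hp1, hp2, hp3⟩ := key j (by lia) (by lia)
    obtain ⟨p', hp1', hp2', hp3'⟩ := key (j+1) (by lia) (by lia)
    obtain ⟨b1, b2⟩ := act p (by lia) (by lia)
    obtain ⟨b1', b2'⟩ := act p' (by lia) (by lia)
    have e1 : u * p = p' := uniq (u * p) p' (by lia) (by lia) (by lia)
    have e2 : u * p' = p := uniq (u * p') p (by linarith) (by linarith) (by linarith)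
    apply hsq
    apply hfree p
    rw [mul_assoc, e1, e2]


end Basic
end AH

namespace AH
section Trans
open TG
variable {n : ℕ} {F : Type} [Group F] [TG n F]

/-- twice the Gromov product at 1 -/
def q (u v : F) : ℤ := len u + len v - d u v
theorem q_def (u v : F) : q u v = len u + len v - d u v := rfl
theorem q_comm (u v : F) : q u v = q v u := by rw [q_def, q_def, d_comm]; ring
theorem q_nonneg (u v : F) : 0 ≤ q u v := by
  have := d_tri u 1 v
  rw [d_one_left, d_one_right] at this
  rw [q_def]; lia
theorem d_tri1 (u v : F) : len u ≤ len v + d u v := by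
  have := d_tri 1 v u
  rw [d_one_left, d_one_left, d_comm] at this
  lia
theorem q_le_left (u v : F) : q u v ≤ 2 * len u := by
  have := d_tri1 v u
  rw [d_comm] at this
  rw [q_def]; lia
theorem q_le_right (u v : F) : q u v ≤ 2 * len v := by
  rw [q_comm]; exact q_le_left _ _
theorem q_ultra (u v w : F) : q u v ≤ q u w ∨ q v w ≤ q u w := by
  have := fp u w v 1
  simp only [d_one_right] at this
  rw [q_def, q_def, q_def]
  rw [d_comm v w]
  lia
theorem q_even (u v : F) : ∃ k : ℤ, q u v = 2 * k := by
  obtain ⟨k, hk⟩ := d_par u v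
  exact ⟨k, by rw [q_def]; lia⟩

/-- translation length -/
def tau (y : F) : ℤ := len (y * y) - len y
def cc (y : F) : ℤ := 2 * len y - len (y * y)

theorem len_eq_tau (y : F) : len y = tau y + cc y := by unfold tau cc; ring
theorem cc_nonneg (y : F) : 0 ≤ cc y := by
  have := len_mul_le y y
  unfold cc; lia
theorem tau_pos {y : F} (h : y ≠ 1) : 1 ≤ tau y := by
  have := len_sq y h
  unfold tau; lia
@[simp] theorem tau_one : tau (1 : F) = 0 := by simp [tau]
theorem tau_nonneg (y : F) : 0 ≤ tau y := by
  by_cases h : y = 1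
  · simp [h]
  · have := tau_pos h; lia
@[simp] theorem tau_inv (y : F) : tau y⁻¹ = tau y := by
  have : y⁻¹ * y⁻¹ = (y * y)⁻¹ := by group
  rw [tau, tau, this, len_inv, len_inv]
@[simp] theorem cc_inv (y : F) : cc y⁻¹ = cc y := by
  have : y⁻¹ * y⁻¹ = (y * y)⁻¹ := by group
  rw [cc, cc, this, len_inv, len_inv]
theorem cc_one : cc (1 : F) = 0 := by simp [cc]

theorem len_pow_succ (y : F) (hy : y ≠ 1) (k : ℕ) :
    len (y ^ (k + 1)) = (k + 1) * tau y + cc y := by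
  have h1 : len (y ^ (0+1)) = tau y + cc y := by simp [← len_eq_tau]
  have h2 : len (y ^ (0+1+1)) = 2 * tau y + cc y := by
    rw [zero_add, one_add_one_eq_two, pow_two]; unfold tau cc; ring
  have key : ∀ k : ℕ, len (y ^ (k+1)) = (k+1) * tau y + cc y ∧
      len (y ^ (k+1+1)) = (k+1) * tau y + tau y + cc y := by
    intro k
    induction k with
    | zero => constructor
              · rw [h1]; push_cast; ring
              · rw [h2]; push_cast; ring
    | succ k ih =>
      obtain ⟨i1, i2⟩ := ih
      push_cast
      refine ⟨by rw [i2]; ring, ?_⟩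
      have t := tau_pos hy
      have c := cc_nonneg y
      have ht := len_eq_tau y
      have hs : len (y * y) = 2 * tau y + cc y := by unfold tau cc; ring
      -- points 1, y, y^(k+2), y^(k+3)
      have a1 := fp 1 (y^(k+1+1+1)) y (y^(k+1+1))
      have a2 := fp 1 (y^(k+1+1)) y (y^(k+1+1+1))
      have e1 : d y (y^(k+1+1)) = len (y^(k+1)) := by rw [d_def]; congr 1; rw [pow_succ' y (k+1)]; group
      have e2 : d y (y^(k+1+1+1)) = len (y^(k+1+1)) := by rw [d_def]; congr 1; rw [pow_succ' y (k+1+1)]; group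
      have e3 : d (y^(k+1+1)) (y^(k+1+1+1)) = len y := by rw [d_def]; congr 1; rw [pow_succ y (k+1+1)]; group
      simp only [d_one_left] at a1 a2
      rw [d_comm _ y] at a1
      rw [d_comm _ y] at a2
      rw [d_comm (y^(k+1+1+1))] at a1
      rw [e1, e2, e3] at a1 a2
      rw [i1, i2, ht] at a1 a2
      have hk : 0 ≤ (k:ℤ) * tau y := by positivity
      have : ((k:ℤ)+1) * tau y = k * tau y + tau y := by ring
      have h3 : ((k:ℤ)+1+1) * tau y = k * tau y + 2 * tau y := by ring
      rw [this] at a1 a2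
      rw [h3]
      generalize (k:ℤ) * tau y = T at *
      lia
  exact (key k).1

theorem len_pow (y : F) (hy : y ≠ 1) (k : ℕ) (hk : 1 ≤ k) :
    len (y ^ k) = k * tau y + cc y := by
  obtain ⟨k, rfl⟩ : ∃ j, k = j + 1 := ⟨k - 1, by lia⟩
  have := len_pow_succ y hy k
  push_cast; exact this

theorem len_zpow (y : F) (hy : y ≠ 1) (k : ℤ) (hk : 1 ≤ k) :
    len (y ^ k) = k * tau y + cc y := by
  lift k to ℕ using by lia
  rw [zpow_natCast]; exact len_pow y hy k (by lia)

theorem d_zpow (y : F) (hy : y ≠ 1) (i j : ℤ) (h : i < j) :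
    d (y ^ i) (y ^ j) = (j - i) * tau y + cc y := by
  rw [← len_zpow y hy (j - i) (by lia), d_def]
  congr 1; group

theorem len_pow_ge (y : F) (hy : y ≠ 1) (k : ℕ) : (k : ℤ) ≤ len (y ^ k) := by
  rcases Nat.eq_zero_or_pos k with h | h
  · subst h; simp
  · rw [len_pow y hy k h]
    have := tau_pos hy
    have := cc_nonneg y
    nlinarith

theorem pow_ne_one' {n : ℕ} {F : Type} [Group F] [TG n F] {y : F} (hy : y ≠ 1) {k : ℕ} (hk : 1 ≤ k) : y ^ k ≠ 1 := by
  intro h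
  have := len_pow_ge y hy k
  rw [h, len_one] at this
  lia

/-- `w` between `y^i` and `y^j`, deep: on the axis. -/
theorem axis (y w : F) (hy : y ≠ 1) (i j : ℤ) (hij : i + 1 < j)
    (hw : d (y^i) w + d w (y^j) = d (y^i) (y^j)) (h1 : cc y ≤ 2 * d (y^i) w)
    (h2 : 2 * tau y + cc y ≤ 2 * d w (y^j)) : d w (y * w) = tau y := by
  have e0 := d_zpow y hy i j (by lia)
  have e1 := d_zpow y hy i (j-1) (by lia)
  have e2 := d_zpow y hy (i-1) j (by lia)
  have e3 := d_zpow y hy (j-1) j (by lia)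
  have e4 := d_zpow y hy (i-1) i (by lia)
  have f1 := d_mul y w (y^(j-1))
  have f2 := d_mul y (y^(i-1)) w
  rw [← zpow_one_add] at f1 f2
  rw [show 1 + (j-1) = j by ring] at f1
  rw [show 1 + (i-1) = i by ring] at f2
  have a1 := fp w (y^(j-1)) (y^i) (y^j)
  have a2 := fp w (y^j) (y^i) (y^(j-1))
  have b1 := fp w (y^(i-1)) (y^i) (y^j)
  have b2 := fp w (y^i) (y^(i-1)) (y^j)
  have c1 := fp w (y*w) (y^i) (y^j)
  have c2 := d_tri (y^i) w (y*w)
  have t := tau_pos hy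
  have c := cc_nonneg y
  have m0 : (j - i) * tau y = (j-i-1-1) * tau y + 2 * tau y := by ring
  have m1 : (j - 1 - i) * tau y = (j-i-1-1) * tau y + tau y := by ring
  have m2 : (j - (i-1)) * tau y = (j-i-1-1) * tau y + 3 * tau y := by ring
  have m3 : 0 ≤ (j-i-1-1) * tau y := by apply mul_nonneg <;> lia
  rw [m0] at e0
  rw [m1] at e1
  rw [m2] at e2
  rw [show (j - (j-1)) * tau y = tau y by ring] at e3
  rw [show (i - (i-1)) * tau y = tau y by ring] at e4
  have s1 := d_comm (y^i) w
  have s2 := d_comm (y^(i-1)) w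
  have s3 := d_comm (y^(j-1)) (y^i)
  have s4 := d_comm (y^j) (y^i)
  have s5 := d_comm (y^(i-1)) (y^i)
  have s6 := d_comm (y^(j-1)) (y^j)
  have s7 := d_comm (y*w) (y^i)
  have s8 := d_comm (y*w) (y^j)
  have s9 := d_comm (y^j) (y^(i-1))
  have r1 := d_tri w (y^j) (y^(j-1))
  have r2 := d_tri w (y^i) (y^(i-1))
  have r3 := d_nonneg w (y * w)
  have r4 := d_tri (y^(i-1)) w (y^j)
  generalize (j-i-1-1) * tau y = T at *
  generalize d (y^i) w = x1 at *
  generalize d w (y^j) = x2 at *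
  generalize d w (y^(j-1)) = x3 at *
  generalize d (y^(i-1)) w = x4 at *
  generalize d (y^i) (y*w) = x5 at *
  generalize d (y*w) (y^j) = x6 at *
  generalize d w (y*w) = x7 at *
  lia

end Trans
end AH

namespace AH
section Comm
open TG
variable {n : ℕ} {F : Type} [Group F] [TG n F]

theorem len_powk (y : F) (k : ℕ) (hk : 1 ≤ k) : len (y ^ k) = k * tau y + cc y := by
  by_cases hy : y = 1
  · subst hy; simp [cc_one]
  · exact len_pow y hy k hk

theorem lim2 {A B B' C C1 C2 : ℤ}
    (h : ∀ k : ℕ, 1 ≤ k → k * A + C ≤ k * B + C1 ∨ k * A + C ≤ k * B' + C2) :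
    A ≤ B ∨ A ≤ B' := by
  by_contra hc
  push Not at hc
  obtain ⟨h1, h2⟩ := hc
  have := h (C1 - C).natAbs.succ
  have h3 := h ((C1 - C).natAbs + (C2 - C).natAbs + 1) (by lia)
  generalize hk : (C1 - C).natAbs + (C2 - C).natAbs + 1 = k at h3
  have i1 : (k:ℤ) * (B + 1) ≤ k * A := by gcongr; lia
  have i2 : (k:ℤ) * (B' + 1) ≤ k * A := by gcongr; lia
  rw [mul_add, mul_one] at i1 i2
  generalize (k:ℤ) * A = x1 at *
  generalize (k:ℤ) * B = x2 at *
  generalize (k:ℤ) * B' = x3 at *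
  lia

theorem tau_conj_le (w y : F) : tau (w * y * w⁻¹) ≤ tau y := by
  have := lim2 (A := tau (w * y * w⁻¹)) (B := tau y) (B' := tau y)
    (C := cc (w * y * w⁻¹)) (C1 := cc y + 2 * len w) (C2 := cc y + 2 * len w) (by
    intro k hk
    left
    rw [← len_powk _ k hk]
    have h1 := len_powk y k hk
    rw [conj_pow]
    have h2 := len_mul_le (w * y^k) w⁻¹
    have h3 := len_mul_le w (y^k)
    rw [len_inv] at h2
    linarith)
  lia

@[simp] theorem tau_conj (w y : F) : tau (w * y * w⁻¹) = tau y := by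
  apply le_antisymm (tau_conj_le w y)
  have := tau_conj_le w⁻¹ (w * y * w⁻¹)
  have e : w⁻¹ * (w * y * w⁻¹) * w⁻¹⁻¹ = y := by group
  rwa [e] at this

@[simp] theorem tau_conj' (w y : F) : tau (w⁻¹ * y * w) = tau y := by
  simpa using tau_conj w⁻¹ y

theorem tau_map (w y : F) : tau (MulAut.conj w y) = tau y := by simp

theorem len_cyc (x : F) (cx : cc x = 0) (k : ℕ) : len (x ^ k) = k * tau x := by
  rcases Nat.eq_zero_or_pos k with h | h
  · subst h; simp
  · rw [len_powk x k h, cx, add_zero]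

theorem fw_half (x y : F) (cx : cc x = 0) (cy : cc y = 0) (k l : ℕ)
    (h : 2 * (tau x + tau y) ≤ q (x^k) (y^l)) :
    len (x * y) = tau x + tau y ∧ d (x*y) (x^(k+1)) = len (x^(k+1)) - (tau x + tau y) := by
  have hx := len_eq_tau x
  have hy := len_eq_tau y
  have tx := tau_nonneg x
  have ty := tau_nonneg y
  have q1 := q_le_left (x^k) (y^l)
  have q2 := q_le_right (x^k) (y^l)
  have lx := len_cyc x cx k
  have lx1 := len_cyc x cx (k+1)
  have ly := len_cyc y cy l
  by_cases hy1 : y = 1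
  · subst hy1
    simp only [mul_one, tau_one, add_zero]
    refine ⟨by lia, ?_⟩
    have : d x (x^(k+1)) = len (x^k) := by rw [d_def, pow_succ']; simp
    rw [this, lx, lx1]; push_cast; ring
  have ty := tau_pos hy1
  have hl : 1 ≤ l := by
    by_contra hl
    have : l = 0 := by lia
    subst this
    have : len (y^0) = 0 := by simp
    lia
  have e1 : q y (y^l) = 2 * tau y := by
    have : d y (y^l) = len (y^(l-1)) := by
      rw [d_def]; congr 1
      obtain ⟨m, rfl⟩ : ∃ m, l = m + 1 := ⟨l - 1, by lia⟩
      rw [pow_succ']; simp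
    rw [q_def, this, len_cyc y cy (l-1), ly]
    push_cast [hl]
    rw [hy, cy]; ring
  have e2 := q_ultra y (y^l) (x^k)
  rw [q_comm (y^l)] at e2
  have e3 : 2 * tau y ≤ q y (x^k) := by lia
  rw [q_def] at e3
  have e4 : d (x*y) (x^(k+1)) = d y (x^k) := by rw [pow_succ']; simp
  have e5 := len_mul_le x y
  have e6 := d_tri1 (x^(k+1)) (x*y)
  rw [d_comm] at e6
  have : len (x^(k+1)) = len (x^k) + tau x := by rw [lx, lx1]; push_cast; ring
  constructor <;> lia

theorem fw (x y : F) (cx : cc x = 0) (cy : cc y = 0) (k l : ℕ)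
    (h : 2 * (tau x + tau y) ≤ q (x^k) (y^l)) : x * y = y * x := by
  obtain ⟨a1, a2⟩ := fw_half x y cx cy k l h
  obtain ⟨b1, b2⟩ := fw_half y x cy cx l k (by rw [q_comm]; lia)
  have tx := tau_nonneg x
  have ty := tau_nonneg y
  have q1 := q_le_left (x^k) (y^l)
  have q2 := q_le_right (x^k) (y^l)
  have ex : q (x^k) (x^(k+1)) = 2 * len (x^k) := by
    have : d (x^k) (x^(k+1)) = len x := by rw [d_def, pow_succ]; simp
    rw [q_def, this, len_cyc x cx, len_cyc x cx, len_eq_tau x, cx]; push_cast; ring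
  have ey : q (y^l) (y^(l+1)) = 2 * len (y^l) := by
    have : d (y^l) (y^(l+1)) = len y := by rw [d_def, pow_succ]; simp
    rw [q_def, this, len_cyc y cy, len_cyc y cy, len_eq_tau y, cy]; push_cast; ring
  have u1 := q_ultra (x^(k+1)) (x^k) (y^l)
  have u2 := q_ultra (x^(k+1)) (y^l) (y^(l+1))
  have u3 := q_ultra (x*y) (x^(k+1)) (y^(l+1))
  have u4 := q_ultra (x*y) (y^(l+1)) (y*x)
  rw [q_comm (x^(k+1)) (x^k)] at u1
  rw [q_comm (y^(l+1)) (y*x)] at u4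
  have v1 : q (x*y) (x^(k+1)) = 2 * (tau x + tau y) := by rw [q_def]; lia
  have v2 : q (y*x) (y^(l+1)) = 2 * (tau x + tau y) := by rw [q_def]; lia
  have v3 := q_def (x*y) (y*x)
  have v4 := d_nonneg (x*y) (y*x)
  rw [← d_eq_zero]
  lia

/-- `x` and `y` have different attracting ends. -/
def Indep (x y : F) : Prop := ∃ M : ℤ, ∀ k l : ℕ, q (x^k) (y^l) ≤ M

theorem Indep.symm {x y : F} (h : Indep x y) : Indep y x := by
  obtain ⟨M, h⟩ := h
  exact ⟨M, fun k l => by rw [q_comm]; exact h l k⟩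

theorem len_conj_axis (y w : F) (h : d w (y * w) = tau y) : cc (w⁻¹ * y * w) = 0 := by
  have h1 := len_eq_tau (w⁻¹ * y * w)
  have h2 := tau_conj' w y
  rw [d_def, ← mul_assoc] at h
  lia

theorem comm_of_conj {x y w : F} (h : (w⁻¹ * x * w) * (w⁻¹ * y * w) = (w⁻¹ * y * w) * (w⁻¹ * x * w)) :
    x * y = y * x := by
  have e1 : (w⁻¹ * x * w) * (w⁻¹ * y * w) = w⁻¹ * (x * y) * w := by group
  have e2 : (w⁻¹ * y * w) * (w⁻¹ * x * w) = w⁻¹ * (y * x) * w := by group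
  rw [e1, e2] at h
  simpa using h

theorem indep_axis_aux (x w : F) (hx1 : x ≠ 1) (k : ℕ) (r : ℤ) (hr : cc x ≤ r)
    (hw : len w = r) (hw2 : d w (x^k) = len (x^k) - r)
    (hM : 2 * tau x + 8 * r < 2 * len (x^k)) : d w (x * w) = tau x := by
  have c := cc_nonneg x
  have hk : 1 < k := by
    by_contra hk
    have : k = 0 ∨ k = 1 := by lia
    rcases this with h | h
    · subst h
      have := tau_nonneg x
      simp only [pow_zero, len_one] at hM
      lia
    · subst h
      rw [pow_one, len_eq_tau] at hM
      lia
  have := axis x w hx1 0 k (by lia)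
  simp only [zpow_natCast, zpow_zero, d_one_left] at this
  exact this (by lia) (by lia) (by lia)

theorem indep_of_not_comm {x y : F} (h : x * y ≠ y * x) : Indep x y := by
  have hx1 : x ≠ 1 := by rintro rfl; simp at h
  have hy1 : y ≠ 1 := by rintro rfl; simp at h
  have c1 := cc_nonneg x
  have c2 := cc_nonneg y
  set r := cc x + cc y with hr
  refine ⟨2 * (tau x + tau y) + 8 * r, ?_⟩
  by_contra hc
  push Not at hc
  obtain ⟨k, l, hkl⟩ := hc
  have tx := tau_nonneg x
  have ty := tau_nonneg y
  have q1 := q_le_left (x^k) (y^l)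
  have q2 := q_le_right (x^k) (y^l)
  obtain ⟨w, hw, hw2⟩ := geo0 (x^k) r (by lia) (by lia)
  have hw3 : d w (y^l) = len (y^l) - r := by
    have a1 := q_ultra w (x^k) (y^l)
    have a2 := q_le_left w (y^l)
    have a3 := q_def w (y^l)
    have a4 := q_def w (x^k)
    lia
  have ax := indep_axis_aux x w hx1 k r (by lia) hw hw2 (by lia)
  have ay := indep_axis_aux y w hy1 l r (by lia) hw hw3 (by lia)
  apply h
  apply comm_of_conj (w := w)
  apply fw _ _ (len_conj_axis _ _ ax) (len_conj_axis _ _ ay) k l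
  rw [tau_conj', tau_conj']
  have e1 (z : F) (k : ℕ) : (w⁻¹ * z * w)^k = w⁻¹ * (z^k * w) := by
    have := conj_pow (i := k) (a := w⁻¹) (b := z)
    rw [inv_inv] at this; rw [this, mul_assoc]
  rw [q_def, e1, e1, d_mul, ← d_def, ← d_def]
  have b1 : d (x^k) (x^k * w) = r := by rw [d_def, ← hw]; simp
  have b2 : d (y^l) (y^l * w) = r := by rw [d_def, ← hw]; simp
  have b3 := d_tri w (x^k * w) (x^k)
  have b4 := d_tri w (y^l * w) (y^l)
  have b5 := d_tri (x^k * w) (x^k) (y^l * w)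
  have b6 := d_tri (x^k) (y^l) (y^l * w)
  have b7 := q_def (x^k) (y^l)
  rw [d_comm (x^k * w) (x^k)] at b3 b5
  rw [d_comm (y^l * w) (y^l)] at b4
  lia

theorem q_pow (y : F) (k l : ℕ) : 2 * len (y^k) - cc y ≤ q (y^k) (y^l) ∨
    2 * len (y^l) - cc y ≤ q (y^k) (y^l) := by
  have c := cc_nonneg y
  have key : ∀ k l : ℕ, k ≤ l → 2 * len (y^k) - cc y ≤ q (y^k) (y^l) := by
    intro k l h
    rcases Nat.eq_zero_or_pos k with h0 | h0
    · subst h0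
      have := q_nonneg (y^0) (y^l)
      simp only [pow_zero, len_one] at *
      lia
    rcases Nat.eq_or_lt_of_le h with h1 | h1
    · subst h1; rw [q_def]; simp; lia
    · obtain ⟨m, rfl⟩ : ∃ m, l = k + m := ⟨l - k, by lia⟩
      have : d (y^k) (y^(k+m)) = len (y^m) := by rw [d_def, pow_add]; simp
      rw [q_def, this, len_powk y k h0, len_powk y _ (by lia : 1 ≤ k + m), len_powk y m (by lia)]
      push_cast
      nlinarith
  rcases le_total k l with h | h
  · left; exact key k l h
  · right; rw [q_comm]; exact key l k h

theorem par_trans {x y z : F} (h1 : ¬ Indep x y) (h2 : ¬ Indep y z) : ¬ Indep x z := by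
  rintro ⟨M, hM⟩
  unfold Indep at h1 h2
  push Not at h1 h2
  obtain ⟨k, l, a1⟩ := h1 (M + cc y)
  obtain ⟨l', m, a2⟩ := h2 (M + cc y)
  have c := cc_nonneg y
  have b1 := q_le_right (x^k) (y^l)
  have b2 := q_le_left (y^l') (z^m)
  have b3 := q_pow y l l'
  have b4 := q_ultra (x^k) (y^l) (y^l')
  have b5 := q_ultra (x^k) (y^l') (z^m)
  have := hM k m
  lia

theorem comm_par {x y : F} (hx : x ≠ 1) (hy : y ≠ 1) (h : x * y = y * x) :
    ¬ Indep x y ∨ ¬ Indep x y⁻¹ := by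
  by_contra hc
  push Not at hc
  obtain ⟨⟨M1, h1⟩, ⟨M2, h2⟩⟩ := hc
  generalize hk : (M1 + M2).natAbs + 1 = k
  have i1 := h1 k k
  have i2 := h2 k k
  have l1 := len_pow_ge x hx k
  have l2 := len_pow_ge y hy k
  have hc : x^k * y^k = y^k * x^k := (Commute.pow_pow h k k : _)
  rw [q_def] at i1 i2
  rw [inv_pow] at i2
  have e1 : d (x^k) (y^k)⁻¹ = len (x^k * y^k) := by
    rw [d_comm, d_def, inv_inv, hc]
  have e2 := fp (x^k) (y^k) 1 (x^k * y^k)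
  have e3 : d (y^k) (x^k * y^k) = len (x^k) := by rw [hc, d_def]; simp
  have e4 : d (x^k) (x^k * y^k) = len (y^k) := by rw [d_def]; simp
  simp only [d_one_left, d_one_right] at e2
  rw [len_inv] at i2
  lia

theorem comm_of_par {x y : F} (h : ¬ Indep x y) : x * y = y * x := by
  by_contra hc
  exact h (indep_of_not_comm hc)

theorem comm_inv_right {x y : F} (h : x * y = y * x) : x * y⁻¹ = y⁻¹ * x :=
  (Commute.inv_right (show Commute x y from h) : _)

theorem comm_inv_right_iff {x y : F} : x * y⁻¹ = y⁻¹ * x ↔ x * y = y * x :=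
  ⟨fun h => by simpa using comm_inv_right h, comm_inv_right⟩

theorem comm_trans {n : ℕ} {F : Type} [Group F] [TG n F] {x y z : F} (hx : x ≠ 1) (hy : y ≠ 1)
    (hz : z ≠ 1) (h1 : x * y = y * x)
    (h2 : y * z = z * y) : x * z = z * x := by
  rcases comm_par hx hy h1 with a | a
  · rcases comm_par hy hz h2 with b | b
    · exact comm_of_par (par_trans a b)
    · rw [← comm_inv_right_iff]
      exact comm_of_par (par_trans a b)
  · have hy' : y⁻¹ ≠ 1 := by simpa using hy
    rcases comm_par hy' hz (comm_inv_right h2.symm).symm with b | b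
    · exact comm_of_par (par_trans a b)
    · rw [← comm_inv_right_iff]
      exact comm_of_par (par_trans a b)

theorem tau_comm1 {x y : F} (h : x * y = y * x) :
    (2 * tau x ≤ 2 * tau y ∨ 2 * tau x ≤ tau (x * y) + tau (x * y⁻¹)) ∧
    (2 * tau y ≤ 2 * tau x ∨ 2 * tau y ≤ tau (x * y) + tau (x * y⁻¹)) ∧
    (tau (x * y) + tau (x * y⁻¹) ≤ 2 * tau x ∨ tau (x * y) + tau (x * y⁻¹) ≤ 2 * tau y) := by
  have base (k : ℕ) (hk : 1 ≤ k) :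
     (2 * (k * tau x + cc x) ≤ 2 * (k * tau y + cc y) ∨
        2 * (k * tau x + cc x) ≤ k * tau (x * y) + cc (x * y) + (k * tau (x * y⁻¹) + cc (x * y⁻¹))) ∧
     (2 * (k * tau y + cc y) ≤ 2 * (k * tau x + cc x) ∨
        2 * (k * tau y + cc y) ≤ k * tau (x * y) + cc (x * y) + (k * tau (x * y⁻¹) + cc (x * y⁻¹))) ∧
     (k * tau (x * y) + cc (x * y) + (k * tau (x * y⁻¹) + cc (x * y⁻¹)) ≤ 2 * (k * tau x + cc x) ∨
     k * tau (x * y) + cc (x * y) + (k * tau (x * y⁻¹) + cc (x * y⁻¹)) ≤ 2 * (k * tau y + cc y)) := by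
    simp only [← len_powk _ k hk]
    have h' : Commute x y := h
    rw [h'.mul_pow, (h'.inv_right).mul_pow, inv_pow]
    have hc : x^k * y^k = y^k * x^k := (h'.pow_pow k k : _)
    have e0 : d (x^k) (y^k) = len (x^k * (y^k)⁻¹) := by
      rw [d_comm, d_def, comm_inv_right hc]
    have e1 := fp (x^k) (y^k) 1 (x^k * y^k)
    have e2 := fp (x^k) 1 (y^k) (x^k * y^k)
    have e5 := fp (y^k) 1 (x^k) (x^k * y^k)
    have e3 : d (y^k) (x^k * y^k) = len (x^k) := by rw [hc, d_def]; simp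
    have e4 : d (x^k) (x^k * y^k) = len (y^k) := by rw [d_def]; simp
    rw [d_comm (y^k) (x^k)] at e5
    simp only [d_one_left, d_one_right, e0, e3, e4] at e1 e2 e5
    generalize len (x^k) = x1 at *
    generalize len (y^k) = x2 at *
    generalize len (x^k * (y^k)⁻¹) = x3 at *
    generalize len (x^k * y^k) = x4 at *
    lia
  refine ⟨lim2 (C := 2 * cc x) (C1 := 2 * cc y) (C2 := cc (x*y) + cc (x*y⁻¹)) ?_,
    lim2 (C := 2 * cc y) (C1 := 2 * cc x) (C2 := cc (x*y) + cc (x*y⁻¹)) ?_,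
    lim2 (C := cc (x*y) + cc (x*y⁻¹)) (C1 := 2 * cc x) (C2 := 2 * cc y) ?_⟩ <;>
  · intro k hk
    have := base k hk
    ring_nf at this ⊢
    tauto

theorem tau_sq (x : F) : tau (x * x) = 2 * tau x := by
  have h1 := len_powk x 4 (by lia)
  have h2 := len_powk x 2 (by lia)
  have e : x * x * (x * x) = x ^ 4 := by simp only [pow_succ, pow_zero, one_mul, mul_assoc]
  have e2 : x * x = x ^ 2 := by rw [pow_two]
  rw [tau, e, e2, h1, h2]; push_cast; ring

theorem tau_comm {x y : F} (hx : x ≠ 1) (hy : y ≠ 1) (h : x * y = y * x) :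
    (tau (x * y) = tau x + tau y ∧ tau (x * y⁻¹) = |tau x - tau y|) ∨
    (tau (x * y⁻¹) = tau x + tau y ∧ tau (x * y) = |tau x - tau y|) := by
  have h' : Commute x y := h
  have h1 := tau_comm1 h
  have h2 := tau_comm1 (x := x * y) (y := x * y⁻¹)
    (((Commute.refl x).mul_left h'.symm).mul_right (h'.inv_right.mul_left ((Commute.refl y).inv_right)))
  have e1 : x * y * (x * y⁻¹) = x * x := by
    rw [h]; group; simp [mul_assoc, ← h]
  have e2 : x * y * (x * y⁻¹)⁻¹ = y * y := by
    rw [mul_inv_rev, inv_inv, mul_assoc, ← mul_assoc y, (h'.symm.mul_left h'.symm).inv_right.eq,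
      mul_inv_cancel_left]
  rw [e1, e2, tau_sq, tau_sq] at h2
  have t1 := tau_pos hx
  have t2 := tau_pos hy
  have t3 := tau_nonneg (x * y)
  have t4 := tau_nonneg (x * y⁻¹)
  rcases abs_cases (tau x - tau y) with ⟨ha, _⟩ | ⟨ha, _⟩ <;> rw [ha] <;>
  generalize tau x = x1 at * <;>
  generalize tau y = x2 at * <;>
  generalize tau (x * y) = x3 at * <;>
  generalize tau (x * y⁻¹) = x4 at * <;> lia

theorem tau_eq_zero {x : F} (h : tau x ≤ 0) : x = 1 := by
  by_contra hc
  have := tau_pos hc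
  lia

theorem cent_cyclic {n : ℕ} {F : Type} [Group F] [TG n F] (g : F) (hg : g ≠ 1) :
    ∃ r : F, r ≠ 1 ∧ r * g = g * r ∧ ∀ x, x * g = g * x → ∃ k : ℤ, x = r ^ k := by
  have hex : ∃ m : ℕ, ∃ r : F, r ≠ 1 ∧ r * g = g * r ∧ tau r = m :=
    ⟨(tau g).toNat, g, hg, rfl, by have := tau_nonneg g; lia⟩
  classical
  obtain ⟨r, hr1, hr2, hr3⟩ := Nat.find_spec hex
  have hmin : ∀ x : F, x ≠ 1 → x * g = g * x → tau r ≤ tau x := by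
    intro x h1 h2
    have := Nat.find_min' hex ⟨x, h1, h2, (by have := tau_nonneg x; lia : tau x = ((tau x).toNat : ℕ))⟩
    have := tau_nonneg x
    lia
  refine ⟨r, hr1, hr2, ?_⟩
  have key : ∀ m : ℕ, ∀ x : F, x * g = g * x → tau x ≤ m → ∃ k : ℤ, x = r ^ k := by
    intro m
    induction m with
    | zero => intro x _ h; exact ⟨0, by rw [zpow_zero]; exact tau_eq_zero (by simpa using h)⟩
    | succ m ih =>
      intro x hx hm
      by_cases hx1 : x = 1
      · exact ⟨0, by simp [hx1]⟩
      have h1 := hmin x hx1 hx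
      have h2 := tau_pos hr1
      have hxr : x * r = r * x := comm_trans hx1 hg hr1 hx hr2.symm
      have c1 : x * r * g = g * (x * r) :=
        ((show Commute x g from hx).mul_left (show Commute r g from hr2) : _)
      have c2 : x * r⁻¹ * g = g * (x * r⁻¹) :=
        ((show Commute x g from hx).mul_left (show Commute r g from hr2).inv_left : _)
      have ha : |tau x - tau r| = tau x - tau r := abs_of_nonneg (by lia)
      rcases tau_comm hx1 hr1 hxr with ⟨_, h⟩ | ⟨_, h⟩
      · obtain ⟨k, hk⟩ := ih _ c2 (by push_cast at hm; lia)
        exact ⟨k + 1, by rw [zpow_add_one, ← hk]; group⟩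
      · obtain ⟨k, hk⟩ := ih _ c1 (by push_cast at hm; lia)
        exact ⟨k - 1, by rw [zpow_sub_one, ← hk]; group⟩
  intro x hx
  exact key (tau x).toNat x hx (by lia)

theorem aut_comm {n : ℕ} {F : Type} [Group F] [TG n F] (g : F) (hg : g ≠ 1) (σ : F ≃* F) (h : σ g * g = g * σ g) :
    σ g = g ∨ σ g = g⁻¹ := by
  obtain ⟨r, hr1, hr2, hr3⟩ := cent_cyclic g hg
  have hσg : σ g ≠ 1 := by simpa using hg
  have hσr : σ r ≠ 1 := by simpa using hr1
  obtain ⟨k, hk⟩ := hr3 g rfl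
  have s1 : σ r * σ g = σ g * σ r := by rw [← map_mul, hr2, map_mul]
  obtain ⟨a, ha⟩ := hr3 (σ r) (comm_trans hσr hσg hg s1 h)
  have s2 : r * σ g = σ g * r := comm_trans hr1 hg hσg hr2 h.symm
  obtain ⟨b, hb⟩ := hr3 (σ.symm r) (by
    apply σ.injective; rw [map_mul, map_mul]; simpa using s2)
  have hab : r = r ^ (a * b) := by
    have := congrArg σ hb
    rw [map_zpow, ha, ← zpow_mul] at this
    simpa using this
  have hab1 : a * b = 1 := by
    by_contra hne
    have h1 : r ^ (a * b - 1) = 1 := by rw [zpow_sub_one, ← hab]; simp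
    have h2 : r ^ (a * b - 1).natAbs = 1 := by
      rcases Int.natAbs_eq (a * b - 1) with h | h
      · rw [← zpow_natCast, ← h, h1]
      · rw [← zpow_natCast, ← neg_neg ((_ : ℕ) : ℤ), ← h, zpow_neg, h1, inv_one]
    exact pow_ne_one' hr1 (by lia) h2
  have ha1 : a = 1 ∨ a = -1 := by
    have := Int.isUnit_iff.mp (IsUnit.of_mul_eq_one b hab1)
    exact this
  have hgk : σ g = (r ^ a) ^ k := by rw [← ha, ← map_zpow, ← hk]
  rcases ha1 with rfl | rfl
  · left; rw [hgk, zpow_one, ← hk]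
  · right; rw [hgk, zpow_neg_one, inv_zpow, ← hk]

/-- conjugating to something commuting -/
theorem conj_comm {n : ℕ} {F : Type} [Group F] [TG n F] (g v : F) (hg : g ≠ 1) (h : (v * g * v⁻¹) * g = g * (v * g * v⁻¹)) :
    v * g = g * v := by
  have := aut_comm g hg (MulAut.conj v) (by simpa using h)
  simp only [MulAut.conj_apply] at this
  rcases this with h1 | h1
  · rw [mul_inv_eq_iff_eq_mul] at h1; exact h1
  · -- v g v⁻¹ = g⁻¹ so v² commutes with g
    rw [mul_inv_eq_iff_eq_mul] at h1
    by_cases hv : v = 1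
    · simp [hv]
    have hv2 : v * v ≠ 1 := fun h => hv (sq_one v h)
    have h2 : v * (v * v) = (v * v) * v := by group
    have h3 : (v * v) * g = g * (v * v) := by
      have h4 : v * g⁻¹ = g * v := by
        have : g * (v * g) * g⁻¹ = g * (g⁻¹ * v) * g⁻¹ := by rw [h1]
        simp [mul_assoc] at this
        exact this.symm
      rw [mul_assoc, h1, ← mul_assoc, h4, mul_assoc]
    exact comm_trans hv hv2 hg h2 h3

end Comm
end AH

namespace AH
section Ends
open TG Filter
variable {n : ℕ} {F : Type} [Group F] [TG n F]

theorem near (x s s' : F) (hx : x ≠ 1) (M : ℤ) :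
    ∃ K : ℕ, ∀ k ≥ K, ∀ k' ≥ K, M < q (x^k * s) (x^k' * s') := by
  refine ⟨(M + cc x + 2 * len s + 2 * len s').natAbs + 1, ?_⟩
  intro k hk k' hk'
  have a1 := len_pow_ge x hx k
  have a2 := len_pow_ge x hx k'
  have c := cc_nonneg x
  have l1 := len_nonneg s
  have l2 := len_nonneg s'
  have e1 : d (x^k * s) (x^k) = len s := by rw [d_comm, d_def]; simp
  have e2 : d (x^k') (x^k' * s') = len s' := by rw [d_def]; simp
  have b1 := q_ultra (x^k * s) (x^k) (x^k')
  have b2 := q_ultra (x^k * s) (x^k') (x^k' * s')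
  have b3 := q_pow x k k'
  have f1 := q_def (x^k * s) (x^k)
  have f2 := q_def (x^k') (x^k' * s')
  have g1 := d_tri1 (x^k) (x^k * s)
  have g2 := d_tri1 (x^k') (x^k' * s')
  rw [d_comm] at g1
  have M0 : M + cc x + 2 * len s + 2 * len s' < k := by lia
  have M1 : M + cc x + 2 * len s + 2 * len s' < k' := by lia
  have M2 : 0 < (k:ℤ) := by lia
  have M3 : 0 < (k':ℤ) := by lia
  clear hk hk'
  generalize len (x^k) = x1 at *
  generalize len (x^k') = x2 at *
  lia

theorem stab {x y : F} (hx : x ≠ 1) (hy : y ≠ 1) (h : Indep x y) :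
    ∃ c, ∀ s t : F, ∃ K : ℕ, ∀ k ≥ K, ∀ l ≥ K, q (x^k * s) (y^l * t) = c := by
  obtain ⟨M, hM⟩ := h
  obtain ⟨K1, h1⟩ := near x 1 1 hx M
  obtain ⟨K2, h2⟩ := near y 1 1 hy M
  simp only [mul_one] at h1 h2
  refine ⟨q (x^K1) (y^K2), fun s t => ?_⟩
  obtain ⟨K3, h3⟩ := near x 1 s hx M
  obtain ⟨K4, h4⟩ := near y 1 t hy M
  simp only [mul_one] at h3 h4
  refine ⟨K3 + K4, fun k hk l hl => ?_⟩
  have a1 := h1 K1 le_rfl (K1 + K3) (by lia)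
  have a2 := h2 K2 le_rfl (K2 + K4) (by lia)
  have a3 := h3 (K1 + K3) (by lia) k (by lia)
  have a4 := h4 (K2 + K4) (by lia) l (by lia)
  have b := hM K1 K2
  have c1 := q_ultra (x^K1) (x^(K1+K3)) (x^k * s)
  have c2 := q_ultra (y^K2) (y^(K2+K4)) (y^l * t)
  have d1 := q_ultra (x^K1) (x^k * s) (y^K2)
  have d2 := q_ultra (x^k * s) (x^K1) (y^K2)
  have d3 := q_ultra (x^k * s) (y^K2) (y^l * t)
  have d4 := q_ultra (x^k * s) (y^l * t) (y^K2)
  rw [q_comm (x^k * s) (x^K1)] at d2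
  rw [q_comm (y^l * t) (y^K2)] at d4
  lia

open Classical in
/-- limiting (double) Gromov product of the two attracting ends -/
def Q (x y : F) : ℤ :=
  if h : ∃ c, ∀ s t : F, ∃ K : ℕ, ∀ k ≥ K, ∀ l ≥ K, q (x^k * s) (y^l * t) = c then h.choose else 0

theorem Q_spec {x y : F} (hx : x ≠ 1) (hy : y ≠ 1) (h : Indep x y) (s t : F) :
    ∃ K : ℕ, ∀ k ≥ K, ∀ l ≥ K, q (x^k * s) (y^l * t) = Q x y := by
  have := stab hx hy h
  rw [Q, dif_pos this]
  exact this.choose_spec s t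

theorem Q_ev2 {x y : F} (hx : x ≠ 1) (hy : y ≠ 1) (h : Indep x y) (i j : ℕ) (s t : F) :
    ∀ᶠ k : ℕ in atTop, q (x^(k+i) * s) (y^(k+j) * t) = Q x y := by
  obtain ⟨K, hK⟩ := Q_spec hx hy h s t
  filter_upwards [eventually_ge_atTop K] with k hk
  exact hK _ (by lia) _ (by lia)

theorem Q_ev {x y : F} (hx : x ≠ 1) (hy : y ≠ 1) (h : Indep x y) :
    ∀ᶠ k : ℕ in atTop, q (x^k) (y^k) = Q x y := by
  simpa using Q_ev2 hx hy h 0 0 1 1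

theorem Q_nonneg {x y : F} (hx : x ≠ 1) (hy : y ≠ 1) (h : Indep x y) : 0 ≤ Q x y := by
  obtain ⟨k, hk⟩ := (Q_ev hx hy h).exists
  rw [← hk]; exact q_nonneg _ _

theorem Q_symm {x y : F} (hx : x ≠ 1) (hy : y ≠ 1) (h : Indep x y) : Q x y = Q y x := by
  obtain ⟨k, hk, hk'⟩ := ((Q_ev hx hy h).and (Q_ev hy hx h.symm)).exists
  rw [← hk, ← hk', q_comm]

theorem Q_ultra {x y z : F} (hx : x ≠ 1) (hy : y ≠ 1) (hz : z ≠ 1) (h1 : Indep x y)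
    (h2 : Indep y z) (h3 : Indep x z) : Q x y ≤ Q x z ∨ Q y z ≤ Q x z := by
  obtain ⟨k, hk, hk', hk''⟩ := ((Q_ev hx hy h1).and ((Q_ev hy hz h2).and (Q_ev hx hz h3))).exists
  rw [← hk, ← hk', ← hk'']; exact q_ultra _ _ _

theorem q_pow_inv (x : F) (k l : ℕ) (hk : 1 ≤ k) (hl : 1 ≤ l) : q (x^k) (x⁻¹^l) = cc x := by
  have : d (x^k) (x⁻¹^l) = len (x^(k+l)) := by
    rw [d_comm, d_def, inv_pow, inv_inv, ← pow_add, add_comm]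
  rw [q_def, this, len_powk _ _ hk, len_powk _ _ hl, len_powk _ _ (by lia : 1 ≤ k + l), tau_inv, cc_inv]
  push_cast; ring

theorem indep_inv (x : F) : Indep x x⁻¹ := by
  refine ⟨cc x, fun k l => ?_⟩
  have c := cc_nonneg x
  rcases Nat.eq_zero_or_pos k with h | h
  · have := q_le_left (x^k) (x⁻¹^l)
    have e : len (x^k) = 0 := by simp [h]
    lia
  rcases Nat.eq_zero_or_pos l with h' | h'
  · have := q_le_right (x^k) (x⁻¹^l)
    have e : len (x⁻¹^l) = 0 := by simp [h']
    lia
  exact (q_pow_inv x k l h h').le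

theorem Q_inv (x : F) (hx : x ≠ 1) : Q x x⁻¹ = cc x := by
  obtain ⟨k, hk, hk'⟩ := ((Q_ev hx (inv_ne_one.mpr hx) (indep_inv x)).and (eventually_ge_atTop 1)).exists
  rw [← hk, q_pow_inv x k k hk' hk']

/-- noncommuting -/
def NC (x y : F) : Prop := x * y ≠ y * x

theorem NC.symm {n : ℕ} {F : Type} [Group F] [TG n F] {x y : F} (h : NC x y) : NC y x := Ne.symm h
theorem NC.inv_right {n : ℕ} {F : Type} [Group F] [TG n F] {x y : F} (h : NC x y) : NC x y⁻¹ :=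
  fun h' => h (comm_inv_right_iff.mp h')
theorem NC.inv_left {n : ℕ} {F : Type} [Group F] [TG n F] {x y : F} (h : NC x y) : NC x⁻¹ y := h.symm.inv_right.symm
theorem NC.ne1 {n : ℕ} {F : Type} [Group F] [TG n F] {x y : F} (h : NC x y) : x ≠ 1 := by rintro rfl; simp [NC] at h
theorem NC.ne2 {n : ℕ} {F : Type} [Group F] [TG n F] {x y : F} (h : NC x y) : y ≠ 1 := h.symm.ne1
theorem NC.indep {x y : F} (h : NC x y) : Indep x y := indep_of_not_comm h
theorem NC.map {n : ℕ} {F : Type} [Group F] [TG n F] {x y : F} (h : NC x y) (φ : F ≃* F) : NC (φ x) (φ y) := by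
  intro h'
  rw [← map_mul, ← map_mul] at h'
  exact h (φ.injective h')

theorem Q_nc_ev {x y : F} (h : NC x y) : ∀ᶠ k : ℕ in atTop, q (x^k) (y^k) = Q x y :=
  Q_ev h.ne1 h.ne2 h.indep

theorem Q_nc_symm {x y : F} (h : NC x y) : Q x y = Q y x := Q_symm h.ne1 h.ne2 h.indep

/-- coordinate of the attracting end of `x` along the axis of `y` (times two) -/
def E (y x : F) : ℤ := Q y x - Q y⁻¹ x

theorem E_inv (y x : F) : E y⁻¹ x = - E y x := by simp [E]

theorem E_ev (y x : F) (h : NC y x) (i j : ℕ) (s t : F) : ∀ᶠ k : ℕ in atTop,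
    E y x = len (y^(k+i) * s) - len (y⁻¹^(k+j) * s) - d (y^(k+i) * s) (x^k * t)
      + d (y⁻¹^(k+j) * s) (x^k * t) := by
  have h1 := Q_ev2 h.ne1 h.ne2 h.indep i 0 s t
  have h2 := Q_ev2 h.inv_left.ne1 h.ne2 h.inv_left.indep j 0 s t
  filter_upwards [h1, h2] with k k1 k2
  rw [add_zero] at k1 k2
  rw [E, ← k1, ← k2, q_def, q_def]
  ring

theorem E_shift (y x : F) (h : NC y x) : E y (y * x * y⁻¹) = E y x + 2 * tau y := by
  have h' : NC y (y * x * y⁻¹) := by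
    have := h.map (MulAut.conj y)
    simpa using this
  obtain ⟨k, h1, h2, h3⟩ := ((E_ev y x h 0 2 1 y⁻¹).and ((E_ev y _ h' 1 1 1 1).and
    (eventually_ge_atTop 1))).exists
  rw [h1, h2, conj_pow]
  simp only [mul_one, add_zero]
  have e1 : d (y^(k+1)) (y * x^k * y⁻¹) = d (y^k) (x^k * y⁻¹) := by
    rw [pow_succ', mul_assoc, d_mul]
  have e2 : d (y⁻¹^(k+1)) (y * x^k * y⁻¹) = d (y⁻¹^(k+2)) (x^k * y⁻¹) := by
    have : y⁻¹^(k+1) = y * y⁻¹^(k+2) := by rw [pow_succ' _ (k+1)]; simp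
    rw [this, mul_assoc, d_mul]
  rw [e1, e2]
  rw [len_powk y k h3, len_powk y _ (by lia : 1 ≤ k + 1), len_powk _ _ (by lia : 1 ≤ k + 1),
    len_powk _ _ (by lia : 1 ≤ k + 2), tau_inv]
  push_cast
  ring

theorem E_shift_inv (y x : F) (h : NC y x) : E y (y⁻¹ * x * y) = E y x - 2 * tau y := by
  have := E_shift y⁻¹ x h.inv_left
  rw [E_inv, E_inv, tau_inv, inv_inv] at this
  lia

theorem E_zshift (y x : F) (h : NC y x) (m : ℤ) :
    NC y (y^m * x * y^(-m)) ∧ E y (y^m * x * y^(-m)) = E y x + 2 * m * tau y := by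
  have hn (m : ℤ) : NC y (y^m * x * y^(-m)) := by
    have := h.map (MulAut.conj (y^m))
    simp only [MulAut.conj_apply] at this
    have e : y^m * y * (y^m)⁻¹ = y := by group
    rw [e] at this
    rw [zpow_neg]; exact this
  refine ⟨hn m, ?_⟩
  induction m using Int.induction_on with
  | zero => simp
  | succ m ih =>
    have := E_shift y _ (hn m)
    have e : y * (y ^ (m:ℤ) * x * y ^ (-(m:ℤ))) * y⁻¹ = y ^ ((m:ℤ)+1) * x * y ^ (-((m:ℤ)+1)) := by group
    rw [e] at this
    rw [this, ih]; ring
  | pred m ih =>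
    have := E_shift_inv y _ (hn (-m))
    have e : y⁻¹ * (y ^ (-(m:ℤ)) * x * y ^ (- -(m:ℤ))) * y = y ^ (-(m:ℤ)-1) * x * y ^ (-(-(m:ℤ)-1)) := by group
    rw [e] at this
    rw [this, ih]; ring

theorem E_conj (c y x z : F) (hx : NC y x) (hz : NC y z) :
    E (c * y * c⁻¹) (c * x * c⁻¹) - E (c * y * c⁻¹) (c * z * c⁻¹) = E y x - E y z := by
  have hx' : NC (c * y * c⁻¹) (c * x * c⁻¹) := hx.map (MulAut.conj c)
  have hz' : NC (c * y * c⁻¹) (c * z * c⁻¹) := hz.map (MulAut.conj c)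
  obtain ⟨k, h1, h2, h3, h4⟩ := ((E_ev _ _ hx' 0 0 1 1).and ((E_ev _ _ hz' 0 0 1 1).and
    ((E_ev _ _ hx 0 0 c⁻¹ c⁻¹).and (E_ev _ _ hz 0 0 c⁻¹ c⁻¹)))).exists
  rw [h1, h2, h3, h4]
  have e : (c * y * c⁻¹)⁻¹ = c * y⁻¹ * c⁻¹ := by group
  rw [e]
  simp only [mul_one, add_zero, conj_pow]
  simp only [mul_assoc, d_mul]
  ring

theorem E_conj' (c y x z : F) (hx : NC y x) (hz : NC y z) :
    E (MulAut.conj c y) (MulAut.conj c x) - E (MulAut.conj c y) (MulAut.conj c z) = E y x - E y z :=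
  E_conj c y x z hx hz

theorem Q_fw (x y : F) (h : NC x y) (cx : cc x = 0) (cy : cc y = 0) :
    0 ≤ Q x y ∧ Q x y ≤ 2 * (tau x + tau y) := by
  obtain ⟨k, hk⟩ := (Q_nc_ev h).exists
  rw [← hk]
  refine ⟨q_nonneg _ _, ?_⟩
  by_contra hc
  exact h (fw x y cx cy k k (by lia))

theorem Q2_aux (x y : F) (h : NC y x) (hlt : E y x⁻¹ < E y x) :
    E y x - E y x⁻¹ ≤ 4 * (tau x + tau y) := by
  have ev1 := E_ev y x h 0 0 1 1
  have ev2 := E_ev y x⁻¹ h.inv_right 0 0 1 1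
  have ev3 := Q_nc_ev h.symm
  have ev4 := Q_nc_ev h.symm.inv_left
  obtain ⟨k, h1, h2, h3, h4, hk⟩ := (ev1.and (ev2.and (ev3.and (ev4.and (eventually_ge_atTop
     ((E y x).natAbs + (Q x y).natAbs + (Q x⁻¹ y).natAbs + (tau x + cc x + tau y + cc y).natAbs + 10)))))).exists
  simp only [add_zero, mul_one] at h1 h2
  have tx := tau_pos h.ne2
  have ty := tau_pos h.ne1
  have cx := cc_nonneg x
  have cy := cc_nonneg y
  have lx := len_powk x k (by lia)
  have ly := len_powk y k (by lia)
  have lx' := len_powk x⁻¹ k (by lia)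
  have ly' := len_powk y⁻¹ k (by lia)
  rw [tau_inv, cc_inv] at lx' ly'
  have kx : (k:ℤ) ≤ k * tau x := by nlinarith
  have ky : (k:ℤ) ≤ k * tau y := by nlinarith
  have qy := q_pow_inv y k k (by lia) (by lia)
  have qx := q_pow_inv x k k (by lia) (by lia)
  rw [q_def] at h3 h4 qx qy
  obtain ⟨m, m1, m2, m3⟩ := median (y^k) (y⁻¹^k) (x^k)
  rw [d_comm (x^k)] at h3
  rw [d_comm (x⁻¹^k)] at h4
  have p1 := fp m (x⁻¹^k) (y^k) (y⁻¹^k)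
  have p2 := fp (x^k) (x⁻¹^k) (y^k) (y⁻¹^k)
  have p3 := fp (x⁻¹^k) (y^k) (x^k) (y⁻¹^k)
  have p4 := d_tri (x^k) m (x⁻¹^k)
  have s1 := d_comm m (y^k)
  have s2 := d_comm m (y⁻¹^k)
  have s3 := d_comm (x^k) m
  have s4 := d_comm (x^k) (y^k)
  have s5 := d_comm (x^k) (y⁻¹^k)
  have s6 := d_comm (x⁻¹^k) (y^k)
  have s7 := d_comm (x⁻¹^k) (y⁻¹^k)
  have s8 := d_comm (x⁻¹^k) (x^k)
  have p5 := fp (x^k) (y⁻¹^k) (x⁻¹^k) (y^k)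
  have M2 : (tau x + cc x + tau y + cc y) + |E y x| + |Q x y| + |Q x⁻¹ y| + 10 ≤ k := by
    have hk' : (((E y x).natAbs + (Q x y).natAbs + (Q x⁻¹ y).natAbs + (tau x + cc x + tau y + cc y).natAbs + 10 : ℕ) : ℤ) ≤ k := by exact_mod_cast hk
    simp only [Nat.cast_add, Int.natCast_natAbs] at hk'
    have := le_abs_self (tau x + cc x + tau y + cc y)
    push_cast at hk'
    linarith
  clear hk ev1 ev2 ev3 ev4
  have a1 := le_abs_self (E y x)
  have a2 := neg_le_abs (E y x)
  have a3 := le_abs_self (Q x y)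
  have a4 := neg_le_abs (Q x y)
  have a5 := le_abs_self (Q x⁻¹ y)
  have a6 := neg_le_abs (Q x⁻¹ y)
  have mx : d (x⁻¹^k) m + d m (x^k) = d (x⁻¹^k) (x^k) := by
    rw [d_comm (x⁻¹^k) m, d_comm (x⁻¹^k) (x^k)]
    clear M2 kx ky tx ty cx cy lx ly lx' ly'
    lia
  have iy : (y:F)^(-(k:ℤ)) = y⁻¹^k := by rw [zpow_neg, zpow_natCast, inv_pow]
  have ix : (x:F)^(-(k:ℤ)) = x⁻¹^k := by rw [zpow_neg, zpow_natCast, inv_pow]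
  have ay : d m (y * m) = tau y := by
    have := axis y m h.ne1 (-(k:ℤ)) k (by lia)
    rw [iy, zpow_natCast] at this
    have s := d_comm (y^k) (y⁻¹^k)
    refine this ?_ ?_ ?_
    · lia
    · clear p1 p2 p3 p5; lia
    · clear p1 p2 p3 p5; lia
  have ax : d m (x * m) = tau x := by
    have := axis x m h.ne2 (-(k:ℤ)) k (by lia)
    rw [ix, zpow_natCast] at this
    refine this mx ?_ ?_
    · clear p1 p2 p3 p5
      have r1 := d_tri1 (x⁻¹^k) m
      have r2 := d_tri1 m (y^k)
      lia
    · clear p1 p2 p3 p5; lia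
  have hxm := len_conj_axis x m ax
  have hym := len_conj_axis y m ay
  have hc := E_conj m⁻¹ y x x⁻¹ h h.inv_right
  rw [inv_inv] at hc
  have e : m⁻¹ * x⁻¹ * m = (m⁻¹ * x * m)⁻¹ := by group
  rw [e] at hc
  have hn : NC (m⁻¹ * y * m) (m⁻¹ * x * m) := by
    have := h.map (MulAut.conj m⁻¹)
    simpa using this
  have tx' := tau_conj' m x
  have ty' := tau_conj' m y
  generalize m⁻¹ * x * m = x' at *
  generalize m⁻¹ * y * m = y' at *
  have r1 := Q_fw y' x' hn hym hxm
  have r2 := Q_fw y'⁻¹ x' hn.inv_left (by simpa using hym) hxm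
  have r3 := Q_fw y' x'⁻¹ hn.inv_right hym (by simpa using hxm)
  have r4 := Q_fw y'⁻¹ x'⁻¹ hn.inv_left.inv_right (by simpa using hym) (by simpa using hxm)
  simp only [tau_inv] at r1 r2 r3 r4
  rw [← hc, E, E]
  clear p1 p2 p3 p5 M2
  lia

theorem Q2 (x y : F) (h : NC y x) : |E y x - E y x⁻¹| ≤ 4 * (tau x + tau y) := by
  have t1 := tau_nonneg x
  have t2 := tau_nonneg y
  rcases lt_trichotomy (E y x) (E y x⁻¹) with h1 | h1 | h1
  · have := Q2_aux x⁻¹ y h.inv_right (by simpa using h1)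
    rw [inv_inv, tau_inv] at this
    rw [abs_sub_comm, abs_of_nonneg (by lia)]; exact this
  · rw [h1]; simp; lia
  · rw [abs_of_nonneg (by lia)]; exact Q2_aux x y h h1

end Ends
end AH

namespace AH
open TG
section
variable {n : ℕ} {F : Type} [Group F] [TG n F]

/-- `w` lies on the geodesic from `x` to `y`. -/
def Bt (x w y : F) : Prop := d x w + d w y = d x y

theorem Bt_def (x w y : F) : Bt x w y ↔ d x w + d w y = d x y := Iff.rfl

theorem Bt_mul (g x w y : F) : Bt (g * x) (g * w) (g * y) ↔ Bt x w y := by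
  simp only [Bt, d_mul]

theorem Bt.symm {x w y : F} (h : Bt x w y) : Bt y w x := by
  unfold Bt at *; rw [d_comm y w, d_comm w x, d_comm y x]; lia

theorem Bt_uniq {x y w w' : F} (h : Bt x w y) (h' : Bt x w' y) (e : d x w = d x w') : w = w' := by
  unfold Bt at *
  have := fp x y w w'
  have := d_nonneg w w'
  rw [d_comm y w', d_comm y w] at *
  rw [← d_eq_zero]
  lia

theorem Bt_split {x w y : F} (z : F) (h : Bt x w y) : Bt x w z ∨ Bt z w y := by
  unfold Bt at *
  have := fp x y w z
  have := d_tri x w z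
  have := d_tri z w y
  rw [d_comm w z, d_comm y w, d_comm y z] at *
  lia

theorem Bt_trans {x w y z : F} (h : Bt x w y) (h' : Bt x z w) : Bt x z y := by
  unfold Bt at *
  have := d_tri z w y
  have := d_tri x z y
  lia

theorem Bt_glue {x w y z : F} (h : Bt x w y) (h1 : Bt x z w) : Bt z w y := by
  unfold Bt at *
  have := d_tri z w y
  have := d_tri x z y
  lia

/-- overlapping geodesics concatenate -/
theorem Bt_cat {z m p u : F} (h1 : Bt z m p) (h2 : Bt m p u) (h : m ≠ p) : Bt z p u := by
  unfold Bt at *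
  have := fp z p m u
  have := d_tri z p u
  have : d m p ≠ 0 := fun h' => h (d_eq_zero.mp h')
  have := d_nonneg m p
  rw [d_comm p m] at *
  lia

theorem Bt_left (x y : F) : Bt x x y := by simp [Bt]
theorem Bt_right (x y : F) : Bt x y y := by simp [Bt]

theorem Bt_edge {x w y : F} (h : Bt x w y) (e : d x y ≤ 1) : w = x ∨ w = y := by
  unfold Bt at h
  have := d_nonneg x w
  have := d_nonneg w y
  by_cases h0 : d x w = 0
  · exact Or.inl (d_eq_zero.mp h0).symm
  · exact Or.inr (d_eq_zero.mp (by lia))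

theorem bcc_side (ψ : F ≃* F) (y u m p : F) (t : ℤ)
    (hyp : ∀ z, Bt y z u → Bt (ψ z) m p → d (ψ z) m ≤ t) (hy : Bt (ψ y) m p) (hu : ¬ Bt (ψ u) m p) :
    ∃ a b : F, d a b = 1 ∧ Bt y a u ∧ Bt y b u ∧ Bt (ψ a) m (ψ b) ∧ ∀ z, Bt y z a → d (ψ z) m ≤ t := by
  classical
  have hex : ∃ j : ℕ, ∃ z, Bt y z u ∧ d y z = j ∧ ¬ Bt (ψ z) m p :=
    ⟨(d y u).toNat, u, Bt_right _ _, by have := d_nonneg y u; lia, hu⟩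
  obtain ⟨b, hb, hj, hnb⟩ := Nat.find_spec hex
  have hmin : ∀ z, Bt y z u → d y z < (Nat.find hex : ℤ) → Bt (ψ z) m p := by
    intro z hz hlt
    by_contra hc
    have := d_nonneg y z
    exact Nat.find_min hex (m := (d y z).toNat) (by lia) ⟨z, hz, by lia, hc⟩
  generalize Nat.find hex = j at *
  have hj0 : j ≠ 0 := by
    rintro rfl
    have : y = b := d_eq_zero.mp (by simpa using hj)
    exact hnb (this ▸ hy)
  obtain ⟨a, ha, ha'⟩ := geo y b (j-1) (by lia) (by lia)
  have hab : Bt y a b := by unfold Bt; lia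
  have hau := Bt_trans hb hab
  refine ⟨a, b, by lia, hau, hb, ?_, ?_⟩
  · have h := hmin a hau (by lia)
    exact (Bt_split (ψ b) h).resolve_right hnb
  · intro z hz
    have hzu := Bt_trans hau hz
    refine hyp z hzu (hmin z hzu ?_)
    have := d_nonneg z a
    unfold Bt at hz
    lia

theorem edge_cases (a b : F) (h : d a b = 1) :
    ∃ c : F, ∃ i : Fin n, (a = c ∧ b = c * gen i) ∨ (b = c ∧ a = c * gen i) := by
  rw [d_def] at h
  obtain ⟨i, hi | hi⟩ := len_one_cases _ h
  · exact ⟨a, i, Or.inl ⟨rfl, by rw [← hi]; group⟩⟩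
  · exact ⟨b, i, Or.inr ⟨rfl, by rw [← inv_inv (gen i : F), ← hi]; group⟩⟩

theorem pt_ex (w : F) (j : ℕ) : ∃ p : F, (j : ℤ) ≤ len w → d 1 p = j ∧ Bt 1 p w := by
  by_cases h : (j : ℤ) ≤ len w
  · obtain ⟨p, h1, h2⟩ := geo 1 w j (by lia) (by rwa [d_one_left])
    exact ⟨p, fun _ => ⟨h1, by unfold Bt; lia⟩⟩
  · exact ⟨1, fun h' => absurd h' h⟩

def pt (w : F) (j : ℕ) : F := (pt_ex w j).choose

theorem pt_spec (w : F) (j : ℕ) (h : (j : ℤ) ≤ len w) : d 1 (pt w j) = j ∧ Bt 1 (pt w j) w :=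
  (pt_ex w j).choose_spec h

/-- the point carried by a label -/
def lp (ψ : F ≃* F) {lam : ℕ} (l : Fin n × Fin (lam + 1)) : F := pt (ψ (gen l.1)) l.2

/-- the relation on labels -/
def R0 (ψ : F ≃* F) (lam : ℕ) (t : ℤ) (l l' : Fin n × Fin (lam+1)) : Prop :=
  ∃ h e e' : F, lp ψ l = ψ h * lp ψ l' ∧ (e = 1 ∨ e = gen l.1) ∧ (e' = 1 ∨ e' = gen l'.1) ∧
    ∀ z, Bt e z (h * e') → d (ψ z) (lp ψ l) ≤ t

theorem len_gen (i : Fin n) : len (gen i : F) = 1 := by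
  have := len_word (F := F) [i]
  simpa using this

theorem Bt_three {a b b' c z : F} (hb : b = b' ∨ d b b' ≤ 1) (h : Bt a z c) : Bt a z b ∨ Bt b' z c := by
  rcases Bt_split b h with h | h
  · exact Or.inl h
  rcases Bt_split b' h with h | h
  · have : z = b ∨ z = b' := by
      refine Bt_edge h ?_
      rcases hb with rfl | hb
      · simp
      · exact hb
    rcases this with rfl | rfl
    · exact Or.inl (Bt_right _ _)
    · exact Or.inr (Bt_left _ _)
  · exact Or.inr h

theorem ends_close {i : Fin n} {e e' : F} (h : e = 1 ∨ e = gen i) (h' : e' = 1 ∨ e' = gen i) : d e e' ≤ 1 := by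
  rcases h with rfl | rfl <;> rcases h' with rfl | rfl <;> simp [d_one_left, d_one_right, len_gen]

theorem R0_symm (ψ : F ≃* F) (lam : ℕ) (t : ℤ) (l l' : Fin n × Fin (lam+1)) (h : R0 ψ lam t l l') :
    R0 ψ lam t l' l := by
  obtain ⟨h, e, e', h1, h2, h3, h4⟩ := h
  have e1 : lp ψ l' = ψ h⁻¹ * lp ψ l := by rw [h1, map_inv]; group
  refine ⟨h⁻¹, e', e, e1, h3, h2, fun z hz => ?_⟩
  have := h4 (h * z) (by
    rw [← Bt_mul h] at hz
    rw [mul_inv_cancel_left] at hz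
    exact hz.symm)
  rw [h1, map_mul, d_mul] at this
  exact this

theorem R0_trans (ψ : F ≃* F) (lam : ℕ) (t : ℤ) (l l' l'' : Fin n × Fin (lam+1)) (h : R0 ψ lam t l l')
    (h' : R0 ψ lam t l' l'') : R0 ψ lam t l l'' := by
  obtain ⟨h, e, e', h1, h2, h3, h4⟩ := h
  obtain ⟨k, f, f', k1, k2, k3, k4⟩ := h'
  refine ⟨h * k, e, f', by rw [h1, k1, map_mul, mul_assoc], h2, k3, fun z hz => ?_⟩
  have hc : d (h * e') (h * f) ≤ 1 := by rw [d_mul]; exact ends_close h3 k2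
  rcases Bt_three (Or.inr hc) hz with hz | hz
  · exact h4 z hz
  · have := k4 (h⁻¹ * z) (by
      rw [← Bt_mul h]
      simpa [mul_assoc] using hz)
    rw [← d_mul (ψ h), ← h1, ← map_mul, mul_inv_cancel_left] at this
    exact this

def RS (ψ : F ≃* F) (lam : ℕ) (t : ℤ) : Setoid (Fin n × Fin (lam+1)) where
  r l l' := l = l' ∨ R0 ψ lam t l l'
  iseqv := ⟨fun _ => Or.inl rfl, by
    rintro x y (rfl | h)
    · exact Or.inl rfl
    · exact Or.inr (R0_symm _ _ _ _ _ h), by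
    rintro x y z (rfl | h) (rfl | h')
    · exact Or.inl rfl
    · exact Or.inr h'
    · exact Or.inr h
    · exact Or.inr (R0_trans _ _ _ _ _ _ h h')⟩

theorem RS_card (ψ : F ≃* F) (lam : ℕ) (B : ℕ)
    (h : ∀ t : ℕ, t < B → ∃ l l', (RS ψ lam t).r l l' ∧ ¬ (RS ψ lam (t-1)).r l l') :
    B ≤ n * (lam + 1) := by
  have key : ∀ t : ℕ, t ≤ B → Nat.card (Quotient (RS ψ lam ((t:ℤ)-1))) + t ≤ n * (lam+1) := by
    intro t
    induction t with
    | zero =>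
      intro _
      have : Nat.card (Quotient (RS ψ lam (((0:ℕ):ℤ)-1))) ≤ Nat.card (Fin n × Fin (lam+1)) :=
        Nat.card_le_card_of_surjective _ Quotient.mk_surjective
      simpa using this
    | succ t ih =>
      intro ht
      have ih := ih (by lia)
      obtain ⟨l, l', h1, h2⟩ := h t (by lia)
      have hle : RS ψ lam ((t:ℤ)-1) ≤ RS ψ lam (((t+1 : ℕ):ℤ)-1) := by
        rintro a b (hab | ⟨h, e, e', q1, q2, q3, q4⟩)
        · exact Or.inl hab
        · exact Or.inr ⟨h, e, e', q1, q2, q3, fun z hz => (q4 z hz).trans (by push_cast; lia)⟩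
      have hfin : Finite (Fin n × Fin (lam+1)) := inferInstance
      let f := Quotient.map' (s₁ := RS ψ lam ((t:ℤ)-1)) (s₂ := RS ψ lam (((t+1:ℕ):ℤ)-1)) id hle
      have hs : Function.Surjective f := by
        intro x
        induction x using Quotient.inductionOn with
        | h a => exact ⟨Quotient.mk'' a, rfl⟩
      have hni : ¬ Function.Injective f := by
        intro hi
        have : (Quotient.mk'' l : Quotient (RS ψ lam ((t:ℤ)-1))) = Quotient.mk'' l' := by
          apply hi
          apply Quotient.sound
          have : (((t+1:ℕ):ℤ)-1) = t := by push_cast; ring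
          rw [this]
          exact h1
        exact h2 (Quotient.exact this)
      let _ := Fintype.ofFinite (Quotient (RS ψ lam ((t:ℤ)-1)))
      let _ := Fintype.ofFinite (Quotient (RS ψ lam (((t+1:ℕ):ℤ)-1)))
      have := Fintype.card_lt_of_surjective_not_injective f hs hni
      rw [Nat.card_eq_fintype_card] at ih
      rw [Nat.card_eq_fintype_card]
      lia
  have := key B le_rfl
  lia

theorem label_ex (ψ : F ≃* F) (lam : ℕ) (hl : ∀ i, len (ψ (gen i)) ≤ lam) (a b m : F) (h : d a b = 1)
    (hm : Bt (ψ a) m (ψ b)) : ∃ c : F, ∃ l : Fin n × Fin (lam+1), m = ψ c * lp ψ l ∧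
      ((a = c ∧ b = c * gen l.1) ∨ (b = c ∧ a = c * gen l.1)) := by
  obtain ⟨c, i, hc⟩ := edge_cases a b h
  have hm' : Bt (ψ c) m (ψ (c * gen i)) := by
    rcases hc with ⟨rfl, rfl⟩ | ⟨rfl, rfl⟩
    · exact hm
    · exact hm.symm
  rw [map_mul] at hm'
  have h2 : Bt 1 ((ψ c)⁻¹ * m) (ψ (gen i)) := by
    rw [← Bt_mul (ψ c)]; simpa using hm'
  have h3 := h2
  rw [Bt_def, d_one_left, d_one_left] at h2
  have := d_nonneg ((ψ c)⁻¹ * m) (ψ (gen i))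
  have := hl i
  have := len_nonneg ((ψ c)⁻¹ * m)
  refine ⟨c, (i, ⟨(len ((ψ c)⁻¹ * m)).toNat, by lia⟩), ?_, hc⟩
  rw [← inv_mul_eq_iff_eq_mul]
  obtain ⟨p1, p2⟩ := pt_spec (ψ (gen i)) (len ((ψ c)⁻¹ * m)).toNat (by lia)
  refine Bt_uniq h3 p2 ?_
  refine Eq.trans ?_ p1.symm
  rw [d_one_left]
  lia

theorem Bt_finite (x y : F) : {z | Bt x z y}.Finite := by
  have := finite_ball (F := F) (d x y)
  refine (this.image (fun w => x * w)).subset ?_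
  intro z hz
  refine ⟨x⁻¹ * z, ?_, by simp⟩
  have := d_nonneg z y
  simp only [Set.mem_ofPred_eq] at hz ⊢
  rw [← d_def]
  unfold Bt at hz
  lia

theorem bcc (ψ : F ≃* F) (lam : ℕ) (hl : ∀ i, len (ψ (gen i)) ≤ lam) (u y w : F) (hy : Bt u y w) :
    d (ψ u) (ψ y) + d (ψ y) (ψ w) ≤ d (ψ u) (ψ w) + 2 * (n * (lam + 1)) := by
  obtain ⟨y, hy, hmax⟩ : ∃ y, Bt u y w ∧ ∀ z, Bt u z w →
      d (ψ u) (ψ z) + d (ψ z) (ψ w) ≤ d (ψ u) (ψ y) + d (ψ y) (ψ w) := by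
    obtain ⟨y', h1, h2⟩ := Set.exists_max_image {z | Bt u z w} (fun z => d (ψ u) (ψ z) + d (ψ z) (ψ w))
      (Bt_finite u w) ⟨y, hy⟩
    exact ⟨y', h1, h2⟩
  refine (hmax _ ‹_›).trans ?_
  obtain ⟨p, p1, p2, p3⟩ := median (ψ y) (ψ u) (ψ w)
  have hp0 := d_nonneg (ψ y) p
  have hB := RS_card ψ lam (d (ψ y) p).toNat ?_
  · rw [d_comm (ψ u) (ψ y)]
    have : (((d (ψ y) p).toNat : ℕ) : ℤ) ≤ ((n * (lam + 1) : ℕ) : ℤ) := by exact_mod_cast hB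
    push_cast at this
    rw [d_comm (ψ u) p] at p3
    generalize (n:ℤ) * (lam + 1) = N at *
    lia
  intro t ht
  obtain ⟨m, m1, m2⟩ := geo (ψ y) p t (by lia) (by lia)
  have hmp : m ≠ p := by
    rintro rfl
    simp at m2; lia
  have hmB : Bt (ψ y) m p := by unfold Bt; lia
  have hmu : Bt m p (ψ u) := Bt_glue p1 hmB
  have hmw : Bt m p (ψ w) := Bt_glue p2 hmB
  have hyp : ∀ z, Bt u z w → Bt (ψ z) m p → d (ψ z) m ≤ t := by
    intro z hz hzm
    have a1 := Bt_cat hzm hmu hmp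
    have a2 := Bt_cat hzm hmw hmp
    have := hmax z hz
    unfold Bt at hzm a1 a2
    rw [d_comm (ψ u), d_comm (ψ u)] at this
    lia
  have nu (v : F) (h : Bt m p (ψ v)) : ¬ Bt (ψ v) m p := by
    intro h'
    unfold Bt at h h'
    rw [d_comm (ψ v) m, d_comm (ψ v) p] at h'
    exact hmp (d_eq_zero.mp (by have := d_nonneg m p; lia))
  have cu : ∀ z, Bt y z u → Bt u z w := fun z hz => Bt_trans hy hz.symm
  have cw : ∀ z, Bt y z w → Bt u z w := fun z hz => (Bt_trans hy.symm hz.symm).symm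
  obtain ⟨a, b, a1, a2, a3, a4, a5⟩ := bcc_side ψ y u m p t (fun z hz => hyp z (cu z hz)) hmB (nu u hmu)
  obtain ⟨a', b', b1, b2, b3, b4, b5⟩ := bcc_side ψ y w m p t (fun z hz => hyp z (cw z hz)) hmB (nu w hmw)
  obtain ⟨c, l, c1, c2⟩ := label_ex ψ lam hl a b m a1 a4
  obtain ⟨c', l', e1, e2⟩ := label_ex ψ lam hl a' b' m b1 b4
  -- any point of the u-edge and any point of the w-edge have y between them
  have sep : ∀ x x', Bt y x u → Bt y x' w → Bt x y x' := by
    intro x x' hx hx'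
    have h1 : Bt x y w := Bt_glue hy hx.symm
    exact (Bt_glue h1.symm hx'.symm).symm
  have uc : Bt y c u ∧ Bt y (c * gen l.1) u := by
    rcases c2 with ⟨r1, r2⟩ | ⟨r1, r2⟩ <;> rw [← r2, ← r1] <;> constructor <;> assumption
  have wc : Bt y c' w ∧ Bt y (c' * gen l'.1) w := by
    rcases e2 with ⟨r1, r2⟩ | ⟨r1, r2⟩ <;> rw [← r2, ← r1] <;> constructor <;> assumption
  refine ⟨l, l', Or.inr ?_, ?_⟩
  · obtain ⟨e, he, hce⟩ : ∃ e, (e = 1 ∨ e = gen l.1) ∧ c * e = a := by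
      rcases c2 with ⟨r1, r2⟩ | ⟨r1, r2⟩
      · exact ⟨1, Or.inl rfl, by rw [r1, mul_one]⟩
      · exact ⟨gen l.1, Or.inr rfl, r2.symm⟩
    obtain ⟨e', he', hce'⟩ : ∃ e, (e = 1 ∨ e = gen l'.1) ∧ c' * e = a' := by
      rcases e2 with ⟨r1, r2⟩ | ⟨r1, r2⟩
      · exact ⟨1, Or.inl rfl, by rw [r1, mul_one]⟩
      · exact ⟨gen l'.1, Or.inr rfl, r2.symm⟩
    refine ⟨c⁻¹ * c', e, e', ?_, he, he', ?_⟩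
    · rw [map_mul, map_inv, mul_assoc, ← e1, c1]; group
    · intro z hz
      rw [← Bt_mul c, hce, mul_assoc, mul_inv_cancel_left, hce'] at hz
      rw [← d_mul (ψ c), ← c1, ← map_mul]
      rcases Bt_split y hz with h | h
      · exact a5 _ h.symm
      · exact b5 _ h
  · rintro (rfl | ⟨h, e, e', q1, q2, q3, q4⟩)
    · have : c = c' := by
        apply ψ.injective
        rw [c1] at e1
        exact mul_right_cancel e1
      subst this
      have h1 := sep _ _ uc.1 wc.1
      have h2 := sep _ _ uc.2 wc.2
      have r1 : c = y := by unfold Bt at h1; rw [d_comm y c] at h1; simp at h1; exact d_eq_zero.mp (by lia)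
      have r2 : c * gen l.1 = y := by unfold Bt at h2; rw [d_comm y] at h2; simp at h2; exact d_eq_zero.mp (by lia)
      have : gen l.1 = (1 : F) := by rw [← r1] at r2; simpa using r2
      have h' := len_gen (F := F) l.1
      rw [this] at h'
      simp at h'
    · have hh : c' = c * h := by
        apply ψ.injective
        rw [c1, q1, ← mul_assoc, ← map_mul] at e1
        exact (mul_right_cancel e1).symm
      have := q4 (c⁻¹ * y) (by
        rw [← Bt_mul c, mul_inv_cancel_left, ← mul_assoc, ← hh]
        apply sep
        · rcases q2 with rfl | rfl
          · rw [mul_one]; exact uc.1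
          · exact uc.2
        · rcases q3 with rfl | rfl
          · rw [mul_one]; exact wc.1
          · exact wc.2)
      rw [← d_mul (ψ c), ← c1, ← map_mul, mul_inv_cancel_left] at this
      lia

end
end AH

namespace AH
open TG
section
variable {n : ℕ} {F : Type} [Group F] [TG n F]

theorem cc_eq_q (y : F) : cc y = q y⁻¹ y := by
  rw [q_def, cc, len_inv, d_def]; simp; ring

theorem q_two {u v : F} (h : q u v ≠ 0) : 2 ≤ q u v := by
  obtain ⟨k, hk⟩ := q_even u v
  have := q_nonneg u v
  lia

theorem min_rep {n : ℕ} {F : Type} [Group F] [TG n F] (i0 : Fin n) (ψ : F ≃* F) : ∃ c : F, ∃ L : ℕ,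
    (∀ i, len (c * ψ (gen i) * c⁻¹) ≤ L) ∧ ∀ v : F, ∃ i, (L : ℤ) ≤ len (v * (c * ψ (gen i) * c⁻¹) * v⁻¹) := by
  classical
  have hex : ∃ L : ℕ, ∃ c : F, ∀ i, len (c * ψ (gen i) * c⁻¹) ≤ L := by
    obtain ⟨M, hM⟩ := (Set.finite_range (fun i => len (ψ (gen i)))).bddAbove
    refine ⟨M.toNat, 1, fun i => ?_⟩
    have := hM ⟨i, rfl⟩
    simp
    lia
  obtain ⟨c, hc⟩ := Nat.find_spec hex
  refine ⟨c, _, hc, fun v => ?_⟩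
  by_contra hcon
  push Not at hcon
  have h0 := hcon i0
  have := len_nonneg (v * (c * ψ (gen i0) * c⁻¹) * v⁻¹)
  refine Nat.find_min hex (m := Nat.find hex - 1) (by lia) ⟨v * c, fun i => ?_⟩
  have h1 := hcon i
  have : v * c * ψ (gen i) * (v * c)⁻¹ = v * (c * ψ (gen i) * c⁻¹) * v⁻¹ := by group
  rw [this]
  lia

theorem len_conj_letter (x b : F) (hx : len x = 1) (h1 : 2 ≤ q x b) (h2 : 2 ≤ q x b⁻¹) (h3 : 2 ≤ len b) :
    len (x⁻¹ * b * x) ≤ len b - 2 := by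
  have e : len (x⁻¹ * b * x) = d x (b * x) := by rw [d_def, mul_assoc]
  have e1 : d (b * x) 1 = d x b⁻¹ := by
    rw [d_comm (b*x) 1, d_comm x, ← d_mul b b⁻¹]; simp
  have e2 : d (b * x) b = len x := by rw [d_def]; simp [len_inv]
  have := fp x (b * x) 1 b
  rw [q_def] at h1 h2
  rw [len_inv] at h2
  rw [e1, d_one_left, d_one_right, e2] at this
  rw [e]
  lia

theorem len_conj_le (x b : F) (hx : len x = 1) : len (x⁻¹ * b * x) ≤ len b + 2 := by
  have := len_mul_le (x⁻¹ * b) x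
  have := len_mul_le x⁻¹ b
  rw [len_inv] at this
  lia

theorem min_tau {n : ℕ} {F : Type} [Group F] [TG n F] (b : Fin n → F) (hb : ∀ i, b i ≠ 1) (L : ℕ)
    (h1 : ∀ i, len (b i) ≤ L) (h2 : ∀ v : F, ∃ i, (L : ℤ) ≤ len (v * b i * v⁻¹)) :
    ∃ i j, (L : ℤ) ≤ 3 * tau (b i * b j) := by
  by_cases hA : ∃ i, (L:ℤ) - 2 ≤ len (b i) ∧ cc (b i) = 0
  · obtain ⟨i, hi, hc⟩ := hA
    refine ⟨i, i, ?_⟩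
    rw [tau_sq]
    have := tau_pos (hb i)
    have := len_eq_tau (b i)
    lia
  push Not at hA
  have hA' : ∀ i, (L:ℤ) - 2 ≤ len (b i) → 2 ≤ q (b i)⁻¹ (b i) := fun i hi => q_two (by
    rw [← cc_eq_q]; exact hA i hi)
  by_cases hB : ∃ i j, (L:ℤ) - 2 ≤ len (b i) ∧ (L:ℤ) - 2 ≤ len (b j) ∧ q (b i) (b j) = 0
  · obtain ⟨i, j, hi, hj, hq⟩ := hB
    refine ⟨i, j, ?_⟩
    have ai := hA' i hi
    have aj := hA' j hj
    have li := len_pos (hb i)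
    have lj := len_pos (hb j)
    have s0 : q (b i) (b j)⁻¹ = 0 := by
      have := q_ultra (b i) (b j)⁻¹ (b j)
      have := q_nonneg (b i) (b j)⁻¹
      lia
    have s1 : q (b i)⁻¹ (b j) = 0 := by
      have := q_ultra (b j) (b i)⁻¹ (b i)
      have := q_nonneg (b i)⁻¹ (b j)
      rw [q_comm (b j) (b i)⁻¹, q_comm (b j) (b i)] at *
      lia
    have hu : len (b i * b j) = len (b i) + len (b j) := by
      rw [q_def, len_inv, d_def, inv_inv] at s1
      lia
    have t1 : q (b i * b j) (b i) = 2 * len (b i) := by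
      rw [q_def, hu, d_comm, d_def]; simp; ring
    have t2 : q (b i * b j)⁻¹ (b j)⁻¹ = 2 * len (b j) := by
      rw [q_def, len_inv, len_inv, hu, d_comm, d_def]; simp [len_inv]; ring
    have t3 : cc (b i * b j) = 0 := by
      rw [cc_eq_q]
      by_contra hne
      have h3 := q_two hne
      have u1 := q_ultra (b i * b j)⁻¹ (b i) (b i * b j)
      have u2 := q_ultra (b i * b j)⁻¹ (b i * b j) (b j)⁻¹
      have u3 := q_ultra (b i * b j) (b j)⁻¹ (b i)
      have u4 := q_ultra (b i) (b i * b j) (b j)⁻¹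
      rw [q_comm (b i) (b i * b j)] at *
      have u5 := q_ultra (b i * b j) (b i * b j)⁻¹ (b j)⁻¹
      rw [q_comm (b i * b j) (b i * b j)⁻¹] at u5
      lia
    have := len_eq_tau (b i * b j)
    lia
  exfalso
  push Not at hB
  obtain ⟨i, hi⟩ := h2 1
  simp only [one_mul, inv_one, mul_one] at hi
  have hci := hA' i (by lia)
  obtain ⟨x, x1, x2⟩ := geo0 (b i) 1 (by lia) (len_pos (hb i))
  have hxi : q x (b i) = 2 := by rw [q_def]; lia
  have hx : ∀ j, (L:ℤ) - 2 ≤ len (b j) → 2 ≤ q x (b j) ∧ 2 ≤ q x (b j)⁻¹ := by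
    intro j hj
    have a1 := q_two (hB i j (by lia) hj)
    have a2 := hA' j hj
    have a3 := q_ultra x (b i) (b j)
    have a4 := q_ultra x (b j) (b j)⁻¹
    rw [q_comm (b j)] at a4
    lia
  obtain ⟨j, hj⟩ := h2 x⁻¹
  rw [inv_inv] at hj
  by_cases hl : (L:ℤ) - 2 ≤ len (b j)
  · obtain ⟨c1, c2⟩ := hx j hl
    have c3 := hA' j hl
    rw [← cc_eq_q] at c3
    have := len_eq_tau (b j)
    have := tau_pos (hb j)
    have := len_conj_letter x (b j) x1 c1 c2 (by lia)
    have := h1 j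
    lia
  · have := len_conj_le x (b j) x1
    lia

def Pos (w : F) : Prop := ∃ l : List (Fin n), w = (l.map gen).prod

theorem Pos.one : Pos (1 : F) := ⟨[], by simp⟩
theorem Pos.gen (i : Fin n) : Pos (gen i : F) := ⟨[i], by simp⟩
theorem Pos.mul {u v : F} (hu : Pos u) (hv : Pos v) : Pos (u * v) := by
  obtain ⟨l, rfl⟩ := hu
  obtain ⟨l', rfl⟩ := hv
  exact ⟨l ++ l', by simp⟩
theorem Pos.pow {u : F} (hu : Pos u) (k : ℕ) : Pos (u ^ k) := by
  induction k with
  | zero => rw [pow_zero]; exact Pos.one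
  | succ k ih => rw [pow_succ]; exact ih.mul hu
theorem Pos.len_mul {u v : F} (hu : Pos u) (hv : Pos v) : len (u * v) = len u + len v := by
  obtain ⟨l, rfl⟩ := hu
  obtain ⟨l', rfl⟩ := hv
  have := len_word (F := F) (l ++ l')
  rw [List.map_append, List.prod_append] at this
  rw [this, len_word, len_word]; simp

theorem Pos.sup {u v : F} (hu : Pos u) (hv : Pos v) (ψ : F ≃* F) (lam : ℕ)
    (hl : ∀ i, len (ψ (TG.gen i)) ≤ lam) :
    len (ψ u) + len (ψ v) - 2 * (n * (lam + 1)) ≤ len (ψ (u * v)) := by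
  have := bcc ψ lam hl 1 u (u * v) (by
    unfold Bt
    rw [d_one_left, d_one_left, hu.len_mul hv, d_def]; simp)
  rw [map_one, d_one_left, d_one_left, d_def (ψ u), ← map_inv, ← map_mul, inv_mul_cancel_left] at this
  lia

/-- the filling word -/
def gP (K : ℕ) (l : List (Fin n × Fin n)) : F := (l.map fun p => (gen p.1 * gen p.2)^K).prod

theorem gP_pos (K : ℕ) (l : List (Fin n × Fin n)) : Pos (gP K l : F) := by
  induction l with
  | nil => simpa [gP] using Pos.one
  | cons p l ih =>
    have : (gP K (p :: l) : F) = (gen p.1 * gen p.2)^K * gP K l := by simp [gP]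
    rw [this]
    exact (((Pos.gen _).mul (Pos.gen _)).pow K).mul ih

theorem gP_len (K : ℕ) (hK : 1 ≤ K) (l : List (Fin n × Fin n)) (p : Fin n × Fin n) (hp : p ∈ l)
    (ψ : F ≃* F) (lam : ℕ) (hl : ∀ i, len (ψ (gen i)) ≤ lam) :
    K * tau (ψ (gen p.1 * gen p.2)) - 2 * (n * (lam + 1)) * l.length ≤ len (ψ (gP K l)) := by
  induction l with
  | nil => simp at hp
  | cons r l ih =>
    have e : (gP K (r :: l) : F) = (gen r.1 * gen r.2)^K * gP K l := by simp [gP]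
    rw [e]
    have s := (((Pos.gen r.1).mul (Pos.gen r.2)).pow K).sup (gP_pos (F := F) K l) ψ lam hl
    have hβ : (0:ℤ) ≤ 2 * (n * (lam + 1)) := by positivity
    rw [List.length_cons]
    push_cast
    generalize (2:ℤ) * (n * (lam + 1)) = β at *
    have h0 : 0 ≤ β * l.length := by positivity
    rw [mul_add, mul_one]
    rcases List.mem_cons.mp hp with rfl | h
    · rw [map_pow, len_powk _ K hK] at s
      have := cc_nonneg (ψ (gen p.1 * gen p.2))
      have := len_nonneg (ψ (gP K l))
      generalize (K:ℤ) * tau (ψ (gen p.1 * gen p.2)) = X at *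
      generalize β * (l.length : ℤ) = Z at *
      lia
    · have := ih h
      have := len_nonneg (ψ ((gen r.1 * gen r.2)^K))
      generalize (K:ℤ) * tau (ψ (gen p.1 * gen p.2)) = X at *
      generalize β * (l.length : ℤ) = Z at *
      lia

theorem Pos.tau_ge {u : F} (hu : Pos u) (ψ : F ≃* F) (lam : ℕ)
    (hl : ∀ i, len (ψ (TG.gen i)) ≤ lam) : len (ψ u) - 2 * (n * (lam + 1)) ≤ tau (ψ u) := by
  have h : ∀ k : ℕ, k * (len (ψ u) - 2 * (n * (lam + 1))) ≤ len (ψ (u ^ k)) := by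
    intro k
    induction k with
    | zero => simp
    | succ k ih =>
      have := (hu.pow k).sup hu ψ lam hl
      rw [← pow_succ] at this
      push_cast
      linarith
  rcases lim2 (A := len (ψ u) - 2 * (n * (lam + 1))) (B := tau (ψ u)) (B' := tau (ψ u)) (C := 0) (C1 := cc (ψ u))
    (C2 := cc (ψ u)) (fun k hk => by
      have := h k
      rw [map_pow, len_powk _ k hk] at this
      left; linarith) with h | h <;> exact h

/-- the filling element -/
def gg {n : ℕ} {F : Type} [Group F] [TG n F] : F := gP (12 * n * (n^2 + 2)) (Finset.univ : Finset (Fin n × Fin n)).toList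

theorem filling {n : ℕ} {F : Type} [Group F] [TG n F] (i0 : Fin n) (ψ : F ≃* F) : ∃ c : F, ∃ L : ℕ,
    (∀ i, len (c * ψ (gen i) * c⁻¹) ≤ L) ∧ 2 * (n * ((L:ℤ) + 1)) ≤ tau (ψ gg) := by
  obtain ⟨c, L, h1, h2⟩ := min_rep i0 ψ
  have hne : ∀ i, c * ψ (gen i) * c⁻¹ ≠ 1 := by
    intro i h
    have : ψ (gen i) = 1 := by simpa using h
    have : (gen i : F) = 1 := by simpa using this
    have h' := len_gen (F := F) i
    rw [this] at h'; simp at h'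
  obtain ⟨i, j, hij⟩ := min_tau (fun i => c * ψ (gen i) * c⁻¹) hne L h1 h2
  refine ⟨c, L, h1, ?_⟩
  let ψ' : F ≃* F := ψ.trans (MulAut.conj c)
  have hψ' : ∀ u, ψ' u = c * ψ u * c⁻¹ := fun u => rfl
  have hl : ∀ i, len (ψ' (gen i)) ≤ L := h1
  have hn : 1 ≤ n := by have := i0.2; lia
  have a := gP_len (F := F) (12 * n * (n^2 + 2)) (by
    have : 0 < 12 * n * (n^2+2) := by positivity
    lia) (Finset.univ : Finset (Fin n × Fin n)).toList (i, j) (by simp) ψ' L hl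
  have b := (gP_pos (F := F) (12 * n * (n^2 + 2)) (Finset.univ : Finset (Fin n × Fin n)).toList).tau_ge ψ' L hl
  have e : tau (ψ' (gen i * gen j)) = tau (c * ψ (gen i) * c⁻¹ * (c * ψ (gen j) * c⁻¹)) := by
    rw [map_mul]; rfl
  have e2 : tau (ψ gg) = tau (ψ' (gP (12 * n * (n^2 + 2)) (Finset.univ : Finset (Fin n × Fin n)).toList)) := by
    rw [hψ', tau_conj]; rfl
  rw [e2]
  simp only [Finset.length_toList, Finset.card_univ, Fintype.card_prod, Fintype.card_fin] at a
  rw [e] at a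
  generalize tau (c * ψ (gen i) * c⁻¹ * (c * ψ (gen j) * c⁻¹)) = T at *
  push_cast at a
  have hL : 1 ≤ (L:ℤ) := (len_pos (hne i0)).trans (h1 i0)
  have hn' : (1:ℤ) ≤ n := by exact_mod_cast hn
  have k1 : 2 * (n * ((L:ℤ) + 1)) ≤ 12 * n * T := by nlinarith
  have k2 : 2 * (n * ((L:ℤ) + 1)) * (n^2 + 2) ≤ 12 * n * T * (n^2+2) := by
    apply mul_le_mul_of_nonneg_right k1; positivity
  nlinarith

theorem tau_gg_pos {n : ℕ} {F : Type} [Group F] [TG n F] (i0 : Fin n) : (gg : F) ≠ 1 := by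
  obtain ⟨c, L, h1, h2⟩ := filling i0 (MulEquiv.refl F)
  intro h
  rw [h] at h2
  have := i0.2
  simp at h2
  nlinarith

theorem ci_fin (ψ : F ≃* F) (β : ℤ) (hβ : ∀ u y w, Bt u y w → d (ψ u) (ψ y) + d (ψ y) (ψ w) ≤ d (ψ u) (ψ w) + β)
    (a b c e : F) (h : d a c - d b c ≤ d a e - d b e) :
    d (ψ a) (ψ c) - d (ψ b) (ψ c) ≤ d (ψ a) (ψ e) - d (ψ b) (ψ e) + 4 * β := by
  obtain ⟨p, p1, p2, p3⟩ := median a b c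
  obtain ⟨r, r1, r2, r3⟩ := median a b e
  have hpr : d a p ≤ d a r := by
    rw [d_comm b p] at p3; rw [d_comm b r] at r3
    lia
  obtain ⟨s, s1, s2⟩ := geo a r (d a p) (d_nonneg _ _) hpr
  have hs : Bt a s r := by unfold Bt; lia
  have hsp : s = p := Bt_uniq (Bt_trans r1 hs) p1 (by lia)
  subst hsp
  have hs' : Bt s r b := Bt_glue r1 hs
  have c1 := d_tri (ψ a) (ψ s) (ψ c)
  have c2 := hβ _ _ _ p3
  have c3 := d_tri (ψ b) (ψ r) (ψ e)
  have c4 := hβ _ _ _ r2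
  have c5 := hβ _ _ _ hs
  have c6 := hβ _ _ _ hs'
  have := d_nonneg (ψ s) (ψ r)
  rw [d_comm (ψ r) (ψ b), d_comm (ψ s) (ψ b)] at c6
  lia

theorem CIm {n : ℕ} {F : Type} [Group F] [TG n F] (i0 : Fin n) (ψ : F ≃* F) (x z : F) (hx : NC gg x)
    (hz : NC gg z) (h : E gg x ≤ E gg z) :
    E (ψ gg) (ψ x) ≤ E (ψ gg) (ψ z) + 4 * tau (ψ gg) := by
  obtain ⟨c, L, h1, h2⟩ := filling i0 ψ
  let ψ' : F ≃* F := ψ.trans (MulAut.conj c)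
  have hψ' : ∀ u, ψ' u = MulAut.conj c (ψ u) := fun u => rfl
  have hb := bcc ψ' L h1
  have ec := E_conj' c (ψ gg) (ψ x) (ψ z) (hx.map ψ) (hz.map ψ)
  rw [← hψ', ← hψ', ← hψ'] at ec
  obtain ⟨k, k1, k2, k3, k4⟩ := ((E_ev _ _ hx 0 0 1 1).and ((E_ev _ _ hz 0 0 1 1).and
    ((E_ev _ _ (hx.map ψ') 0 0 1 1).and (E_ev _ _ (hz.map ψ') 0 0 1 1)))).exists
  simp only [add_zero, mul_one, ← map_inv, ← map_pow] at k1 k2 k3 k4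
  have := ci_fin ψ' _ hb (gg⁻¹^k) (gg^k) (x^k) (z^k) (by lia)
  lia

/-- normalized difference of projections -/
def ee (y x z : F) : ℝ := ((E y x - E y z : ℤ) : ℝ) / (2 * (tau y : ℤ))

theorem ee_add (y x z w : F) : ee y x w = ee y x z + ee y z w := by
  unfold ee; rw [← add_div]; congr 1; push_cast; ring
theorem ee_self (y x : F) : ee y x x = 0 := by simp [ee]
theorem ee_swap (y x z : F) : ee y x z = - ee y z x := by
  have := ee_add y x z x
  rw [ee_self] at this; linarith
theorem ee_inv (y x z : F) : ee y⁻¹ x z = - ee y x z := by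
  unfold ee; rw [E_inv, E_inv, tau_inv, ← neg_div]; congr 1; push_cast; ring

theorem ee_shift (y x : F) (h : NC y x) (m : ℤ) : ee y (y^m * x * y^(-m)) x = m := by
  have := tau_pos h.ne1
  have : (1:ℝ) ≤ (tau y : ℤ) := by exact_mod_cast this
  unfold ee
  rw [(E_zshift y x h m).2]
  push_cast
  field_simp
  ring

theorem ee_le_iff (y x z : F) (h : y ≠ 1) (t : ℤ) : ee y x z ≤ t ↔ E y x - E y z ≤ 2 * t * tau y := by
  have h1 := tau_pos h
  have h1 : (0:ℝ) < 2 * (tau y : ℤ) := by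
    have : (1:ℝ) ≤ (tau y : ℤ) := by exact_mod_cast h1
    linarith
  unfold ee
  rw [div_le_iff₀ h1]
  have : (t:ℝ) * (2 * (tau y : ℤ)) = ((2 * t * tau y : ℤ) : ℝ) := by push_cast; ring
  rw [this]
  exact Int.cast_le

theorem ee_CI1 {n : ℕ} {F : Type} [Group F] [TG n F] (i0 : Fin n) (ψ : F ≃* F) (x z : F) (hx : NC gg x)
    (hz : NC gg z) : ee (ψ gg) (ψ x) (ψ z) ≤ ee gg x z + 3 := by
  have hm := Int.le_ceil (ee gg x z)
  have hm2 := Int.ceil_lt_add_one (ee gg x z)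
  generalize ⌈ee gg x z⌉ = m at *
  rw [ee_le_iff _ _ _ hx.ne1] at hm
  obtain ⟨s1, s2⟩ := E_zshift gg z hz m
  have := CIm i0 ψ x _ hx s1 (by rw [s2]; linarith)
  have h2 : ψ (gg ^ m * z * gg ^ (-m)) = (ψ gg)^m * ψ z * (ψ gg)^(-m) := by simp
  rw [h2, (E_zshift (ψ gg) (ψ z) (hz.map ψ) m).2] at this
  have : ee (ψ gg) (ψ x) (ψ z) ≤ ((m + 2 : ℤ) : ℝ) := by
    rw [ee_le_iff _ _ _ (hx.map ψ).ne1]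
    linarith
  push_cast at this
  linarith

theorem ee_CI {n : ℕ} {F : Type} [Group F] [TG n F] (i0 : Fin n) (φ ψ : F ≃* F) (x z : F) (hx : NC (φ gg) x)
    (hz : NC (φ gg) z) : |ee (ψ (φ gg)) (ψ x) (ψ z) - ee (φ gg) x z| ≤ 6 := by
  have hx' := hx.map φ.symm
  have hz' := hz.map φ.symm
  rw [MulEquiv.symm_apply_apply] at hx' hz'
  have a1 := ee_CI1 i0 φ _ _ hx' hz'
  have a2 := ee_CI1 i0 φ _ _ hz' hx'
  have b1 := ee_CI1 i0 (φ.trans ψ) _ _ hx' hz'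
  have b2 := ee_CI1 i0 (φ.trans ψ) _ _ hz' hx'
  simp only [MulEquiv.trans_apply, MulEquiv.apply_symm_apply] at a1 a2 b1 b2
  rw [ee_swap _ z x, ee_swap _ (φ.symm z)] at a2
  rw [ee_swap _ (ψ z), ee_swap _ (φ.symm z)] at b2
  rw [abs_le]
  constructor <;> linarith

end
end AH

namespace AH
open TG
section
variable {n : ℕ} {F : Type} [Group F] [TG n F]

theorem Q_nc_ultra {x y z : F} (h1 : NC x y) (h2 : NC y z) (h3 : NC x z) :
    Q x y ≤ Q x z ∨ Q y z ≤ Q x z := Q_ultra h1.ne1 h1.ne2 h2.ne2 h1.indep h2.indep h3.indep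

theorem Q_inv_ultra {x z : F} (h : NC x z) : (Q x z ≤ Q x x⁻¹ ∨ Q z x⁻¹ ≤ Q x x⁻¹) ∧
    (Q x x⁻¹ ≤ Q x z ∨ Q x⁻¹ z ≤ Q x z) ∧ (Q x x⁻¹ ≤ Q x⁻¹ z ∨ Q x z ≤ Q x⁻¹ z) := by
  have hx := h.ne1
  have hx' : x⁻¹ ≠ 1 := by simpa using hx
  refine ⟨?_, ?_, ?_⟩
  · exact Q_ultra hx h.ne2 hx' h.indep h.symm.inv_right.indep (indep_inv x)
  · exact Q_ultra hx hx' h.ne2 (indep_inv x) h.inv_left.indep h.indep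
  · have := Q_ultra hx' hx h.ne2 (indep_inv x).symm h.indep h.inv_left.indep
    rwa [Q_symm hx' hx (indep_inv x).symm] at this

theorem cross_arith (a a' b b' c r : ℤ) (h : a - a' < b - b') (a2 : c ≤ a ∨ a' ≤ a) (a3 : c ≤ a' ∨ a ≤ a')
    (a1 : a ≤ c ∨ a' ≤ c) (b2 : c ≤ b ∨ b' ≤ b) (b3 : c ≤ b' ∨ b ≤ b') (b1 : b ≤ c ∨ b' ≤ c)
    (c1 : a ≤ b ∨ r ≤ b) (c2 : b ≤ a ∨ r ≤ a) (c3 : a ≤ r ∨ b ≤ r)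
    (c1' : a' ≤ b' ∨ r ≤ b') (c2' : b' ≤ a' ∨ r ≤ a') (c3' : a' ≤ r ∨ b' ≤ r) : a + b' = r + c := by
  rcases lt_trichotomy a a' with h1 | h1 | h1 <;> rcases lt_trichotomy b b' with h2 | h2 | h2 <;>
    rcases lt_trichotomy a b with h3 | h3 | h3 <;> rcases lt_trichotomy a' b' with h4 | h4 | h4 <;> omega

/-- two smallest of three sums coincide -/
theorem Q_cross {x y z : F} (hx : NC y x) (hz : NC y z) (hxz : NC x z) (h : E y x < E y z) :
    Q y x + Q y⁻¹ z = Q x z + Q y y⁻¹ := by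
  obtain ⟨a1, a2, a3⟩ := Q_inv_ultra hx
  obtain ⟨b1, b2, b3⟩ := Q_inv_ultra hz
  have c1 := Q_nc_ultra hx hxz hz
  have c2 := Q_nc_ultra hz hxz.symm hx
  have c3 := Q_nc_ultra hx.symm hz hxz
  have c1' := Q_nc_ultra hx.inv_left hxz hz.inv_left
  have c2' := Q_nc_ultra hz.inv_left hxz.symm hx.inv_left
  have c3' := Q_nc_ultra hx.inv_left.symm hz.inv_left hxz
  rw [Q_nc_symm hxz.symm] at c2 c2'
  rw [Q_nc_symm hx.symm] at c3
  rw [Q_nc_symm hx.inv_left.symm] at c3'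
  rw [Q_nc_symm hx.symm.inv_right] at a1
  rw [Q_nc_symm hz.symm.inv_right] at b1
  exact cross_arith _ _ _ _ _ _ h a2 a3 a1 b2 b3 b1 c1 c2 c3 c1' c2' c3'

theorem E_flip {x y z : F} (hx : NC y x) (hz : NC y z) (hxz : NC x z) (h : E y x < E y z) (h' : E y x < E y z⁻¹) :
    E z x = E z y⁻¹ := by
  have a := Q_cross hx hz hxz h
  have b := Q_cross hx hz.inv_right hxz.inv_right h'
  unfold E
  rw [Q_nc_symm hxz.symm, Q_nc_symm hxz.symm.inv_left, Q_nc_symm hz.symm.inv_right, Q_nc_symm hz.symm.inv_right.inv_left]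
  lia

theorem gap_bound {x y z : F} (hx : NC y x) (hz : NC y z)
    (h1 : E y x < E y z) (h2 : Q y z ≤ Q y z⁻¹) (h3 : Q y⁻¹ x ≤ Q y⁻¹ x⁻¹) (R : ℤ) (hxR : cc x ≤ R) (hzR : cc z ≤ R) :
    cc y ≤ R ∧ E y z - E y x ≤ 2 * R := by
  obtain ⟨a1, a2, a3⟩ := Q_inv_ultra hx
  obtain ⟨b1, b2, b3⟩ := Q_inv_ultra hz
  obtain ⟨c1, -, -⟩ := Q_inv_ultra hx.inv_left.symm
  obtain ⟨d1, -, -⟩ := Q_inv_ultra hz.symm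
  rw [Q_inv _ hx.ne2, Q_nc_symm hx.symm.inv_right] at c1
  rw [Q_inv _ hz.ne2, Q_nc_symm hz.symm] at d1
  rw [Q_inv _ hx.ne1, Q_nc_symm hx.symm.inv_right] at a1
  rw [Q_inv _ hx.ne1] at a2 a3 b2 b3
  rw [Q_inv _ hx.ne1, Q_nc_symm hz.symm.inv_right] at b1
  have n1 := Q_nonneg hx.ne1 hx.ne2 hx.indep
  have n2 := Q_nonneg hz.inv_left.ne1 hz.ne2 hz.inv_left.indep
  unfold E at *
  have e1 : Q y⁻¹ x ≤ R := by lia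
  have e2 : Q y z ≤ R := by lia
  clear c1 d1 h2 h3
  constructor <;> lia

def sg {F : Type} [Group F] (s : Bool) (x : F) : F := if s then x else x⁻¹

theorem sg_map {F : Type} [Group F] (φ : F ≃* F) (s : Bool) (x : F) : φ (sg s x) = sg s (φ x) := by
  cases s <;> simp [sg]

theorem sg_sg {F : Type} [Group F] (s t : Bool) (x : F) : sg s (sg t x) = sg (s == t) x := by
  cases s <;> cases t <;> simp [sg]

theorem NC.sg {n : ℕ} {F : Type} [Group F] [TG n F] {x y : F} (h : NC x y) (s t : Bool) : NC (sg s x) (sg t y) := by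
  cases s <;> cases t <;> simp only [AH.sg] <;> simp <;> first | exact h | exact h.inv_left | exact h.inv_right | exact h.inv_left.inv_right

theorem ee_abs_sg (s : Bool) (y x z : F) : |ee (sg s y) x z| = |ee y x z| := by
  cases s <;> simp [sg, ee_inv]

/-- stabilizer of `{g, g⁻¹}` -/
def SS (n : ℕ) (F : Type) [Group F] [TG n F] : Subgroup (MulAut F) where
  carrier := {φ | ∃ s, φ (gg : F) = sg s gg}
  one_mem' := ⟨true, by simp [sg]⟩
  mul_mem' := by
    rintro a b ⟨s, hs⟩ ⟨t, ht⟩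
    exact ⟨t == s, by rw [MulAut.mul_apply, ht, sg_map, hs, sg_sg]⟩
  inv_mem' := by
    rintro a ⟨s, hs⟩
    refine ⟨s, ?_⟩
    have : a⁻¹ (a gg) = gg := by simp
    rw [hs, sg_map] at this
    rw [← this, sg_sg, this]
    cases s <;> simp [sg]

abbrev YY (n : ℕ) (F : Type) [Group F] [TG n F] : Type := MulAut F ⧸ SS n F

def rep (Y : YY n F) : F := (Quotient.out Y : MulAut F) gg

theorem rep_smul (σ : MulAut F) (Y : YY n F) : ∃ s, rep (σ • Y) = sg s (σ (rep Y)) := by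
  have h : (QuotientGroup.mk (Quotient.out (σ • Y)) : YY n F) = QuotientGroup.mk (σ * Quotient.out Y) := by
    have : (QuotientGroup.mk (σ * Quotient.out Y) : YY n F) = σ • QuotientGroup.mk (Quotient.out Y) := rfl
    rw [this, QuotientGroup.out_eq', QuotientGroup.out_eq']
  rw [eq_comm, QuotientGroup.eq] at h
  obtain ⟨s, hs⟩ := h
  refine ⟨s, ?_⟩
  have e : σ (rep Y) = (σ * Quotient.out Y) gg := rfl
  rw [e, ← sg_map, ← hs, ← MulAut.mul_apply, mul_inv_cancel_left]
  rfl

theorem rep_nc (i0 : Fin n) {X Y : YY n F} (h : X ≠ Y) : NC (rep X) (rep Y) := by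
  intro hc
  apply h
  rw [← QuotientGroup.out_eq' X, ← QuotientGroup.out_eq' Y, QuotientGroup.eq]
  unfold rep at hc
  generalize (Quotient.out X : MulAut F) = a at *
  generalize (Quotient.out Y : MulAut F) = b at *
  have hc' := congrArg (fun u => a⁻¹ u) hc
  simp only [map_mul, MulAut.inv_apply_self] at hc'
  rcases aut_comm gg (tau_gg_pos i0) (a⁻¹ * b) hc'.symm with h | h
  · exact ⟨true, h⟩
  · exact ⟨false, h⟩

theorem rep_orb (Y : YY n F) : ∃ φ : F ≃* F, rep Y = φ gg := ⟨_, rfl⟩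

/-- basic constant -/
def th0 (n : ℕ) (F : Type) [Group F] [TG n F] : ℝ := 2 * (tau (gg : F) : ℤ) + 8
def kap (n : ℕ) (F : Type) [Group F] [TG n F] : ℝ := 2 * th0 n F + 6

theorem th0_pos : 8 ≤ th0 n F := by
  have := tau_nonneg (gg : F)
  have : (0:ℝ) ≤ (tau (gg:F) : ℤ) := by exact_mod_cast this
  unfold th0; linarith

theorem ee_sign (i0 : Fin n) (φ φ' : F ≃* F) (h : NC (φ gg) (φ' gg)) :
    |ee (φ gg) (φ' gg) (φ' gg)⁻¹| ≤ th0 n F := by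
  have a := ee_CI i0 φ φ'.symm (φ' gg) (φ' gg)⁻¹ h h.inv_right
  have h' := h.map φ'.symm
  simp only [map_inv, MulEquiv.symm_apply_apply] at a h'
  have b := Q2 gg (φ'.symm (φ gg)) h'
  have t1 := tau_pos h'.ne1
  have t2 := tau_nonneg (gg : F)
  have c : |ee (φ'.symm (φ gg)) gg gg⁻¹| ≤ 2 * (tau (gg : F) : ℤ) + 2 := by
    unfold ee
    have t1' : (1:ℝ) ≤ (tau (φ'.symm (φ gg)) : ℤ) := by exact_mod_cast t1
    rw [abs_div, abs_of_pos (by linarith : (0:ℝ) < 2 * (tau (φ'.symm (φ gg)) : ℤ)), div_le_iff₀ (by linarith)]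
    have b' : |((E (φ'.symm (φ gg)) gg - E (φ'.symm (φ gg)) gg⁻¹ : ℤ):ℝ)| ≤ ((4 * (tau (gg:F) + tau (φ'.symm (φ gg))) : ℤ) : ℝ) := by
      exact_mod_cast b
    refine b'.trans ?_
    have t2' : (0:ℝ) ≤ (tau (gg:F) : ℤ) := by exact_mod_cast t2
    push_cast
    nlinarith
  rw [abs_le] at *
  unfold th0
  constructor <;> linarith

theorem ee_sg (i0 : Fin n) {X Y : YY n F} (h : X ≠ Y) (φ : F ≃* F) (s t : Bool) :
    |ee (φ (rep Y)) (φ (sg s (rep X))) (φ (sg t (rep X)))| ≤ th0 n F := by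
  obtain ⟨a, ha⟩ := rep_orb X
  obtain ⟨b, hb⟩ := rep_orb Y
  have hn := (rep_nc i0 h.symm).map φ
  have := ee_sign i0 (b.trans φ) (a.trans φ) (by rw [ha, hb] at hn; exact hn)
  simp only [MulEquiv.trans_apply, ← ha, ← hb] at this
  have := th0_pos (n := n) (F := F)
  cases s <;> cases t <;> simp only [sg] <;> simp [ee_self]
  · linarith
  · rw [ee_swap, abs_neg]; assumption
  · assumption
  · linarith

theorem ee_var (i0 : Fin n) {X Y Z : YY n F} (hX : X ≠ Y) (hZ : Z ≠ Y) (φ φ' : F ≃* F) (s t s' t' : Bool) :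
    |ee (φ (rep Y)) (φ (sg s (rep X))) (φ (sg t (rep Z))) -
      ee (φ' (rep Y)) (φ' (sg s' (rep X))) (φ' (sg t' (rep Z)))| ≤ kap n F := by
  obtain ⟨b, hb⟩ := rep_orb Y
  have hx : NC (rep Y) (sg s' (rep X)) := (rep_nc i0 hX.symm).sg true s'
  have hz : NC (rep Y) (sg t' (rep Z)) := (rep_nc i0 hZ.symm).sg true t'
  have hx1 := hx.map φ
  have hz1 := hz.map φ
  have c := ee_CI i0 (b.trans φ) (φ.symm.trans φ') (φ (sg s' (rep X))) (φ (sg t' (rep Z))) (by rw [hb] at hx1; exact hx1)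
    (by rw [hb] at hz1; exact hz1)
  simp only [MulEquiv.trans_apply, MulEquiv.symm_apply_apply, ← hb] at c
  have a1 := ee_sg i0 hX φ s s'
  have a2 := ee_sg i0 hZ φ t' t
  have e1 := ee_add (φ (rep Y)) (φ (sg s (rep X))) (φ (sg s' (rep X))) (φ (sg t (rep Z)))
  have e2 := ee_add (φ (rep Y)) (φ (sg s' (rep X))) (φ (sg t' (rep Z))) (φ (sg t (rep Z)))
  rw [abs_le] at *
  unfold kap
  constructor <;> linarith

/-- projection distances -/
def dp (Y X Z : YY n F) : ℝ := ⨆ p : (F ≃* F) × Bool × Bool,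
  |ee (p.1 (rep Y)) (p.1 (sg p.2.1 (rep X))) (p.1 (sg p.2.2 (rep Z)))|

theorem le_dp (i0 : Fin n) {X Y Z : YY n F} (hX : X ≠ Y) (hZ : Z ≠ Y) (φ : F ≃* F) (s t : Bool) :
    |ee (φ (rep Y)) (φ (sg s (rep X))) (φ (sg t (rep Z)))| ≤ dp Y X Z := by
  refine le_ciSup (f := fun p : (F ≃* F) × Bool × Bool =>
    |ee (p.1 (rep Y)) (p.1 (sg p.2.1 (rep X))) (p.1 (sg p.2.2 (rep Z)))|) ?_ (φ, s, t)
  refine ⟨|ee (φ (rep Y)) (φ (sg s (rep X))) (φ (sg t (rep Z)))| + kap n F, ?_⟩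
  rintro _ ⟨⟨φ', s', t'⟩, rfl⟩
  have := ee_var i0 hX hZ φ' φ s' t' s t
  have := abs_sub_abs_le_abs_sub (ee (φ' (rep Y)) (φ' (sg s' (rep X))) (φ' (sg t' (rep Z)))) (ee (φ (rep Y)) (φ (sg s (rep X))) (φ (sg t (rep Z))))
  simp only
  linarith

theorem dp_le {X Y Z : YY n F} (r : ℝ) (h : ∀ (φ : F ≃* F) (s t : Bool), |ee (φ (rep Y)) (φ (sg s (rep X))) (φ (sg t (rep Z)))| ≤ r) :
    dp Y X Z ≤ r := by
  haveI : Nonempty ((F ≃* F) × Bool × Bool) := ⟨(MulEquiv.refl F, true, true)⟩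
  exact ciSup_le fun p => h p.1 p.2.1 p.2.2

theorem dp_le' (i0 : Fin n) {X Y Z : YY n F} (hX : X ≠ Y) (hZ : Z ≠ Y) (φ : F ≃* F) (s t : Bool) :
    dp Y X Z ≤ |ee (φ (rep Y)) (φ (sg s (rep X))) (φ (sg t (rep Z)))| + kap n F := by
  refine dp_le _ fun φ' s' t' => ?_
  have := ee_var i0 hX hZ φ' φ s' t' s t
  have := abs_sub_abs_le_abs_sub (ee (φ' (rep Y)) (φ' (sg s' (rep X))) (φ' (sg t' (rep Z)))) (ee (φ (rep Y)) (φ (sg s (rep X))) (φ (sg t (rep Z))))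
  linarith

theorem dp_self (i0 : Fin n) {X Y : YY n F} (hX : X ≠ Y) : dp Y X X ≤ kap n F := by
  have := dp_le' i0 hX hX (MulEquiv.refl F) true true
  rw [ee_self] at this
  simpa using this

theorem dp_symm_le (i0 : Fin n) {X Y Z : YY n F} (hX : X ≠ Y) (hZ : Z ≠ Y) : dp Y X Z ≤ dp Y Z X := by
  refine dp_le _ fun φ s t => ?_
  rw [ee_swap, abs_neg]
  exact le_dp i0 hZ hX φ t s

theorem dp_tri (i0 : Fin n) {X Y Z W : YY n F} (hX : X ≠ Y) (hZ : Z ≠ Y) (hW : W ≠ Y) :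
    dp Y X Z ≤ dp Y X W + dp Y W Z := by
  refine dp_le _ fun φ s t => ?_
  rw [ee_add _ _ (φ (sg true (rep W)))]
  exact (abs_add_le _ _).trans (add_le_add (le_dp i0 hX hW φ s true) (le_dp i0 hW hZ φ true t))

theorem dp_inv_le (i0 : Fin n) {X Y Z : YY n F} (hX : X ≠ Y) (hZ : Z ≠ Y) (σ : MulAut F) :
    dp (σ • Y) (σ • X) (σ • Z) ≤ dp Y X Z := by
  refine dp_le _ fun φ s t => ?_
  obtain ⟨a, ha⟩ := rep_smul σ Y
  obtain ⟨b, hb⟩ := rep_smul σ X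
  obtain ⟨c, hc⟩ := rep_smul σ Z
  rw [ha, hb, hc, sg_sg, sg_sg, sg_map φ a, ee_abs_sg]
  have := le_dp i0 hX hZ (MulEquiv.trans σ φ) (s == b) (t == c)
  simp only [MulEquiv.trans_apply] at this
  rw [← sg_map, ← sg_map]
  exact this

theorem dp_inv (i0 : Fin n) {X Y Z : YY n F} (hX : X ≠ Y) (hZ : Z ≠ Y) (σ : MulAut F) :
    dp (σ • Y) (σ • X) (σ • Z) = dp Y X Z := by
  apply le_antisymm (dp_inv_le i0 hX hZ σ)
  have := dp_inv_le i0 (X := σ • X) (Y := σ • Y) (Z := σ • Z) (by simpa using hX) (by simpa using hZ) σ⁻¹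
  simpa using this

theorem dp_big (i0 : Fin n) {X Y Z : YY n F} (hX : X ≠ Y) (hZ : Z ≠ Y) (h : 2 * kap n F < dp Y X Z) :
    (∀ s t, ee (rep Y) (sg s (rep X)) (sg t (rep Z)) < -1) ∨ (∀ s t, 1 < ee (rep Y) (sg s (rep X)) (sg t (rep Z))) := by
  have h1 := dp_le' i0 hX hZ (MulEquiv.refl F) true true
  simp only [MulEquiv.refl_apply] at h1
  have hk : 1 ≤ kap n F := by have := th0_pos (n := n) (F := F); unfold kap; linarith
  have h2 : kap n F < |ee (rep Y) (sg true (rep X)) (sg true (rep Z))| := by linarith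
  have h3 : ∀ s t, |ee (rep Y) (sg s (rep X)) (sg t (rep Z)) - ee (rep Y) (sg true (rep X)) (sg true (rep Z))| ≤ 2 * th0 n F := by
    intro s t
    have a1 := ee_sg i0 hX (MulEquiv.refl F) s true
    have a2 := ee_sg i0 hZ (MulEquiv.refl F) true t
    simp only [MulEquiv.refl_apply] at a1 a2
    rw [ee_add _ (sg s (rep X)) (sg true (rep X)), ee_add _ (sg true (rep X)) (sg true (rep Z)) (sg t (rep Z))]
    rw [abs_le] at *
    constructor <;> linarith
  unfold kap at h2
  rcases lt_abs.mp h2 with h | h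
  · right; intro s t; have := abs_le.mp (h3 s t); linarith
  · left; intro s t; have := abs_le.mp (h3 s t); linarith

theorem ee_neg_iff (y x z : F) (h : y ≠ 1) : ee y x z < 0 ↔ E y x < E y z := by
  have h1 := tau_pos h
  have h1 : (0:ℝ) < 2 * (tau y : ℤ) := by
    have : (1:ℝ) ≤ (tau y : ℤ) := by exact_mod_cast h1
    linarith
  unfold ee
  rw [div_lt_iff₀ h1, zero_mul, ← Int.cast_zero, Int.cast_lt]
  constructor <;> intro h <;> linarith

theorem dp_P1 (i0 : Fin n) {X Y Z : YY n F} (hX : X ≠ Y) (hZ : Z ≠ Y) (hXZ : X ≠ Z) (h : 2 * kap n F < dp Y X Z) :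
    dp Z X Y ≤ kap n F := by
  have nx := rep_nc i0 hX.symm
  have nz := rep_nc i0 hZ.symm
  have nxz := rep_nc i0 hXZ
  rcases dp_big i0 hX hZ h with h | h
  · have h1 := h true true
    have h2 := h true false
    simp only [sg, if_true, Bool.false_eq_true, if_false] at h1 h2
    have e := E_flip nx nz nxz ((ee_neg_iff _ _ _ nx.ne1).mp (by linarith)) ((ee_neg_iff _ _ _ nx.ne1).mp (by linarith))
    have := dp_le' i0 hXZ hZ.symm (MulEquiv.refl F) true false
    simpa [sg, ee, e] using this
  · have h1 := h true true
    have h2 := h true false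
    simp only [sg, if_true, Bool.false_eq_true, if_false] at h1 h2
    have e := E_flip nx.inv_left nz.inv_left nxz ((ee_neg_iff _ _ _ nx.inv_left.ne1).mp (by rw [ee_inv]; linarith)) ((ee_neg_iff _ _ _ nx.inv_left.ne1).mp (by rw [ee_inv]; linarith))
    rw [inv_inv] at e
    have := dp_le' i0 hXZ hZ.symm (MulEquiv.refl F) true true
    simpa [sg, ee, e] using this

theorem len_bound_aux {x y z : F} (hx : NC y x) (hz : NC y z) (h : ∀ s t, ee y (sg s x) (sg t z) < -1) (R : ℤ)
    (hxR : cc x ≤ R) (hzR : cc z ≤ R) : len y ≤ 2 * R := by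
  obtain ⟨t, ht⟩ : ∃ t, Q y (sg t z) ≤ Q y (sg t z)⁻¹ := by
    rcases le_total (Q y z) (Q y z⁻¹) with h | h
    · exact ⟨true, h⟩
    · exact ⟨false, by simpa [sg] using h⟩
  obtain ⟨s, hs⟩ : ∃ s, Q y⁻¹ (sg s x) ≤ Q y⁻¹ (sg s x)⁻¹ := by
    rcases le_total (Q y⁻¹ x) (Q y⁻¹ x⁻¹) with h | h
    · exact ⟨true, h⟩
    · exact ⟨false, by simpa [sg] using h⟩
  have hst := h s t
  have nx : NC y (sg s x) := hx.sg true s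
  have nz : NC y (sg t z) := hz.sg true t
  have hcx : cc (sg s x) ≤ R := by cases s <;> simpa [sg, cc_inv] using hxR
  have hcz : cc (sg t z) ≤ R := by cases t <;> simpa [sg, cc_inv] using hzR
  obtain ⟨g1, g2⟩ := gap_bound nx nz ((ee_neg_iff _ _ _ hx.ne1).mp (by linarith)) ht hs R hcx hcz
  have := (ee_le_iff y (sg s x) (sg t z) hx.ne1 (-1)).mp (by push_cast; linarith)
  rw [len_eq_tau]
  linarith

theorem dp_P2 (i0 : Fin n) (X Z : YY n F) : {Y | X ≠ Y ∧ Z ≠ Y ∧ 2 * kap n F < dp Y X Z}.Finite := by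
  have hf := finite_ball (F := F) (2 * max (cc (rep X)) (cc (rep Z)))
  refine Set.Finite.of_finite_image (f := rep) (hf.subset ?_) ?_
  · rintro _ ⟨Y, ⟨hX, hZ, h⟩, rfl⟩
    have nx := rep_nc i0 hX.symm
    have nz := rep_nc i0 hZ.symm
    rcases dp_big i0 hX hZ h with h | h
    · exact len_bound_aux nx nz h _ (le_max_left _ _) (le_max_right _ _)
    · have := len_bound_aux nx.inv_left nz.inv_left (by intro s t; rw [ee_inv]; have := h s t; linarith) _ (le_max_left (cc (rep X)) (cc (rep Z))) (le_max_right _ _)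
      rwa [len_inv] at this
  · intro A _ B _ hAB
    by_contra hne
    exact rep_nc i0 hne (by rw [hAB])

end
end AH

namespace AH
open TG
section
variable {n : ℕ} {F : Type} [Group F] [TG n F]

theorem finite_auts (r : ℤ) : {β : F ≃* F | ∀ i, len (β (gen i)) ≤ r}.Finite := by
  have hf : (Set.pi Set.univ (fun _ : Fin n => {u : F | len u ≤ r})).Finite :=
    Set.Finite.pi' (fun _ => finite_ball r) |>.subset (by intro f hf i; exact hf i trivial)
  refine Set.Finite.of_injOn (f := fun β : F ≃* F => fun i => β (gen i)) (t := _) ?_ ?_ hf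
  · intro β hβ i _
    exact hβ i
  · intro β _ γ _ h
    exact aut_ext _ _ (fun i => congrFun h i)

theorem sg_conj_comm {n : ℕ} {F : Type} [Group F] [TG n F] {g v : F} (hg : g ≠ 1) (s t : Bool) (h : sg s g = v * sg t g * v⁻¹) : v * g = g * v := by
  apply conj_comm g v hg
  have e : v * g * v⁻¹ = sg (s == t) g := by
    cases t
    · have e1 : v * g * v⁻¹ = (v * g⁻¹ * v⁻¹)⁻¹ := by group
      have h' : v * g⁻¹ * v⁻¹ = sg s g := h.symm
      rw [e1, h']
      cases s <;> simp [sg]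
    · have h' : v * g * v⁻¹ = sg s g := h.symm
      rw [h']
      cases s <;> simp [sg]
  rw [e]
  cases (s == t) <;> simp [sg]

theorem stab_bound (i0 : Fin n) : ∃ N : ℕ, ∀ Y Y' : YY n F, Y ≠ Y' → ∃ s : Finset (MulAut F), s.card ≤ N ∧
    ∀ φ : MulAut F, φ • Y = Y → φ • Y' = Y' → φ ∈ s := by
  classical
  set B := {β : F ≃* F | ∀ i, len (β (gen i)) ≤ tau (gg : F)} with hB
  have hBf : B.Finite := finite_auts _
  refine ⟨B.ncard, fun Y Y' hne => ?_⟩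
  have hnc := rep_nc i0 hne
  obtain ⟨φ0, h0⟩ := rep_orb Y
  set h := φ0.symm (rep Y') with hh
  have hh' : rep Y' = φ0 h := by simp [hh]
  have hnc' : NC (gg : F) h := by
    have := hnc.map φ0.symm
    rwa [h0, MulEquiv.symm_apply_apply] at this
  have fixed : ∀ (φ : MulAut F) (Z : YY n F) (z : F), rep Z = φ0 z → φ • Z = Z → ∃ s, (φ0.trans (MulEquiv.trans φ φ0.symm)) z = sg s z := by
    intro φ Z z hz hφ
    obtain ⟨s, hs⟩ := rep_smul φ Z
    refine ⟨s, ?_⟩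
    rw [hφ, hz] at hs
    have e : φ (φ0 z) = sg s (φ0 z) := by
      generalize φ (φ0 z) = w at hs ⊢
      rw [hs, sg_sg]; cases s <;> simp [sg]
    change φ0.symm (φ (φ0 z)) = _
    rw [e, sg_map, MulEquiv.symm_apply_apply]
  have key : ∀ φ : MulAut F, φ • Y = Y → ∃ c : F, (φ0.trans (MulEquiv.trans φ φ0.symm)).trans (MulAut.conj c) ∈ B := by
    intro φ hφ
    obtain ⟨s, hs⟩ := fixed φ Y gg h0 hφ
    obtain ⟨c, L, h1, h2⟩ := filling i0 (φ0.trans (MulEquiv.trans φ φ0.symm))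
    refine ⟨c, fun i => ?_⟩
    have ht : tau ((φ0.trans (MulEquiv.trans φ φ0.symm)) gg) = tau (gg : F) := by
      rw [hs]; cases s <;> simp [sg]
    rw [ht] at h2
    have hn : (1:ℤ) ≤ n := by have := i0.pos; omega
    have h3 := h1 i
    have : ((L:ℤ) + 1) ≤ n * ((L:ℤ)+1) := by nlinarith
    change len (c * _ * c⁻¹) ≤ _
    refine h3.trans ?_
    linarith
  choose! c hc using key
  set S := {φ : MulAut F | φ • Y = Y ∧ φ • Y' = Y'} with hS
  have hm : Set.MapsTo (fun φ : MulAut F => (φ0.trans (MulEquiv.trans φ φ0.symm)).trans (MulAut.conj (c φ))) S B := by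
    intro φ hφ
    exact hc φ hφ.1
  have hi : Set.InjOn (fun φ : MulAut F => (φ0.trans (MulEquiv.trans φ φ0.symm)).trans (MulAut.conj (c φ))) S := by
    intro φ1 h1 φ2 h2 he
    have he' : ∀ x, c φ1 * φ0.symm (φ1 (φ0 x)) * (c φ1)⁻¹ = c φ2 * φ0.symm (φ2 (φ0 x)) * (c φ2)⁻¹ :=
      fun x => DFunLike.congr_fun he x
    set v := (c φ1)⁻¹ * c φ2 with hv
    have he2 : ∀ x, φ0.symm (φ1 (φ0 x)) = v * φ0.symm (φ2 (φ0 x)) * v⁻¹ := by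
      intro x
      have := he' x
      calc _ = (c φ1)⁻¹ * (c φ1 * φ0.symm (φ1 (φ0 x)) * (c φ1)⁻¹) * c φ1 := by group
        _ = _ := by rw [this, hv]; group
    have cm : ∀ (Z : YY n F) (z : F), z ≠ 1 → rep Z = φ0 z → φ1 • Z = Z → φ2 • Z = Z → v * z = z * v := by
      intro Z z hz hZ a1 a2
      obtain ⟨s, hs⟩ := fixed φ1 Z z hZ a1
      obtain ⟨t, ht⟩ := fixed φ2 Z z hZ a2
      change φ0.symm (φ1 (φ0 z)) = _ at hs
      change φ0.symm (φ2 (φ0 z)) = _ at ht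
      apply sg_conj_comm hz s t
      rw [← hs, ← ht]; exact he2 z
    have c1 := cm Y gg hnc'.ne1 h0 h1.1 h2.1
    have c2 := cm Y' h hnc'.ne2 hh' h1.2 h2.2
    have v1 : v = 1 := by
      by_contra hv1
      exact hnc' (comm_trans hnc'.ne1 hv1 hnc'.ne2 c1.symm c2)
    ext x
    have := he2 (φ0.symm x)
    rw [v1] at this
    simpa using this
  have hSf : S.Finite := Set.Finite.of_injOn hm hi hBf
  refine ⟨hSf.toFinset, ?_, ?_⟩
  · rw [← Set.ncard_eq_toFinset_card S hSf]
    exact Set.ncard_le_ncard_of_injOn _ hm hi hBf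
  · intro φ h1 h2
    simp [hS, h1, h2]

theorem exists_nc (hn : 2 ≤ n) (y : F) (hy : y ≠ 1) : ∃ h : F, NC y h := by
  by_contra hc
  push Not at hc
  have hc' : ∀ h : F, y * h = h * y := fun h => by
    have := hc h
    unfold NC at this
    push Not at this
    exact this
  let i : Fin n := ⟨0, by omega⟩
  let j : Fin n := ⟨1, by omega⟩
  have hne : ∀ k : Fin n, (gen k : F) ≠ 1 := by
    intro k hk
    have : len (([k].map (gen (F := F))).prod) = _ := len_word [k]
    simp [hk] at this
  have := gen_comm i j (comm_trans (hne i) hy (hne j) (hc' _).symm (hc' _))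
  simp [i, j] at this

theorem big_gap (hn : 2 ≤ n) : ∃ X0 : YY n F, ∀ T : ℝ, ∃ p : MulAut F, p • X0 ≠ X0 ∧ p⁻¹ • X0 ≠ X0 ∧
    T < dp X0 (p⁻¹ • X0) (p • X0) := by
  have i0 : Fin n := ⟨0, by omega⟩
  refine ⟨QuotientGroup.mk 1, fun T => ?_⟩
  set X0 : YY n F := QuotientGroup.mk 1 with hX0
  set y := rep X0 with hy
  obtain ⟨φ0, h0⟩ := rep_orb X0
  have hy1 : y ≠ 1 := by
    rw [hy, h0]; simpa using tau_gg_pos i0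
  obtain ⟨h, hh⟩ := exists_nc hn y hy1
  have nc1 : NC y (h * y * h⁻¹) := by
    intro hc
    exact hh (conj_comm y h hy1 hc.symm).symm
  have nc2 : NC y (h⁻¹ * y * h) := by
    intro hc
    have := conj_comm y h⁻¹ hy1 (by simpa using hc.symm)
    apply hh.inv_right
    exact this.symm
  obtain ⟨M, hM⟩ := exists_nat_gt (T + |ee y (h * y * h⁻¹) (h⁻¹ * y * h)|)
  have ea : y ^ (M:ℤ) * (h * y * h⁻¹) * y ^ (-(M:ℤ)) = (y^M * h) * y * (y^M * h)⁻¹ := by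
    simp [mul_assoc]
  have eb : (y^M * h)⁻¹ * y * (y^M * h) = h⁻¹ * y * h := by
    have : y * y ^ M = y^M * y := (Commute.self_pow y M)
    calc _ = h⁻¹ * (y^M)⁻¹ * (y * y^M) * h := by group
      _ = _ := by rw [this]; group
  have key := ee_shift y (h * y * h⁻¹) nc1 M
  rw [ea] at key
  set q := y^M * h with hq
  obtain ⟨s, hs⟩ := rep_smul (MulAut.conj q) X0
  obtain ⟨t, ht⟩ := rep_smul (MulAut.conj q)⁻¹ X0
  rw [← hy, MulAut.conj_apply] at hs
  have ec : (MulAut.conj q)⁻¹ y = h⁻¹ * y * h := by rw [MulAut.conj_inv_apply, eb]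
  rw [← hy, ec] at ht
  have hne1 : MulAut.conj q • X0 ≠ X0 := by
    intro hc
    rw [hc, ← hy] at hs
    have : y * (q * y * q⁻¹) = (q * y * q⁻¹) * y := by
      generalize q * y * q⁻¹ = w at hs ⊢
      rw [hs]; cases s <;> simp [sg]
    have := conj_comm y q hy1 this.symm
    rw [hq] at this
    apply hh
    have e2 : y * y ^ M = y^M * y := (Commute.self_pow y M)
    have : y^M * (h * y) = y^M * (y * h) := by
      rw [← mul_assoc, this, ← mul_assoc, e2, mul_assoc]
    exact (mul_left_cancel this).symm
  have hne2 : (MulAut.conj q)⁻¹ • X0 ≠ X0 := by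
    intro hc
    apply hne1
    nth_rw 1 [← hc]
    simp
  refine ⟨MulAut.conj q, hne1, hne2, ?_⟩
  have := le_dp i0 hne2 hne1 (MulEquiv.refl F) t s
  rw [hs, ht, sg_sg, sg_sg] at this
  simp only [beq_self_eq_true] at this
  change |ee y (h⁻¹ * y * h) (q * y * q⁻¹)| ≤ _ at this
  have e1 := ee_add y (q * y * q⁻¹) (h * y * h⁻¹) (h⁻¹ * y * h)
  have e2 := ee_swap y (q * y * q⁻¹) (h⁻¹ * y * h)
  have a1 := neg_abs_le (ee y (h * y * h⁻¹) (h⁻¹ * y * h))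
  have a2 := neg_abs_le (ee y (h⁻¹ * y * h) (q * y * q⁻¹))
  push_cast at key
  linarith
end

/-- Abstract projection data. -/
structure PS (G : Type) [Group G] (V : Type) [MulAction G V] where
  p : V → V → V → ℝ
  θ : ℝ
  pos : 0 < θ
  self : ∀ X Y, X ≠ Y → p Y X X ≤ θ
  sym : ∀ X Y Z, X ≠ Y → Z ≠ Y → p Y X Z = p Y Z X
  tri : ∀ X Y Z W, X ≠ Y → Z ≠ Y → W ≠ Y → p Y X Z ≤ p Y X W + p Y W Z
  inv : ∀ (σ : G) X Y Z, X ≠ Y → Z ≠ Y → p (σ • Y) (σ • X) (σ • Z) = p Y X Z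
  P1 : ∀ X Y Z, X ≠ Y → Z ≠ Y → X ≠ Z → θ < p Y X Z → p Z X Y ≤ θ
  P2 : ∀ X Z, {Y | X ≠ Y ∧ Z ≠ Y ∧ θ < p Y X Z}.Finite
  stab : ∃ N : ℕ, ∀ Y Y' : V, Y ≠ Y' → ∃ s : Finset G, s.card ≤ N ∧
    ∀ φ : G, φ • Y = Y → φ • Y' = Y' → φ ∈ s
  big : ∃ X0 : V, ∀ T : ℝ, ∃ g : G, g • X0 ≠ X0 ∧ g⁻¹ • X0 ≠ X0 ∧ T < p X0 (g⁻¹ • X0) (g • X0)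

def thePS (n : ℕ) (hn : 2 ≤ n) (F : Type) [Group F] [TG n F] : PS (MulAut F) (YY n F) :=
  let i0 : Fin n := ⟨0, by omega⟩
  have hk : 0 < kap n F := by have := th0_pos (n := n) (F := F); unfold kap; linarith
  { p := dp
    θ := 2 * kap n F
    pos := by linarith
    self := fun X Y h => (dp_self i0 h).trans (by linarith)
    sym := fun X Y Z h h' => le_antisymm (dp_symm_le i0 h h') (dp_symm_le i0 h' h)
    tri := fun X Y Z W h h' h'' => dp_tri i0 h h' h''
    inv := fun σ X Y Z h h' => dp_inv i0 h h' σ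
    P1 := fun X Y Z h h' h'' h3 => (dp_P1 i0 h h' h'' h3).trans (by linarith)
    P2 := fun X Z => dp_P2 i0 X Z
    stab := stab_bound i0
    big := big_gap hn }

end AH

namespace AH
namespace PS
section
variable {G : Type} [Group G] {V : Type} [MulAction G V] (D : PS G V)

def Adj (Z X Y : V) : Prop := X ≠ Z ∧ Y ≠ Z ∧ X ≠ Y ∧ (10 * D.θ < D.p Y X Z ∨ 10 * D.θ < D.p X Y Z)

theorem Adj.symm {D : PS G V} {Z X Y : V} (h : D.Adj Z X Y) : D.Adj Z Y X :=
  ⟨h.2.1, h.1, h.2.2.1.symm, h.2.2.2.symm⟩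

theorem beh {X Y Z : V} (h1 : X ≠ Y) (h2 : Z ≠ Y) (h3 : X ≠ Z) (h : D.θ < D.p Y X Z) : D.p X Y Z ≤ D.θ := by
  rw [D.sym X Y Z h1 h2] at h
  rw [D.sym Y X Z h1.symm h3.symm]
  exact D.P1 Z Y X h2 h1 h3.symm h

theorem nonneg {X Y Z : V} (h1 : X ≠ Y) (h2 : Z ≠ Y) : 0 ≤ D.p Y X Z := by
  have a := D.tri X Y X Z h1 h1 h2
  have b := D.sym X Y Z h1 h2
  have c := D.tri X Y X X h1 h1 h1
  linarith

def Gt (Z A x : V) : Prop := x = A ∨ 8 * D.θ < D.p A x Z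

theorem adj_gt {Z A x : V} (h : D.Adj Z A x) (h1 : D.Gt Z A x) : 10 * D.θ < D.p A x Z := by
  obtain ⟨a, b, c, e⟩ := h
  have hp := D.pos
  rcases h1 with h1 | h1
  · exact absurd h1.symm c
  rcases e with e | e
  · have := D.beh (X := x) (Y := A) (Z := Z) c.symm a.symm b (by linarith)
    linarith
  · exact e

theorem near {Z A A' x : V} (hA : A ≠ Z) (hA' : A' ≠ Z) (hne : A ≠ A') (hx : x ≠ Z) (h : D.p A' A Z ≤ D.θ) (hxA : x ≠ A)
    (h1 : D.Gt Z A' x) : D.p A x A' ≤ D.θ := by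
  have hp := D.pos
  rcases h1 with h1 | h1
  · subst h1
    exact D.self _ _ hxA
  · by_cases hxA' : x = A'
    · subst hxA'
      exact D.self _ _ hxA
    have t := D.tri x A' Z A hxA' hA'.symm hne
    exact D.P1 x A' A hxA' hne hxA (by linarith)

theorem roof_step {Z A A' x1 xm : V} (hA : A ≠ Z) (hA' : A' ≠ Z) (hne : A ≠ A') (hx1 : x1 ≠ Z) (hxm : xm ≠ Z)
    (h : 8 * D.θ < D.p A A' Z) (a1 : D.Adj Z A x1) (g1 : D.Gt Z A x1) (g2 : D.Gt Z A' x1) (g3 : D.Gt Z A' xm) :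
    D.Gt Z A xm := by
  have hp := D.pos
  by_cases hm : xm = A
  · exact Or.inl hm
  right
  have k := D.adj_gt a1 g1
  have h1A : x1 ≠ A := a1.2.2.1.symm
  have b := D.beh (X := A') (Y := A) (Z := Z) hne.symm hA.symm hA' (by linarith)
  have n1 := D.near hA hA' hne hx1 b h1A g2
  have n2 := D.near hA hA' hne hxm b hm g3
  have t1 := D.tri x1 A Z A' h1A hA.symm hne.symm
  have t2 := D.tri A' A Z xm hne.symm hA.symm hm
  have s := D.sym A' A xm hne.symm hm
  linarith

theorem roof_ends {Z A A' x1 : V} (hA : A ≠ Z) (hA' : A' ≠ Z) (hne : A ≠ A') (hx1 : x1 ≠ Z)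
    (a1 : D.Adj Z A x1) (g1 : D.Gt Z A x1) (g2 : D.Gt Z A' x1) (b : D.p A' A Z ≤ D.θ) :
    D.Gt Z A A' := by
  have hp := D.pos
  right
  have k := D.adj_gt a1 g1
  have h1A : x1 ≠ A := a1.2.2.1.symm
  have n1 := D.near hA hA' hne hx1 b h1A g2
  have t1 := D.tri x1 A Z A' h1A hA.symm hne.symm
  linarith

theorem roof (Z : V) (m : ℕ) : ∀ v : ℕ → V, (∀ i ≤ m, v i ≠ Z) → (∀ i < m, D.Adj Z (v i) (v (i+1))) →
    ∃ a ≤ m, ∀ i ≤ m, D.Gt Z (v a) (v i) := by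
  have hp := D.pos
  induction m with
  | zero => exact fun v _ _ => ⟨0, le_rfl, fun i hi => by rw [Nat.le_zero.mp hi]; exact Or.inl rfl⟩
  | succ m ih =>
    intro v hz ha
    obtain ⟨a, ham, hga⟩ := ih v (fun i hi => hz i (by omega)) (fun i hi => ha i (by omega))
    obtain ⟨b', hbm, hgb'⟩ := ih (fun i => v (i+1)) (fun i hi => hz _ (by omega)) (fun i hi => ha _ (by omega))
    have hgb : ∀ i, 1 ≤ i → i ≤ m + 1 → D.Gt Z (v (b'+1)) (v i) := by
      intro i h1 h2
      have := hgb' (i-1) (by omega)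
      rwa [Nat.sub_add_cancel h1] at this
    by_cases hab : v a = v (b'+1)
    · refine ⟨a, by omega, fun i hi => ?_⟩
      by_cases h : i ≤ m
      · exact hga i h
      · rw [hab]; exact hgb i (by omega) hi
    have hA := hz a (by omega)
    have hB := hz (b'+1) (by omega)
    rcases Nat.eq_zero_or_pos m with hm0 | hmpos
    · subst hm0
      have ea : a = 0 := by omega
      have eb : b' = 0 := by omega
      subst ea; subst eb
      have h01 := ha 0 (by omega)
      rcases h01.2.2.2 with h | h
      · refine ⟨1, le_rfl, fun i hi => ?_⟩
        interval_cases i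
        · exact Or.inr (by simpa using (show 8 * D.θ < D.p (v (0+1)) (v 0) Z by linarith))
        · exact Or.inl rfl
      · refine ⟨0, by omega, fun i hi => ?_⟩
        interval_cases i
        · exact Or.inl rfl
        · exact Or.inr (by simpa using (show 8 * D.θ < D.p (v 0) (v (0+1)) Z by linarith))
    -- m ≥ 1
    have useA : D.Gt Z (v a) (v (m+1)) → ∃ a ≤ m+1, ∀ i ≤ m+1, D.Gt Z (v a) (v i) := by
      intro h
      refine ⟨a, by omega, fun i hi => ?_⟩
      by_cases h' : i ≤ m
      · exact hga i h'
      · rwa [show i = m + 1 by omega]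
    have useB : D.Gt Z (v (b'+1)) (v 0) → ∃ a ≤ m+1, ∀ i ≤ m+1, D.Gt Z (v a) (v i) := by
      intro h
      refine ⟨b'+1, by omega, fun i hi => ?_⟩
      by_cases h' : 1 ≤ i
      · exact hgb i h' hi
      · rwa [show i = 0 by omega]
    by_cases ha0 : a = 0
    · by_cases hbm' : b' = m
      · subst ha0; subst hbm'
        by_cases h : D.θ < D.p (v 0) (v (b'+1)) Z
        · have b := D.beh (X := v (b'+1)) (Y := v 0) (Z := Z) (Ne.symm hab) hA.symm hB h
          exact useA (D.roof_ends hA hB hab (hz 1 (by omega)) (ha 0 (by omega)) (hga 1 hmpos) (hgb 1 le_rfl (by omega)) b)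
        · push Not at h
          exact useB (D.roof_ends hB hA (Ne.symm hab) (hz b' (by omega)) (ha b' (by omega)).symm (hgb b' hmpos (by omega)) (hga b' le_rfl) h)
      · subst ha0
        rcases hga (b'+1) (by omega) with h | h
        · exact absurd h.symm hab
        exact useA (D.roof_step hA hB hab (hz 1 (by omega)) (hz _ le_rfl) h (ha 0 (by omega)) (hga 1 hmpos) (hgb 1 le_rfl (by omega)) (hgb _ (by omega) le_rfl))
    · rcases hgb a (by omega) (by omega) with h | h
      · exact absurd h hab
      by_cases hbm' : b' = m
      · subst hbm'
        exact useB (D.roof_step hB hA (Ne.symm hab) (hz b' (by omega)) (hz _ (by omega)) h (ha b' (by omega)).symm (hgb b' hmpos (by omega)) (hga b' le_rfl) (hga 0 (by omega)))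
      · rcases hga (b'+1) (by omega) with h' | h'
        · exact absurd h'.symm hab
        have := D.beh (X := v (b'+1)) (Y := v a) (Z := Z) (Ne.symm hab) hA.symm hB (by linarith)
        linarith

def Eqv (Z : V) : V → V → Prop := Relation.ReflTransGen (D.Adj Z)

theorem Eqv.symm {D : PS G V} {Z X Y : V} (h : D.Eqv Z X Y) : D.Eqv Z Y X := by
  induction h with
  | refl => exact Relation.ReflTransGen.refl
  | tail _ h2 ih => exact Relation.ReflTransGen.head h2.symm ih

theorem Eqv.chain {D : PS G V} {Z X Y : V} (hX : X ≠ Z) (h : D.Eqv Z X Y) : ∃ (m : ℕ) (v : ℕ → V), v 0 = X ∧ v m = Y ∧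
    (∀ i ≤ m, v i ≠ Z) ∧ (∀ i < m, D.Adj Z (v i) (v (i+1))) := by
  induction h with
  | refl => exact ⟨0, fun _ => X, rfl, rfl, fun _ _ => hX, fun i hi => absurd hi (by omega)⟩
  | @tail b c h1 h2 ih =>
    obtain ⟨m, v, h0, hm, hz, ha⟩ := ih
    refine ⟨m+1, fun i => if i ≤ m then v i else c, by simp [h0], by simp, ?_, ?_⟩
    · intro i hi
      by_cases h : i ≤ m
      · simpa [h] using hz i h
      · simpa [h] using h2.2.1
    · intro i hi
      by_cases h : i + 1 ≤ m
      · simpa [h, show i ≤ m by omega] using ha i (by omega)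
      · have : i = m := by omega
        subst this
        simpa [hm] using h2

theorem Eqv.ne {D : PS G V} {Z X Y : V} (hX : X ≠ Z) (h : D.Eqv Z X Y) : Y ≠ Z := by
  obtain ⟨m, v, h0, hm, hz, ha⟩ := h.chain hX
  rw [← hm]; exact hz m le_rfl

theorem Eqv.le {D : PS G V} {Z X Y : V} (hX : X ≠ Z) (h : D.Eqv Z X Y) : D.p Z X Y ≤ 2 * D.θ := by
  have hp := D.pos
  obtain ⟨m, v, h0, hm, hz, ha⟩ := h.chain hX
  obtain ⟨a, ham, hg⟩ := D.roof Z m v hz ha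
  have key : ∀ i ≤ m, D.p Z (v i) (v a) ≤ D.θ := by
    intro i hi
    by_cases e : v i = v a
    · rw [e]; exact D.self _ _ (hz a ham)
    rcases hg i hi with h | h
    · exact absurd h e
    · exact D.P1 (v i) (v a) Z e (hz a ham).symm (hz i hi) (by linarith)
  have k0 := key 0 (by omega)
  have km := key m le_rfl
  rw [h0] at k0
  rw [hm] at km
  have hY := h.ne hX
  have t := D.tri X Z Y (v a) hX hY (hz a ham)
  have s := D.sym Y Z (v a) hY (hz a ham)
  linarith

def pp (Z X W : V) : ℝ := sSup {r | ∃ X' W', D.Eqv Z X X' ∧ D.Eqv Z W W' ∧ r = D.p Z X' W'}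

theorem pp_aux {Z X W X' W' : V} (hX : X ≠ Z) (hW : W ≠ Z) (h1 : D.Eqv Z X X') (h2 : D.Eqv Z W W') :
    D.p Z X' W' ≤ D.p Z X W + 4 * D.θ := by
  have hX' := h1.ne hX
  have hW' := h2.ne hW
  have t1 := D.tri X' Z W' X hX' hW' hX
  have t2 := D.tri X Z W' W hX hW' hW
  have l1 := h1.symm.le hX'
  have l2 := h2.le hW
  linarith

theorem le_pp {Z X W X' W' : V} (hX : X ≠ Z) (hW : W ≠ Z) (h1 : D.Eqv Z X X') (h2 : D.Eqv Z W W') :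
    D.p Z X' W' ≤ D.pp Z X W := by
  apply le_csSup
  · refine ⟨D.p Z X W + 4 * D.θ, ?_⟩
    rintro r ⟨X'', W'', a, b, rfl⟩
    exact D.pp_aux hX hW a b
  · exact ⟨X', W', h1, h2, rfl⟩

theorem pp_le {Z X W : V} (r : ℝ) (h : ∀ X' W', D.Eqv Z X X' → D.Eqv Z W W' → D.p Z X' W' ≤ r) : D.pp Z X W ≤ r := by
  apply csSup_le
  · exact ⟨_, X, W, Relation.ReflTransGen.refl, Relation.ReflTransGen.refl, rfl⟩
  · rintro _ ⟨X', W', a, b, rfl⟩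
    exact h _ _ a b

theorem pp_le_p {Z X W : V} (hX : X ≠ Z) (hW : W ≠ Z) : D.pp Z X W ≤ D.p Z X W + 4 * D.θ :=
  D.pp_le _ (fun _ _ a b => D.pp_aux hX hW a b)

theorem p_le_pp {Z X W : V} (hX : X ≠ Z) (hW : W ≠ Z) : D.p Z X W ≤ D.pp Z X W :=
  D.le_pp hX hW Relation.ReflTransGen.refl Relation.ReflTransGen.refl

theorem pp_eqv_le {Z X Y W : V} (hX : X ≠ Z) (hW : W ≠ Z) (h : D.Eqv Z X Y) : D.pp Z X W ≤ D.pp Z Y W :=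
  D.pp_le _ (fun _ _ a b => D.le_pp (h.ne hX) hW (h.symm.trans a) b)

theorem pp_sym_le {Z X W : V} (hX : X ≠ Z) (hW : W ≠ Z) : D.pp Z X W ≤ D.pp Z W X :=
  D.pp_le _ (fun X' W' a b => by rw [D.sym X' Z W' (a.ne hX) (b.ne hW)]; exact D.le_pp hW hX b a)

theorem adj_smul {Z X Y : V} (σ : G) (h : D.Adj Z X Y) : D.Adj (σ • Z) (σ • X) (σ • Y) := by
  obtain ⟨a, b, c, e⟩ := h
  refine ⟨by simpa using a, by simpa using b, by simpa using c, ?_⟩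
  rwa [D.inv σ X Y Z c b.symm, D.inv σ Y X Z c.symm a.symm]

theorem eqv_smul {Z X Y : V} (σ : G) (h : D.Eqv Z X Y) : D.Eqv (σ • Z) (σ • X) (σ • Y) :=
  Relation.ReflTransGen.lift (σ • ·) (fun _ _ h => D.adj_smul σ h) _ _ h

theorem pp_inv_le {Z X W : V} (hX : X ≠ Z) (hW : W ≠ Z) (σ : G) : D.pp Z X W ≤ D.pp (σ • Z) (σ • X) (σ • W) :=
  D.pp_le _ (fun X' W' a b => by
    rw [← D.inv σ X' Z W' (a.ne hX) (b.ne hW)]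
    exact D.le_pp (by simpa using hX) (by simpa using hW) (D.eqv_smul σ a) (D.eqv_smul σ b))
end
end PS

/-- Strong projection data. -/
structure SP (G : Type) [Group G] (V : Type) [MulAction G V] where
  p : V → V → V → ℝ
  θ : ℝ
  pos : 0 < θ
  self : ∀ X Y, X ≠ Y → p Y X X ≤ θ
  sym : ∀ X Y Z, X ≠ Y → Z ≠ Y → p Y X Z = p Y Z X
  tri : ∀ X Y Z W, X ≠ Y → Z ≠ Y → W ≠ Y → p Y X Z ≤ p Y X W + p Y W Z
  inv : ∀ (σ : G) X Y Z, X ≠ Y → Z ≠ Y → p (σ • Y) (σ • X) (σ • Z) = p Y X Z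
  P3 : ∀ X Y Z W, X ≠ Y → Z ≠ Y → X ≠ Z → θ < p Y X Z → W ≠ Z → p Z X W = p Z Y W
  P2 : ∀ X Z, {Y | X ≠ Y ∧ Z ≠ Y ∧ θ < p Y X Z}.Finite
  stab : ∃ N : ℕ, ∀ Y Y' : V, Y ≠ Y' → ∃ s : Finset G, s.card ≤ N ∧
    ∀ φ : G, φ • Y = Y → φ • Y' = Y' → φ ∈ s
  big : ∃ X0 : V, ∀ T : ℝ, ∃ g : G, g • X0 ≠ X0 ∧ g⁻¹ • X0 ≠ X0 ∧ T < p X0 (g⁻¹ • X0) (g • X0)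

def PS.toSP {G : Type} [Group G] {V : Type} [MulAction G V] (D : PS G V) : SP G V :=
  have hp := D.pos
  { p := D.pp
    θ := 14 * D.θ
    pos := by linarith
    self := fun X Y h => by have := D.pp_le_p h h; have := D.self X Y h; linarith
    sym := fun X Y Z h h' => le_antisymm (D.pp_sym_le h h') (D.pp_sym_le h' h)
    tri := fun X Y Z W h h' h'' => D.pp_le _ (fun X' Z' a b => by
      have t := D.tri X' Y Z' W (a.ne h) (b.ne h') h''
      have l1 := D.le_pp h h'' a (Relation.ReflTransGen.refl)
      have l2 := D.le_pp h'' h' (Relation.ReflTransGen.refl) b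
      linarith)
    inv := fun σ X Y Z h h' => le_antisymm (by
      have := D.pp_inv_le (Z := σ • Y) (X := σ • X) (W := σ • Z) (by simpa using h) (by simpa using h') σ⁻¹
      simpa using this) (D.pp_inv_le h h' σ)
    P3 := fun X Y Z W h h' h'' h3 hW => by
      have e : D.Eqv Z X Y := Relation.ReflTransGen.single ⟨h'', h'.symm, h, Or.inl (by
        have := D.pp_le_p h h'; linarith)⟩
      exact le_antisymm (D.pp_eqv_le h'' hW e) (D.pp_eqv_le h'.symm hW e.symm)
    P2 := fun X Z => (D.P2 X Z).subset (by
      rintro Y ⟨a, b, c⟩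
      exact ⟨a, b, by have := D.pp_le_p a b; linarith⟩)
    stab := D.stab
    big := by
      obtain ⟨X0, h⟩ := D.big
      refine ⟨X0, fun T => ?_⟩
      obtain ⟨g, h1, h2, h3⟩ := h T
      exact ⟨g, h1, h2, h3.trans_le (D.p_le_pp h2 h1)⟩ }
end AH

namespace AH
namespace SP
section
variable {G : Type} [Group G] {V : Type} [MulAction G V] (D : SP G V)

def C (Y A B : V) : Prop := ∀ W, W ≠ Y → D.p Y A W = D.p Y B W

theorem C.symm {D : SP G V} {Y A B : V} (h : D.C Y A B) : D.C Y B A := fun W hW => (h W hW).symm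
theorem C.trans {D : SP G V} {Y A B E : V} (h : D.C Y A B) (h' : D.C Y B E) : D.C Y A E :=
  fun W hW => (h W hW).trans (h' W hW)

theorem cR {X Y Z : V} (h1 : X ≠ Y) (h2 : Z ≠ Y) (h : D.θ < D.p Y X Z) : D.C Z X Y := by
  have hXZ : X ≠ Z := by rintro rfl; exact absurd (D.self _ _ h1) (by linarith)
  exact fun W hW => D.P3 X Y Z W h1 h2 hXZ h hW

theorem cL {X Y Z : V} (h1 : X ≠ Y) (h2 : Z ≠ Y) (h : D.θ < D.p Y X Z) : D.C X Z Y := by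
  rw [D.sym X Y Z h1 h2] at h
  exact D.cR h2 h1 h

theorem C.le {D : SP G V} {Y A B : V} (h : D.C Y A B) (hB : B ≠ Y) : D.p Y A B ≤ D.θ := by
  rw [h B hB]; exact D.self _ _ hB

theorem C.le' {D : SP G V} {Y A B : V} (h : D.C Y A B) (hA : A ≠ Y) : D.p Y A B ≤ D.θ ∨ B = Y := by
  by_cases hB : B = Y
  · exact Or.inr hB
  · exact Or.inl (h.le hB)

def S (X Z : V) : Set V := {Y | X ≠ Y ∧ Z ≠ Y ∧ 2 * D.θ < D.p Y X Z}

theorem S_fin (X Z : V) : (D.S X Z).Finite := (D.P2 X Z).subset (by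
  rintro Y ⟨a, b, c⟩; exact ⟨a, b, by have := D.pos; linarith⟩)

theorem S_symm_le (X Z : V) : D.S X Z ⊆ D.S Z X := by
  rintro Y ⟨a, b, c⟩; exact ⟨b, a, by rwa [D.sym Z Y X b a]⟩

theorem S_symm (X Z : V) : D.S X Z = D.S Z X := Subset.antisymm (D.S_symm_le _ _) (D.S_symm_le _ _)

theorem S_self (X : V) : D.S X X = ∅ := by
  ext Y; constructor
  · rintro ⟨a, b, c⟩; have := D.self X Y a; have := D.pos; linarith
  · exact fun h => h.elim

def N (X Z : V) : ℕ := (D.S X Z).ncard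

theorem N_symm (X Z : V) : D.N X Z = D.N Z X := by rw [N, S_symm, N]
theorem N_self (X : V) : D.N X X = 0 := by rw [N, S_self]; simp

variable {D}

theorem S_congr {X X' Y Z : V} (h : Y ∈ D.S X Z) (hX : X' ≠ Y) (hc : D.C Y X' X) : Y ∈ D.S X' Z :=
  ⟨hX, h.2.1, by rw [hc Z h.2.1]; exact h.2.2⟩

theorem S_congr_right {X Z' Y Z : V} (h : Y ∈ D.S X Z) (hZ : Z' ≠ Y) (hc : D.C Y Z' Z) : Y ∈ D.S X Z' := by
  rw [S_symm] at h ⊢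
  exact S_congr h hZ hc

theorem mem_cR {X Y Z : V} (h : Y ∈ D.S X Z) : D.C Z X Y :=
  D.cR h.1 h.2.1 (by have := D.pos; have := h.2.2; linarith)
theorem mem_cL {X Y Z : V} (h : Y ∈ D.S X Z) : D.C X Z Y :=
  D.cL h.1 h.2.1 (by have := D.pos; have := h.2.2; linarith)
theorem mem_not_C {X Y Z : V} (h : Y ∈ D.S X Z) : ¬ D.C Y X Z := fun hc => by
  have := hc.le h.2.1; have := h.2.2; have := D.pos; linarith

/-- comparing two members -/
theorem dich {X Z Y U : V} (hY : Y ∈ D.S X Z) (hU : U ∈ D.S X Z) (hne : U ≠ Y) : U ∈ D.S X Y ∨ U ∈ D.S Y Z := by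
  have t := D.tri X Y Z U hY.1 hY.2.1 hne
  have h := hY.2.2
  by_cases h1 : D.θ < D.p Y X U
  · right
    exact S_congr hU hne.symm (D.cR hY.1 hne h1).symm
  · left
    have : D.θ < D.p Y U Z := by push Not at h1; linarith
    exact S_congr_right hU hne.symm (D.cL hne hY.2.1 this).symm

theorem S_sub {X Z Y U : V} (hY : Y ∈ D.S X Z) (hU : U ∈ D.S X Y) : U ∈ D.S X Z := by
  have c := mem_cR hU
  have hUZ : D.p Y U Z = D.p Y X Z := (c Z hY.2.1).symm
  have h : D.θ < D.p Y U Z := by rw [hUZ]; have := D.pos; have := hY.2.2; linarith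
  have hZU : Z ≠ U := by
    rintro rfl
    exact absurd (D.self _ _ hY.2.1) (by linarith)
  exact S_congr_right hU hZU (D.cL hU.2.1.symm hY.2.1 h)

theorem S_sub' {X Z Y U : V} (hY : Y ∈ D.S X Z) (hU : U ∈ D.S Y Z) : U ∈ D.S X Z := by
  rw [S_symm] at *
  exact S_sub hY hU

theorem S_disj {X Z Y U : V} (hY : Y ∈ D.S X Z) (hU : U ∈ D.S X Y) (hU' : U ∈ D.S Y Z) : False := by
  have a := (mem_cR hU).le hU.2.1.symm
  have b := (mem_cL hU').le hU.2.1.symm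
  have t := D.tri X Y Z U hY.1 hY.2.1 hU.2.1.symm
  have s := D.sym U Y Z hU.2.1.symm hY.2.1
  have := hY.2.2
  linarith

theorem N_add {X Z Y : V} (hY : Y ∈ D.S X Z) : D.N X Z = D.N X Y + 1 + D.N Y Z := by
  have e : D.S X Z = insert Y (D.S X Y ∪ D.S Y Z) := by
    ext U
    constructor
    · intro hU
      by_cases h : U = Y
      · exact Or.inl h
      · exact Or.inr (dich hY hU h)
    · rintro (rfl | h | h)
      · exact hY
      · exact S_sub hY h
      · exact S_sub' hY h
  unfold N
  rw [e, Set.ncard_insert_of_notMem ?_ ((D.S_fin _ _).union (D.S_fin _ _)), Set.ncard_union_eq ?_ (D.S_fin _ _) (D.S_fin _ _)]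
  · ring
  · rw [Set.disjoint_left]
    exact fun U h h' => S_disj hY h h'
  · rintro (h | h)
    · exact h.2.1 rfl
    · exact h.1 rfl

theorem N_inj {X Z Y U : V} (hY : Y ∈ D.S X Z) (hU : U ∈ D.S X Z) (h : D.N X Y = D.N X U) : Y = U := by
  by_contra hne
  have a := N_add hY
  have b := N_add hU
  rcases dich hY hU (Ne.symm hne) with h' | h'
  · have := N_add h'; omega
  · have := N_add h'; omega

theorem N_surj {X Z : V} {j : ℕ} (hj : j < D.N X Z) : ∃ Y ∈ D.S X Z, D.N X Y = j := by
  classical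
  have hf := D.S_fin X Z
  have hc : (Finset.range (D.N X Z)).card ≤ hf.toFinset.card := by
    rw [Finset.card_range, ← Set.ncard_eq_toFinset_card _ hf]; rfl
  have hm : Set.MapsTo (D.N X) hf.toFinset (Finset.range (D.N X Z)) := by
    intro Y hY
    have hY' : Y ∈ D.S X Z := by simpa using hY
    have := N_add hY'
    simp; omega
  have hi : Set.InjOn (D.N X) hf.toFinset := by
    intro Y hY U hU h
    exact N_inj (by simpa using hY) (by simpa using hU) h
  have := Finset.surjOn_of_injOn_of_card_le _ hm hi hc
  obtain ⟨Y, hY, h⟩ := this (show j ∈ (Finset.range (D.N X Z) : Set ℕ) by simpa using hj)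
  exact ⟨Y, by simpa using hY, h⟩

variable (D)
def Un (X Z W : V) : Set V := {Y | Y ∈ D.S X Z ∧ (Y = W ∨ ¬ (D.C Y W X ∨ D.C Y W Z))}
variable {D}

theorem un_aux {X Z W Y U : V} (hY : Y ∈ D.S X Z) (hU : U ∈ D.S Y Z) (hWY : W ≠ Y) (hWU : W ≠ U) (h : D.θ < D.p Y W Z) :
    D.C U W X := by
  have c1 : D.C Y U Z := (mem_cL hU).symm
  have e : D.p Y W U = D.p Y W Z := by
    rw [D.sym W Y U hWY hU.1.symm, D.sym W Y Z hWY hY.2.1, c1 W hWY]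
  have c2 : D.C U W Y := D.cR hWY hU.1.symm (by rw [e]; exact h)
  have hU' := S_sub' hY hU
  -- X and Y cluster at U
  have e2 : D.p Y U X = D.p Y Z X := c1 X hY.1
  have c3 : D.C U X Y := D.cR hY.1 hU.1.symm (by
    rw [D.sym X Y U hY.1 hU.1.symm, e2, D.sym Z Y X hY.2.1 hY.1]
    have := hY.2.2; have := D.pos; linarith)
  exact c2.trans c3.symm

theorem un_side (X Z W : V) : {Y | Y ∈ D.S X Z ∧ W ≠ Y ∧ ¬ D.C Y W X ∧ D.θ < D.p Y W Z}.ncard ≤ 1 := by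
  have hf : {Y | Y ∈ D.S X Z ∧ W ≠ Y ∧ ¬ D.C Y W X ∧ D.θ < D.p Y W Z}.Finite := (D.S_fin X Z).subset fun Y h => h.1
  rw [Set.ncard_le_one hf]
  rintro Y ⟨hY, h1, h2, h3⟩ U ⟨hU, h4, h5, h6⟩
  by_contra hne
  rcases dich hU hY hne with h | h
  · rcases dich hY hU (Ne.symm hne) with h' | h'
    · have a := N_add h
      have b := N_add h'
      omega
    · exact h5 (un_aux hY h' h1 h4 h3)
  · exact h2 (un_aux hU h h4 h1 h6)

theorem Un_card (X Z W : V) : (D.Un X Z W).ncard ≤ 3 := by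
  have hsub : D.Un X Z W ⊆ insert W ({Y | Y ∈ D.S X Z ∧ W ≠ Y ∧ ¬ D.C Y W X ∧ D.θ < D.p Y W Z} ∪
      {Y | Y ∈ D.S Z X ∧ W ≠ Y ∧ ¬ D.C Y W Z ∧ D.θ < D.p Y W X}) := by
    rintro Y ⟨hY, h⟩
    by_cases e : Y = W
    · exact Or.inl e
    right
    have h' := h.resolve_left e
    push Not at h'
    have hWY : W ≠ Y := Ne.symm e
    have t := D.tri X Y Z W hY.1 hY.2.1 hWY
    have s := D.sym X Y W hY.1 hWY
    have := hY.2.2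
    by_cases h1 : D.θ < D.p Y W Z
    · exact Or.inl ⟨hY, hWY, h'.1, h1⟩
    · refine Or.inr ⟨by rwa [S_symm], hWY, h'.2, by linarith⟩
  have hf1 : {Y | Y ∈ D.S X Z ∧ W ≠ Y ∧ ¬ D.C Y W X ∧ D.θ < D.p Y W Z}.Finite := (D.S_fin X Z).subset fun Y h => h.1
  have hf2 : {Y | Y ∈ D.S Z X ∧ W ≠ Y ∧ ¬ D.C Y W Z ∧ D.θ < D.p Y W X}.Finite := (D.S_fin Z X).subset fun Y h => h.1
  refine (Set.ncard_le_ncard hsub ((hf1.union hf2).insert _)).trans ?_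
  refine (Set.ncard_insert_le _ _).trans ?_
  have := Set.ncard_union_le {Y | Y ∈ D.S X Z ∧ W ≠ Y ∧ ¬ D.C Y W X ∧ D.θ < D.p Y W Z}
      {Y | Y ∈ D.S Z X ∧ W ≠ Y ∧ ¬ D.C Y W Z ∧ D.θ < D.p Y W X}
  have := un_side (D := D) X Z W
  have := un_side (D := D) Z X W
  omega

theorem Un_fin (X Z W : V) : (D.Un X Z W).Finite := (D.S_fin X Z).subset fun _ h => h.1

theorem clean {X Z W Y : V} (hY : Y ∈ D.S X Z) (h : Y ∉ D.Un X Z W) : W ≠ Y ∧ (D.C Y W X ∨ D.C Y W Z) := by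
  by_contra hc
  apply h
  refine ⟨hY, ?_⟩
  by_cases e : Y = W
  · exact Or.inl e
  · exact Or.inr fun h' => hc ⟨Ne.symm e, h'⟩

theorem N_tri (X Z W : V) : D.N X Z ≤ D.N X W + D.N W Z + 3 := by
  have hsub : D.S X Z ⊆ (D.S X W ∪ D.S W Z) ∪ D.Un X Z W := by
    intro Y hY
    by_cases h : Y ∈ D.Un X Z W
    · exact Or.inr h
    left
    obtain ⟨h1, h2 | h2⟩ := clean hY h
    · right; exact S_congr hY h1 h2
    · left; exact S_congr_right hY h1 h2
  have h1 := Set.ncard_le_ncard hsub (((D.S_fin _ _).union (D.S_fin _ _)).union (Un_fin _ _ _))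
  have h2 := Set.ncard_union_le (D.S X W ∪ D.S W Z) (D.Un X Z W)
  have h3 := Set.ncard_union_le (D.S X W) (D.S W Z)
  have h4 := Un_card (D := D) X Z W
  unfold N
  omega

theorem ncard_four {A B P Q E : Set V} (hA : A.Finite) (hB : B.Finite) (hP : P.Finite) (hQ : Q.Finite) (hE : E.Finite)
    (h1 : ∀ Y, Y ∉ E → Y ∈ A → Y ∈ P ∨ Y ∈ Q) (h2 : ∀ Y, Y ∉ E → Y ∈ B → Y ∈ P ∨ Y ∈ Q)
    (h3 : ∀ Y, Y ∉ E → Y ∈ A → Y ∈ B → Y ∈ P ∧ Y ∈ Q) : A.ncard + B.ncard ≤ P.ncard + Q.ncard + 2 * E.ncard := by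
  have s1 : A ∪ B ⊆ (P ∪ Q) ∪ E := by
    intro Y hY
    by_cases h : Y ∈ E
    · exact Or.inr h
    rcases hY with hY | hY
    · exact Or.inl (h1 Y h hY)
    · exact Or.inl (h2 Y h hY)
  have s2 : A ∩ B ⊆ (P ∩ Q) ∪ E := by
    intro Y hY
    by_cases h : Y ∈ E
    · exact Or.inr h
    · exact Or.inl (h3 Y h hY.1 hY.2)
  have a1 := Set.ncard_union_add_ncard_inter A B hA hB
  have a2 := Set.ncard_union_add_ncard_inter P Q hP hQ
  have b1 := Set.ncard_le_ncard s1 ((hP.union hQ).union hE)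
  have b2 := Set.ncard_le_ncard s2 ((hP.inter_of_left Q).union hE)
  have c1 := Set.ncard_union_le (P ∪ Q) E
  have c2 := Set.ncard_union_le (P ∩ Q) E
  omega

theorem four_cross {X Y Z W U T : V} (hU : U ∈ D.S X Y) (hT : T ∈ D.S X Y) (hZU : Z ≠ U) (hWU : W ≠ U)
    (hZT : Z ≠ T) (hWT : W ≠ T) (u1 : D.C U Z X) (u2 : D.C U W Y) (t1 : D.C T Z Y) (t2 : D.C T W X)
    (h : T ∈ D.S X U) : False := by
  have c1 : D.C U X T := mem_cR h
  -- T separates X and U, at U: T ~ X, so p_U(T, W) = p_U(X, Y)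
  have e : D.θ < D.p U T W := by
    rw [← c1 W hWU, D.sym X U W hU.1 hWU, u2 X hU.1, D.sym Y U X hU.2.1 hU.1]
    have := hU.2.2; have := D.pos; linarith
  have c2 : D.C T W U := D.cL h.2.1.symm hWU e
  have : D.C T X U := t2.symm.trans c2
  exact mem_not_C h this

theorem four_half {X Y Z W : V} (hno : ∀ T, T ∈ D.S X Y → Z ≠ T → W ≠ T → D.C T Z Y → D.C T W X → False) :
    D.N X Y + D.N Z W ≤ D.N X W + D.N Y Z + 24 := by
  have hE : (((D.Un X Y Z ∪ D.Un X Y W) ∪ D.Un Z W X) ∪ D.Un Z W Y).Finite :=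
    (((Un_fin _ _ _).union (Un_fin _ _ _)).union (Un_fin _ _ _)).union (Un_fin _ _ _)
  have key := ncard_four (D.S_fin X Y) (D.S_fin Z W) (D.S_fin X W) (D.S_fin Y Z) hE ?_ ?_ ?_
  · have c1 := Set.ncard_union_le ((D.Un X Y Z ∪ D.Un X Y W) ∪ D.Un Z W X) (D.Un Z W Y)
    have c2 := Set.ncard_union_le (D.Un X Y Z ∪ D.Un X Y W) (D.Un Z W X)
    have c3 := Set.ncard_union_le (D.Un X Y Z) (D.Un X Y W)
    have := Un_card (D := D) X Y Z
    have := Un_card (D := D) X Y W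
    have := Un_card (D := D) Z W X
    have := Un_card (D := D) Z W Y
    unfold N
    omega
  · intro T hT hA
    simp only [Set.mem_union, not_or] at hT
    obtain ⟨⟨⟨n1, n2⟩, n3⟩, n4⟩ := hT
    obtain ⟨hZ, cZ⟩ := clean hA n1
    obtain ⟨hW, cW⟩ := clean hA n2
    rcases cZ with cZ | cZ
    · right; rw [S_symm]; exact S_congr hA hZ cZ
    · rcases cW with cW | cW
      · exact (hno T hA hZ hW cZ cW).elim
      · left; exact S_congr_right hA hW cW
  · intro T hT hA
    simp only [Set.mem_union, not_or] at hT
    obtain ⟨⟨⟨n1, n2⟩, n3⟩, n4⟩ := hT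
    obtain ⟨hX, cX⟩ := clean hA n3
    obtain ⟨hY, cY⟩ := clean hA n4
    rcases cX with cX | cX
    · left; exact S_congr hA hX cX
    · rcases cY with cY | cY
      · exfalso
        refine hno T ?_ hA.1 hA.2.1 cY.symm cX.symm
        rw [S_symm]
        exact S_congr_right (S_congr hA hY cY) hX cX
      · right; rw [S_symm]; exact S_congr_right hA hY cY
  · intro T hT hA hB
    simp only [Set.mem_union, not_or] at hT
    obtain ⟨⟨⟨n1, n2⟩, n3⟩, n4⟩ := hT
    obtain ⟨hZ, cZ⟩ := clean hA n1
    obtain ⟨hW, cW⟩ := clean hA n2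
    rcases cZ with cZ | cZ
    · rcases cW with cW | cW
      · exact (mem_not_C hB (cZ.trans cW.symm)).elim
      · exact ⟨S_congr_right hA hW cW, by rw [S_symm]; exact S_congr hA hZ cZ⟩
    · rcases cW with cW | cW
      · exact (hno T hA hZ hW cZ cW).elim
      · exact (mem_not_C hB (cZ.trans cW.symm)).elim

theorem N_four (X Y Z W : V) : D.N X Y + D.N Z W ≤ max (D.N X Z + D.N Y W) (D.N X W + D.N Y Z) + 24 := by
  by_cases h1 : ∀ T, T ∈ D.S X Y → Z ≠ T → W ≠ T → D.C T Z Y → D.C T W X → False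
  · have := four_half h1
    omega
  · have h2 : ∀ U, U ∈ D.S X Y → W ≠ U → Z ≠ U → D.C U W Y → D.C U Z X → False := by
      intro U hU hWU hZU u2 u1
      push Not at h1
      obtain ⟨T, hT, hZT, hWT, t1, t2, _⟩ := h1
      have hne : T ≠ U := by
        rintro rfl
        exact mem_not_C hU (u1.symm.trans t1)
      rcases dich hU hT hne with h | h
      · exact four_cross hU hT hZU hWU hZT hWT u1 u2 t1 t2 h
      · rw [S_symm] at hU hT h
        exact four_cross hU hT hWU hZU hWT hZT u2 u1 t2 t1 h
    have := four_half h2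
    rw [N_symm D W Z] at this
    omega

theorem S_smul_le (σ : G) {X Z Y : V} (h : Y ∈ D.S X Z) : σ • Y ∈ D.S (σ • X) (σ • Z) := by
  refine ⟨by simpa using h.1, by simpa using h.2.1, ?_⟩
  rw [D.inv σ X Y Z h.1 h.2.1]; exact h.2.2

theorem S_smul (σ : G) {X Z Y : V} : σ • Y ∈ D.S (σ • X) (σ • Z) ↔ Y ∈ D.S X Z := by
  refine ⟨fun h => ?_, S_smul_le σ⟩
  simpa using S_smul_le σ⁻¹ h

theorem N_smul (σ : G) (X Z : V) : D.N (σ • X) (σ • Z) = D.N X Z := by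
  unfold N
  have : D.S (σ • X) (σ • Z) = (σ • ·) '' D.S X Z := by
    ext Y
    constructor
    · intro h
      exact ⟨σ⁻¹ • Y, by rw [← S_smul σ]; simpa using h, by simp⟩
    · rintro ⟨U, hU, rfl⟩
      exact S_smul_le σ hU
  rw [this, Set.ncard_image_of_injective _ (MulAction.injective σ)]

theorem N_unbdd : ∃ X0 : V, ∃ g : G, ∀ m : ℕ, m ≤ D.N X0 (g ^ (m+1) • X0) := by
  obtain ⟨X0, hb⟩ := D.big
  obtain ⟨g, h1, h2, h3⟩ := hb (2 * D.θ)
  have hp := D.pos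
  refine ⟨X0, g, ?_⟩
  have key : ∀ m : ℕ, X0 ≠ g ^ (m+1) • X0 ∧ D.C (g^(m+1) • X0) X0 (g^m • X0) ∧ m ≤ D.N X0 (g^(m+1) • X0) := by
    intro m
    induction m with
    | zero => exact ⟨by simpa using h1.symm, by intro W hW; simp, by omega⟩
    | succ m ih =>
      obtain ⟨a, c, b⟩ := ih
      have e1 : g ^ m • X0 = g^(m+1) • (g⁻¹ • X0) := by rw [smul_smul, pow_succ]; simp
      have e2 : g ^ (m+1+1) • X0 = g^(m+1) • (g • X0) := by rw [smul_smul, ← pow_succ]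
      have hne : g^(m+1+1) • X0 ≠ g^(m+1) • X0 := by rw [e2]; simpa using h1
      have hS : g^(m+1) • X0 ∈ D.S X0 (g^(m+1+1) • X0) := by
        refine ⟨a, hne, ?_⟩
        rw [c _ hne, e1, e2, D.inv _ _ _ _ h2 h1]
        exact h3
      have := N_add hS
      refine ⟨?_, mem_cR hS, by omega⟩
      intro hc
      have hself := D.self (g^(m+1+1) • X0) (g^(m+1) • X0) hne
      have hS2 := hS.2.2
      rw [← hc] at hS2 hself
      linarith
  exact fun m => (key m).2.2
end
end SP
end AH

namespace AH

/-- Coarse hyperbolic acylindrical action data. -/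
structure HS (G : Type) [Group G] (V : Type) [MulAction G V] where
  d : V → V → ℝ
  d_self : ∀ x, d x x = 0
  d_sym : ∀ x y, d x y = d y x
  d_tri : ∀ x y z, d x z ≤ d x y + d y z
  d_inv : ∀ (g : G) x y, d (g • x) (g • y) = d x y
  δ : ℝ
  c : ℝ
  four : ∀ x y z w, d x y + d z w ≤ max (d x z + d y w) (d x w + d y z) + 2 * δ
  cg : ∀ x z t, 0 ≤ t → t ≤ d x z → ∃ y, d x y ≤ t + c ∧ d y z ≤ d x z - t + c
  acyl : ∀ R : ℝ, ∃ L : ℝ, ∃ M : ℕ, ∀ x z, L < d x z → ∃ s : Finset G, s.card ≤ M ∧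
    ∀ g : G, d x (g • x) < R → d z (g • z) < R → g ∈ s
  unbdd : ∃ x, ∀ B : ℝ, ∃ g : G, B < d x (g • x)

namespace SP
section
variable {G : Type} [Group G] {V : Type} [MulAction G V] (D : SP G V)

theorem coset {G : Type} [Group G] {V : Type} [MulAction G V] (D : SP G V) : ∃ N : ℕ, ∀ A B Y Y' : V, Y ≠ Y' → ∃ s : Finset G, s.card ≤ N ∧
    ∀ φ : G, φ • A = Y → φ • B = Y' → φ ∈ s := by
  classical
  obtain ⟨N, hN⟩ := D.stab
  refine ⟨N, fun A B Y Y' hne => ?_⟩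
  by_cases h : ∃ φ : G, φ • A = Y ∧ φ • B = Y'
  · obtain ⟨φ0, h1, h2⟩ := h
    obtain ⟨s, hs, hs'⟩ := hN Y Y' hne
    refine ⟨s.image (· * φ0), Finset.card_image_le.trans hs, fun φ a b => ?_⟩
    rw [Finset.mem_image]
    refine ⟨φ * φ0⁻¹, hs' _ ?_ ?_, by simp⟩
    · rw [mul_smul, ← h1, inv_smul_smul, a, h1]
    · rw [mul_smul, ← h2, inv_smul_smul, b, h2]
  · exact ⟨∅, by simp, fun φ a b => absurd ⟨φ, a, b⟩ h⟩

variable {D}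
/-- members of S(X,Z) lost when the endpoints move -/
theorem lost (X Z X' Z' : V) (r : ℕ) (h1 : D.N X X' ≤ r) (h2 : D.N Z Z' ≤ r) :
    {Y | Y ∈ D.S X Z ∧ Y ∉ D.S X' Z'}.ncard ≤ 2 * r + 6 := by
  have hsub : {Y | Y ∈ D.S X Z ∧ Y ∉ D.S X' Z'} ⊆ ((D.Un X Z X' ∪ D.Un X Z Z') ∪ D.S X X') ∪ D.S Z Z' := by
    rintro Y ⟨hY, hn⟩
    by_contra hc
    simp only [Set.mem_union, not_or] at hc
    obtain ⟨⟨⟨n1, n2⟩, n3⟩, n4⟩ := hc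
    obtain ⟨hX, cX⟩ := clean hY n1
    obtain ⟨hZ, cZ⟩ := clean hY n2
    rcases cX with cX | cX
    · rcases cZ with cZ | cZ
      · apply n4
        rw [S_symm]
        exact S_congr hY hZ cZ
      · exact hn (S_congr_right (S_congr hY hX cX) hZ cZ)
    · exact n3 (S_congr_right hY hX cX)
  have hf : (((D.Un X Z X' ∪ D.Un X Z Z') ∪ D.S X X') ∪ D.S Z Z').Finite :=
    (((Un_fin _ _ _).union (Un_fin _ _ _)).union (D.S_fin _ _)).union (D.S_fin _ _)
  have := Set.ncard_le_ncard hsub hf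
  have c1 := Set.ncard_union_le ((D.Un X Z X' ∪ D.Un X Z Z') ∪ D.S X X') (D.S Z Z')
  have c2 := Set.ncard_union_le (D.Un X Z X' ∪ D.Un X Z Z') (D.S X X')
  have c3 := Set.ncard_union_le (D.Un X Z X') (D.Un X Z Z')
  have := Un_card (D := D) X Z X'
  have := Un_card (D := D) X Z Z'
  unfold N at h1 h2
  omega

theorem N_acyl (r : ℕ) : ∃ M : ℕ, ∀ X Z : V, 2 * r + 8 ≤ D.N X Z → ∃ s : Finset G, s.card ≤ M ∧
    ∀ φ : G, D.N X (φ • X) ≤ r → D.N Z (φ • Z) ≤ r → φ ∈ s := by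
  classical
  obtain ⟨Ns, hNs⟩ := D.coset
  choose! cs hcs hcs' using hNs
  refine ⟨(2*r+8) * ((2*r+8) * ((2*r+7) * ((2*r+7) * Ns))), fun X Z hN => ?_⟩
  obtain ⟨T, hT, hTc⟩ := Finset.exists_subset_card_eq (s := (D.S_fin X Z).toFinset) (n := 2*r+8) (by
    rw [← Set.ncard_eq_toFinset_card _ (D.S_fin X Z)]; exact hN)
  have hTS : ∀ Y ∈ T, Y ∈ D.S X Z := fun Y hY => by simpa using hT hY
  let O : V → Finset V := fun Y => ((D.S_fin X Z).toFinset).filter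
    (fun A => D.N X A ≤ D.N X Y + (r+3) ∧ D.N X Y ≤ D.N X A + (r+3))
  have hO : ∀ Y, (O Y).card ≤ 2*r+7 := by
    intro Y
    have : (O Y).card ≤ (Finset.Icc (D.N X Y - (r+3)) (D.N X Y + (r+3))).card := by
      apply Finset.card_le_card_of_injOn (D.N X)
      · intro A hA
        have hA' := (Finset.mem_filter.mp hA).2
        simp only [Finset.coe_Icc, Set.mem_Icc]
        omega
      · intro A hA B hB h
        have hA' := (Finset.mem_filter.mp hA).1
        have hB' := (Finset.mem_filter.mp hB).1
        exact N_inj (by simpa using hA') (by simpa using hB') h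
    rw [Nat.card_Icc] at this
    omega
  refine ⟨T.biUnion fun Y => T.biUnion fun Y' => (O Y).biUnion fun A => (O Y').biUnion fun B => if Y = Y' then ∅ else cs A B Y Y', ?_, ?_⟩
  · refine Finset.card_biUnion_le_card_mul _ _ _ ?_ |>.trans (by rw [hTc])
    intro Y _
    refine Finset.card_biUnion_le_card_mul _ _ _ ?_ |>.trans (by rw [hTc])
    intro Y' _
    refine (Finset.card_biUnion_le_card_mul _ _ ((2*r+7)*Ns) ?_).trans (Nat.mul_le_mul_right _ (hO _))
    intro A _
    refine (Finset.card_biUnion_le_card_mul _ _ Ns ?_).trans (Nat.mul_le_mul_right _ (hO _))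
    intro B _
    split_ifs with h
    · simp
    · exact hcs A B Y Y' h
  · intro φ h1 h2
    have hl := lost (D := D) X Z (φ • X) (φ • Z) r h1 h2
    have hlf : {Y | Y ∈ D.S X Z ∧ Y ∉ D.S (φ • X) (φ • Z)}.Finite := (D.S_fin X Z).subset fun _ h => h.1
    have hgood : 1 < (T.filter (fun Y => Y ∈ D.S (φ • X) (φ • Z))).card := by
      have hb : (T.filter (fun Y => ¬ Y ∈ D.S (φ • X) (φ • Z))).card ≤ 2*r+6 := by
        rw [Set.ncard_eq_toFinset_card _ hlf] at hl
        refine (Finset.card_le_card ?_).trans hl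
        intro Y hY
        rw [Finset.mem_filter] at hY
        simp only [Set.Finite.mem_toFinset]
        exact ⟨hTS Y hY.1, hY.2⟩
      have := Finset.card_filter_add_card_filter_not (s := T) (fun Y => Y ∈ D.S (φ • X) (φ • Z))
      omega
    obtain ⟨Y, hY, Y', hY', hne⟩ := Finset.one_lt_card.mp hgood
    rw [Finset.mem_filter] at hY hY'
    have hmem : ∀ Y, Y ∈ D.S (φ • X) (φ • Z) → φ⁻¹ • Y ∈ O Y := by
      intro Y hY
      have e : D.N X (φ⁻¹ • Y) = D.N (φ • X) Y := by
        rw [← N_smul φ]; simp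
      rw [Finset.mem_filter, e]
      refine ⟨?_, ?_, ?_⟩
      · simp only [Set.Finite.mem_toFinset]
        rw [← S_smul φ]; simpa using hY
      · have := N_tri (D := D) (φ • X) Y X
        rw [N_symm D (φ • X) X] at this
        omega
      · have := N_tri (D := D) X Y (φ • X)
        omega
    simp only [Finset.mem_biUnion]
    refine ⟨Y, hY.1, Y', hY'.1, φ⁻¹ • Y, hmem Y hY.2, φ⁻¹ • Y', hmem Y' hY'.2, ?_⟩
    rw [if_neg hne]
    exact hcs' _ _ _ _ hne φ (by simp) (by simp)

variable (D)
open Classical in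
def dd (X Z : V) : ℝ := if X = Z then 0 else (D.N X Z : ℝ) + 3

theorem dd_ge (X Z : V) : (D.N X Z : ℝ) ≤ D.dd X Z := by
  unfold dd; split_ifs with h
  · rw [h, N_self]; simp
  · linarith
theorem dd_le (X Z : V) : D.dd X Z ≤ (D.N X Z : ℝ) + 3 := by
  unfold dd; split_ifs with h
  · positivity
  · exact le_rfl

def toHS : HS G V where
  d := D.dd
  d_self := fun x => by simp [dd]
  d_sym := fun x y => by
    by_cases h : x = y
    · rw [h]
    · simp [dd, h, Ne.symm h, N_symm D x y]
  d_tri := fun x y z => by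
    by_cases h1 : x = y
    · subst h1; simp [dd]
    by_cases h2 : y = z
    · subst h2; simp [dd]
    have a := D.dd_le x z
    have b := N_tri (D := D) x z y
    have b' : (D.N x z : ℝ) ≤ D.N x y + D.N y z + 3 := by exact_mod_cast b
    have c1 : D.dd x y = D.N x y + 3 := by simp [dd, h1]
    have c2 : D.dd y z = D.N y z + 3 := by simp [dd, h2]
    linarith
  d_inv := fun g x y => by
    by_cases h : x = y
    · simp [dd, h]
    · simp [dd, h, N_smul]
  δ := 15
  c := 3
  four := fun x y z w => by
    have h := N_four (D := D) x y z w
    have h' : (D.N x y : ℝ) + D.N z w ≤ max ((D.N x z : ℝ) + D.N y w) ((D.N x w : ℝ) + D.N y z) + 24 := by exact_mod_cast h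
    have a := D.dd_le x y
    have b := D.dd_le z w
    have : max ((D.N x z : ℝ) + D.N y w) ((D.N x w : ℝ) + D.N y z) ≤ max (D.dd x z + D.dd y w) (D.dd x w + D.dd y z) :=
      max_le_max (add_le_add (D.dd_ge _ _) (D.dd_ge _ _)) (add_le_add (D.dd_ge _ _) (D.dd_ge _ _))
    linarith
  cg := fun x z t h0 ht => by
    by_cases hj : ⌊t⌋₊ < D.N x z
    · obtain ⟨y, hy, e⟩ := N_surj hj
      refine ⟨y, ?_, ?_⟩
      · have := D.dd_le x y
        have := Nat.floor_le h0
        rw [e] at *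
        linarith
      · have a := D.dd_le y z
        have b := N_add hy
        have b' : (D.N x z : ℝ) = D.N x y + 1 + D.N y z := by exact_mod_cast b
        have e' : (D.N x y : ℝ) = ⌊t⌋₊ := by exact_mod_cast e
        have := Nat.lt_floor_add_one t
        have := D.dd_ge x z
        linarith
    · refine ⟨z, ?_, ?_⟩
      · have := D.dd_le x z
        push Not at hj
        have h1 : (D.N x z : ℝ) ≤ ⌊t⌋₊ := by exact_mod_cast hj
        have := Nat.floor_le h0
        linarith
      · have : D.dd z z = 0 := by simp [dd]
        linarith
  acyl := fun R => by
    obtain ⟨r, hr⟩ := exists_nat_gt R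
    obtain ⟨M, hM⟩ := N_acyl (D := D) r
    refine ⟨2 * r + 11, M, fun x z h => ?_⟩
    have h1 : 2 * r + 8 ≤ D.N x z := by
      have := D.dd_le x z
      have : ((2 * r + 8 : ℕ) : ℝ) ≤ D.N x z := by push_cast; linarith
      exact_mod_cast this
    obtain ⟨s, hs, hs'⟩ := hM x z h1
    refine ⟨s, hs, fun g a b => hs' g ?_ ?_⟩
    · have := D.dd_ge x (g • x)
      have : (D.N x (g • x) : ℝ) ≤ r := by linarith
      exact_mod_cast this
    · have := D.dd_ge z (g • z)
      have : (D.N z (g • z) : ℝ) ≤ r := by linarith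
      exact_mod_cast this
  unbdd := by
    obtain ⟨X0, g, h⟩ := N_unbdd (D := D)
    refine ⟨X0, fun B => ?_⟩
    obtain ⟨m, hm⟩ := exists_nat_gt B
    refine ⟨g^(m+1), ?_⟩
    have := D.dd_ge X0 (g^(m+1) • X0)
    have h' : (m:ℝ) ≤ D.N X0 (g^(m+1) • X0) := by exact_mod_cast h m
    linarith
end
end SP
end AH

namespace AH
namespace HS
section
variable {G : Type} [Group G] {V : Type} [MulAction G V] (D : HS G V)

/-- Functions dominating the metric. -/
def Dl (u : V → ℝ) : Prop := ∀ x y, D.d x y ≤ u x + u y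

/-- The injective hull. -/
def E : Type := {f : V → ℝ // D.Dl f ∧ ∀ x, ∀ ε : ℝ, 0 < ε → ∃ y, f x + f y < D.d x y + ε}

variable {D}

theorem Dl.nonneg {u : V → ℝ} (h : D.Dl u) (x : V) : 0 ≤ u x := by
  have := h x x; rw [D.d_self] at this; linarith

theorem E.dl (f : D.E) : D.Dl f.1 := f.2.1

theorem E.lip (f : D.E) (x y : V) : f.1 x ≤ D.d x y + f.1 y := by
  apply le_of_forall_pos_le_add
  intro ε hε
  obtain ⟨z, hz⟩ := f.2.2 x ε hε
  have := D.d_tri x y z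
  have := f.dl y z
  linarith

theorem E.bd (f g : D.E) (v x : V) : |f.1 x - g.1 x| ≤ f.1 v + g.1 v := by
  have a := f.lip x v
  have b := g.dl x v
  have a' := g.lip x v
  have b' := f.dl x v
  rw [abs_le]; constructor <;> linarith

theorem ne (D : HS G V) : Nonempty V := ⟨D.unbdd.choose⟩

theorem E.bdd (f g : D.E) : BddAbove (Set.range fun x => |f.1 x - g.1 x|) := by
  obtain ⟨v⟩ := D.ne
  refine ⟨f.1 v + g.1 v, ?_⟩
  rintro _ ⟨x, rfl⟩
  exact f.bd g v x

def ds (f g : D.E) : ℝ := ⨆ x, |f.1 x - g.1 x|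

theorem le_ds (f g : D.E) (x : V) : |f.1 x - g.1 x| ≤ ds f g := le_ciSup (f.bdd g) x

theorem ds_le {f g : D.E} {r : ℝ} (h : ∀ x, |f.1 x - g.1 x| ≤ r) : ds f g ≤ r :=
  haveI := D.ne
  ciSup_le h

instance : MetricSpace D.E where
  dist := ds
  dist_self := fun f => by simp [ds]
  dist_comm := fun f g => by simp only [ds, abs_sub_comm]
  dist_triangle := fun f g h => ds_le fun x => by
    have a := le_ds f g x
    have b := le_ds g h x
    have := abs_sub_le (f.1 x) (g.1 x) (h.1 x)
    linarith
  eq_of_dist_eq_zero := fun {f g} h => by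
    apply Subtype.ext
    funext x
    have := le_ds f g x
    have h' : ds f g = 0 := h
    rw [h'] at this
    have := abs_nonpos_iff.mp this
    linarith

theorem dist_def (f g : D.E) : dist f g = ds f g := rfl

theorem dist_ge (f g : D.E) (x y : V) : D.d x y - f.1 x - g.1 y ≤ dist f g := by
  have a := le_ds f g y
  have b := f.dl x y
  have := le_abs_self (f.1 y - g.1 y)
  rw [dist_def]; linarith

theorem dist_near (f g : D.E) (ε : ℝ) (hε : 0 < ε) : ∃ x y, dist f g < D.d x y - f.1 x - g.1 y + ε := by
  haveI := D.ne
  obtain ⟨x, hx⟩ := exists_lt_of_lt_ciSup (show ds f g - ε / 2 < ⨆ x, |f.1 x - g.1 x| by unfold ds; linarith)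
  rw [dist_def]
  rcases abs_cases (f.1 x - g.1 x) with ⟨h, _⟩ | ⟨h, _⟩
  · obtain ⟨y, hy⟩ := f.2.2 x (ε/2) (by linarith)
    refine ⟨y, x, ?_⟩
    rw [D.d_sym y x]; linarith
  · obtain ⟨y, hy⟩ := g.2.2 x (ε/2) (by linarith)
    refine ⟨x, y, ?_⟩
    linarith

theorem hyp (D : HS G V) : GromovHyperbolic D.E D.δ := by
  intro f g h k
  apply le_of_forall_pos_le_add
  intro ε hε
  obtain ⟨x, y, h1⟩ := dist_near f g (ε/2) (by linarith)
  obtain ⟨z, w, h2⟩ := dist_near h k (ε/2) (by linarith)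
  have a1 := dist_ge f h x z
  have a2 := dist_ge g k y w
  have a3 := dist_ge f k x w
  have a4 := dist_ge g h y z
  have b1 := le_max_left (dist f h + dist g k) (dist f k + dist g h)
  have b2 := le_max_right (dist f h + dist g k) (dist f k + dist g h)
  have hf := D.four x y z w
  rcases max_cases (D.d x z + D.d y w) (D.d x w + D.d y z) with ⟨e, _⟩ | ⟨e, _⟩
  · rw [e] at hf; linarith
  · rw [e] at hf; linarith

variable (D)
def star (u : V → ℝ) (x : V) : ℝ := ⨆ z, (D.d x z - u z)
def qq (u : V → ℝ) (x : V) : ℝ := (u x + D.star u x) / 2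
variable {D}

theorem star_bdd {u : V → ℝ} (h : D.Dl u) (x : V) : BddAbove (Set.range fun z => D.d x z - u z) := by
  refine ⟨u x, ?_⟩
  rintro _ ⟨z, rfl⟩
  have := h x z
  simp only; linarith

theorem le_star {u : V → ℝ} (h : D.Dl u) (x z : V) : D.d x z - u z ≤ D.star u x := le_ciSup (star_bdd h x) z
theorem star_le {u : V → ℝ} {x : V} {r : ℝ} (h : ∀ z, D.d x z - u z ≤ r) : D.star u x ≤ r :=
  haveI := D.ne
  ciSup_le h

theorem star_le_self {u : V → ℝ} (h : D.Dl u) (x : V) : D.star u x ≤ u x :=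
  star_le fun z => by have := h x z; linarith

theorem qq_le {u : V → ℝ} (h : D.Dl u) (x : V) : D.qq u x ≤ u x := by
  have := star_le_self h x
  unfold qq; linarith

theorem qq_dl {u : V → ℝ} (h : D.Dl u) : D.Dl (D.qq u) := by
  intro x y
  have a := le_star h x y
  have b := le_star h y x
  rw [D.d_sym y x] at b
  unfold qq; linarith

theorem star_lip {u v : V → ℝ} (hu : D.Dl u) {C : ℝ} (h : ∀ x, v x ≤ u x + C) (x : V) (hv : D.Dl v) :
    D.star u x ≤ D.star v x + C := star_le fun z => by
  have := le_star hv x z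
  have := h z
  linarith

theorem qq_lip {u v : V → ℝ} (hu : D.Dl u) (hv : D.Dl v) {C : ℝ} (h : ∀ x, |u x - v x| ≤ C) (x : V) : |D.qq u x - D.qq v x| ≤ C := by
  have a := star_lip hu (C := C) (fun x => by have := abs_le.mp (h x); linarith) x hv
  have b := star_lip hv (C := C) (fun x => by have := abs_le.mp (h x); linarith) x hu
  have := abs_le.mp (h x)
  rw [abs_le]
  unfold qq
  constructor <;> linarith

variable (D)
def qn (u : V → ℝ) : ℕ → V → ℝ
  | 0 => u
  | n+1 => D.qq (qn u n)
def rr (u : V → ℝ) (x : V) : ℝ := ⨅ n, D.qn u n x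
variable {D}

theorem qn_dl {u : V → ℝ} (h : D.Dl u) (n : ℕ) : D.Dl (D.qn u n) := by
  induction n with
  | zero => exact h
  | succ n ih => exact qq_dl ih

theorem qn_lim {u : V → ℝ} (h : D.Dl u) (x : V) : Filter.Tendsto (fun n => D.qn u n x) Filter.atTop (nhds (D.rr u x)) := by
  apply tendsto_atTop_ciInf
  · exact antitone_nat_of_succ_le fun n => qq_le (qn_dl h n) x
  · refine ⟨0, ?_⟩
    rintro _ ⟨n, rfl⟩
    exact (qn_dl h n).nonneg x

theorem rr_le_qn {u : V → ℝ} (h : D.Dl u) (n : ℕ) (x : V) : D.rr u x ≤ D.qn u n x := by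
  apply ciInf_le
  refine ⟨0, ?_⟩
  rintro _ ⟨n, rfl⟩
  exact (qn_dl h n).nonneg x

theorem rr_dl {u : V → ℝ} (h : D.Dl u) : D.Dl (D.rr u) := fun x y =>
  ge_of_tendsto' ((qn_lim h x).add (qn_lim h y)) fun n => qn_dl h n x y

theorem rr_star {u : V → ℝ} (h : D.Dl u) (x : V) : D.rr u x ≤ D.star (D.rr u) x := by
  have h1 : Filter.Tendsto (fun n => 2 * D.qn u (n+1) x - D.qn u n x) Filter.atTop (nhds (2 * D.rr u x - D.rr u x)) :=
    (((qn_lim h x).comp (Filter.tendsto_add_atTop_nat 1)).const_mul 2).sub (qn_lim h x)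
  have h2 : ∀ n, 2 * D.qn u (n+1) x - D.qn u n x ≤ D.star (D.rr u) x := by
    intro n
    have e : 2 * D.qn u (n+1) x - D.qn u n x = D.star (D.qn u n) x := by
      change 2 * ((D.qn u n x + D.star (D.qn u n) x) / 2) - _ = _
      ring
    rw [e]
    have := star_lip (C := 0) (qn_dl h n) (fun y => by simpa using rr_le_qn h n y) x (rr_dl h)
    linarith
  have := le_of_tendsto' h1 h2
  linarith

def rE {u : V → ℝ} (h : D.Dl u) : D.E := ⟨D.rr u, rr_dl h, fun x ε hε => by
  haveI := D.ne
  have h1 := rr_star h x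
  obtain ⟨z, hz⟩ := exists_lt_of_lt_ciSup (show D.rr u x - ε < ⨆ z, (D.d x z - D.rr u z) by
    change _ < D.star (D.rr u) x
    linarith)
  exact ⟨z, by linarith⟩⟩

theorem rE_lip {u v : V → ℝ} (hu : D.Dl u) (hv : D.Dl v) {C : ℝ} (h : ∀ x, |u x - v x| ≤ C) : dist (rE hu) (rE hv) ≤ C := by
  apply ds_le
  intro x
  refine le_of_tendsto' (((qn_lim hu x).sub (qn_lim hv x)).abs) fun n => ?_
  have : ∀ n x, |D.qn u n x - D.qn v n x| ≤ C := by
    intro n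
    induction n with
    | zero => exact h
    | succ n ih => exact qq_lip (qn_dl hu n) (qn_dl hv n) ih
  exact this n x

theorem rE_id (f : D.E) (h : D.Dl f.1) : rE h = f := by
  apply Subtype.ext
  have hs : ∀ x, D.star f.1 x = f.1 x := by
    intro x
    apply le_antisymm (star_le_self h x)
    apply le_of_forall_pos_le_add
    intro ε hε
    obtain ⟨y, hy⟩ := f.2.2 x ε hε
    have := le_star h x y
    linarith
  have hq : ∀ n, D.qn f.1 n = f.1 := by
    intro n
    induction n with
    | zero => rfl
    | succ n ih =>
      change D.qq (D.qn f.1 n) = _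
      rw [ih]; funext x
      unfold qq; rw [hs]; ring
  funext x
  change D.rr f.1 x = _
  unfold rr
  simp [hq]

theorem dl_interp (f g : D.E) {a : ℝ} (h0 : 0 ≤ a) (h1 : a ≤ 1) : D.Dl (fun x => (1 - a) * f.1 x + a * g.1 x) := by
  intro x y
  have p := mul_le_mul_of_nonneg_left (f.dl x y) (show 0 ≤ 1 - a by linarith)
  have q := mul_le_mul_of_nonneg_left (g.dl x y) h0
  simp only
  nlinarith

theorem geod (D : HS G V) : GeodesicSpace D.E := by
  classical
  intro f g
  set r := dist f g with hr
  by_cases hr0 : r = 0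
  · have : f = g := dist_eq_zero.mp hr0
    refine ⟨fun _ => f, rfl, this, ?_⟩
    rintro s ⟨hs, hs'⟩ t ⟨ht, ht'⟩
    have e1 : s = 0 := by linarith
    have e2 : t = 0 := by linarith
    simp [e1, e2]
  have hrp : 0 < r := lt_of_le_of_ne dist_nonneg (Ne.symm hr0)
  let γ : ℝ → D.E := fun s => if h : 0 ≤ s / r ∧ s / r ≤ 1 then rE (dl_interp f g h.1 h.2) else f
  have hin : ∀ s ∈ Set.Icc 0 r, 0 ≤ s / r ∧ s / r ≤ 1 := fun s hs =>
    ⟨div_nonneg hs.1 hrp.le, (div_le_one hrp).mpr hs.2⟩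
  have g0 : γ 0 = f := by
    have h := hin 0 ⟨le_rfl, hrp.le⟩
    simp only [γ, dif_pos h]
    have : D.Dl f.1 := f.dl
    have e : (fun x => (1 - 0 / r) * f.1 x + 0 / r * g.1 x) = f.1 := by funext x; simp
    convert rE_id f this using 2
  have g1 : γ r = g := by
    have h := hin r ⟨hrp.le, le_rfl⟩
    simp only [γ, dif_pos h]
    have : D.Dl g.1 := g.dl
    have e : (fun x => (1 - r / r) * f.1 x + r / r * g.1 x) = g.1 := by funext x; rw [div_self hr0]; simp
    convert rE_id g this using 2
  have lip : ∀ s ∈ Set.Icc 0 r, ∀ t ∈ Set.Icc 0 r, dist (γ s) (γ t) ≤ |s - t| := by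
    intro s hs t ht
    simp only [γ, dif_pos (hin s hs), dif_pos (hin t ht)]
    apply rE_lip
    intro x
    have e : (1 - s / r) * f.1 x + s / r * g.1 x - ((1 - t / r) * f.1 x + t / r * g.1 x) = (s - t) / r * (g.1 x - f.1 x) := by
      field_simp; ring
    rw [e, abs_mul, abs_div, abs_of_pos hrp, abs_sub_comm (g.1 x)]
    have := le_ds f g x
    rw [← dist_def, ← hr] at this
    rw [div_mul_eq_mul_div, div_le_iff₀ hrp]
    exact mul_le_mul_of_nonneg_left this (abs_nonneg _)
  have main : ∀ s ∈ Set.Icc 0 r, ∀ t ∈ Set.Icc 0 r, s ≤ t → dist (γ s) (γ t) = |s - t| := by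
    intro s hs t ht hst
    apply le_antisymm (lip s hs t ht)
    have a := lip 0 ⟨le_rfl, hrp.le⟩ s hs
    have b := lip t ht r ⟨hrp.le, le_rfl⟩
    rw [g0, abs_of_nonpos (by linarith [hs.1])] at a
    rw [g1, abs_of_nonpos (by linarith [ht.2])] at b
    rw [abs_of_nonpos (by linarith)]
    have t1 := dist_triangle f (γ s) g
    have t2 := dist_triangle (γ s) (γ t) g
    linarith
  refine ⟨γ, g0, g1, fun s hs t ht => ?_⟩
  rcases le_total s t with h | h
  · exact main s hs t ht h
  · rw [dist_comm, abs_sub_comm]; exact main t ht s hs h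

variable (D)
def ev (v : V) : D.E := ⟨D.d v, fun x y => by have := D.d_tri x v y; rw [D.d_sym x v] at this; exact this, fun x ε hε =>
  ⟨v, by rw [D.d_self, D.d_sym v x]; linarith⟩⟩
variable {D}

theorem dist_ev (f : D.E) (v : V) : dist f (D.ev v) = f.1 v := by
  apply le_antisymm
  · apply ds_le
    intro x
    have a := f.lip x v
    have b := f.dl v x
    have e : (D.ev v).1 x = D.d v x := rfl
    rw [e, abs_le, D.d_sym v x]
    rw [D.d_sym v x] at b
    constructor <;> linarith
  · have := le_ds f (D.ev v) v
    have e : (D.ev v).1 v = 0 := D.d_self v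
    rw [e, sub_zero] at this
    exact (le_abs_self _).trans this

theorem dist_ev_ev (v w : V) : dist (D.ev v) (D.ev w) = D.d v w := dist_ev _ _

theorem dense (f : D.E) : ∃ v, f.1 v ≤ D.c + 2 * D.δ + 2 := by
  obtain ⟨x⟩ := D.ne
  obtain ⟨y, hy⟩ := f.2.2 x 1 one_pos
  have fx := f.dl.nonneg x
  have fy := f.dl.nonneg y
  have dn : 0 ≤ D.d x y := by
    have := D.d_tri x y x; rw [D.d_self, D.d_sym y x] at this; linarith
  obtain ⟨v, h1, h2⟩ := D.cg x y (min (f.1 x) (D.d x y)) (le_min fx dn) (min_le_right _ _)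
  refine ⟨v, ?_⟩
  obtain ⟨w, hw⟩ := f.2.2 v 1 one_pos
  have t1 := min_le_left (f.1 x) (D.d x y)
  have t2 : f.1 x - 1 ≤ min (f.1 x) (D.d x y) := le_min (by linarith) (by linarith)
  have hf := D.four v w x y
  have a := f.dl w y
  have b := f.dl w x
  rw [D.d_sym v x] at hf
  rcases max_cases (D.d x v + D.d w y) (D.d v y + D.d w x) with ⟨e, _⟩ | ⟨e, _⟩
  · rw [e] at hf; linarith
  · rw [e] at hf; linarith

def act (g : G) (f : D.E) : D.E := ⟨fun x => f.1 (g⁻¹ • x), fun x y => by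
    have := f.dl (g⁻¹ • x) (g⁻¹ • y); rwa [D.d_inv] at this, fun x ε hε => by
    obtain ⟨y, hy⟩ := f.2.2 (g⁻¹ • x) ε hε
    refine ⟨g • y, ?_⟩
    have e : D.d x (g • y) = D.d (g⁻¹ • x) y := by rw [← D.d_inv g (g⁻¹ • x), smul_inv_smul]
    rw [e]
    change f.1 (g⁻¹ • x) + f.1 (g⁻¹ • g • y) < _
    rw [inv_smul_smul]; exact hy⟩

theorem act_mul (g h : G) (f : D.E) : act (g * h) f = act g (act h f) := by
  apply Subtype.ext; funext x
  change f.1 ((g*h)⁻¹ • x) = f.1 (h⁻¹ • g⁻¹ • x)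
  rw [mul_inv_rev, mul_smul]
theorem act_one (f : D.E) : act (1 : G) f = f := by
  apply Subtype.ext; funext x
  change f.1 ((1:G)⁻¹ • x) = _
  simp

theorem act_dist_le (g : G) (f f' : D.E) : dist (act g f) (act g f') ≤ dist f f' :=
  ds_le fun x => le_ds f f' (g⁻¹ • x)

theorem act_dist (g : G) (f f' : D.E) : dist (act g f) (act g f') = dist f f' := by
  apply le_antisymm (act_dist_le g f f')
  have := act_dist_le g⁻¹ (act g f) (act g f')
  rwa [← act_mul, ← act_mul, inv_mul_cancel, act_one, act_one] at this

variable (D)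
def rho : G →* (D.E ≃ᵢ D.E) where
  toFun := fun g => IsometryEquiv.mk ⟨act g, act g⁻¹, fun f => by rw [← act_mul, inv_mul_cancel, act_one], fun f => by rw [← act_mul, mul_inv_cancel, act_one]⟩
    (Isometry.of_dist_eq (act_dist g))
  map_one' := by ext1 f; exact act_one f
  map_mul' := fun g h => by ext1 f; exact act_mul g h f
variable {D}

theorem rho_apply (g : G) (f : D.E) : D.rho g f = act g f := rfl

theorem act_ev (g : G) (v : V) : act g (D.ev v) = D.ev (g • v) := by
  apply Subtype.ext; funext x
  change D.d v (g⁻¹ • x) = D.d (g • v) x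
  rw [← D.d_inv g v, smul_inv_smul]

theorem move {f : D.E} {v : V} {C R : ℝ} (h : f.1 v ≤ C) (g : G) (hg : dist f (act g f) < R) : D.d v (g • v) < R + 2 * C := by
  have a : dist f (D.ev v) ≤ C := by rw [dist_ev]; exact h
  have b : dist (act g f) (act g (D.ev v)) ≤ C := by rw [act_dist]; exact a
  rw [act_ev] at b
  rw [← dist_ev_ev (D := D)]
  have t1 := dist_triangle (D.ev v) f (D.ev (g • v))
  have t2 := dist_triangle f (act g f) (D.ev (g • v))
  rw [dist_comm (D.ev v) f] at t1
  linarith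

theorem rho_acyl (D : HS G V) : IsAcylindrical D.rho := by
  intro R hR
  set C := D.c + 2 * D.δ + 2 with hC
  obtain ⟨L, M, hM⟩ := D.acyl (R + 2 * C)
  refine ⟨max 1 (L + 2 * C), by positivity, M, fun f h hfh => ?_⟩
  obtain ⟨v, hv⟩ := dense f
  obtain ⟨w, hw⟩ := dense h
  have hd : L < D.d v w := by
    rw [← dist_ev_ev (D := D)]
    have t1 := dist_triangle f (D.ev v) h
    have t2 := dist_triangle (D.ev v) (D.ev w) h
    rw [dist_comm (D.ev w) h, dist_ev h w] at t2
    rw [dist_ev] at t1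
    have := le_max_right 1 (L + 2 * C)
    linarith
  obtain ⟨s, hs, hs'⟩ := hM v w hd
  exact ⟨s, hs, fun g a b => hs' g (move hv g a) (move hw g b)⟩

theorem main (D : HS G V) (hG : ¬ VirtuallyCyclic G) (hδ : 0 ≤ D.δ) : AcylindricallyHyperbolic G := by
  refine ⟨hG, D.E, inferInstance, D.rho, ⟨D.geod, D.δ, hδ, D.hyp⟩, D.rho_acyl, ?_⟩
  obtain ⟨x, hx⟩ := D.unbdd
  refine ⟨D.ev x, fun hb => ?_⟩
  obtain ⟨C, hC⟩ := Metric.isBounded_iff.mp hb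
  obtain ⟨g, hg⟩ := hx C
  have := hC ⟨1, rfl⟩ ⟨g, rfl⟩
  simp only [rho_apply, act_ev, dist_ev_ev, one_smul] at this
  linarith
end
end HS
end AH

namespace AH
open TG
theorem not_vc {n : ℕ} {F : Type} [Group F] [TG n F] (hn : 2 ≤ n) : ¬ VirtuallyCyclic (MulAut F) := by
  rintro ⟨H, hfi, hcyc⟩
  let i : Fin n := ⟨0, by omega⟩
  let j : Fin n := ⟨1, by omega⟩
  have hnc : NC (gen i : F) (gen j) := by
    intro h
    have := gen_comm i j h
    simp [i, j] at this
  obtain ⟨m, hm, _, hmH⟩ := Subgroup.exists_pow_mem_of_index_ne_zero hfi.index_ne_zero (MulAut.conj (gen i : F))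
  obtain ⟨k, hk, _, hkH⟩ := Subgroup.exists_pow_mem_of_index_ne_zero hfi.index_ne_zero (MulAut.conj (gen j : F))
  have hc : (⟨_, hmH⟩ : H) * ⟨_, hkH⟩ = ⟨_, hkH⟩ * ⟨_, hmH⟩ := by
    obtain ⟨g, hg⟩ := hcyc.exists_generator
    obtain ⟨a, ha⟩ := hg ⟨_, hmH⟩
    obtain ⟨b, hb⟩ := hg ⟨_, hkH⟩
    rw [← ha, ← hb]
    exact Commute.zpow_zpow_self g a b
  have hc' := congrArg Subtype.val hc
  change MulAut.conj (gen i : F) ^ m * MulAut.conj (gen j : F) ^ k = MulAut.conj (gen j : F) ^ k * MulAut.conj (gen i : F) ^ m at hc'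
  rw [← map_pow, ← map_pow, ← map_mul, ← map_mul] at hc'
  have hcen : ∀ x : F, ((gen j ^ k * gen i ^ m)⁻¹ * (gen i ^ m * gen j ^ k)) * x = x * ((gen j ^ k * gen i ^ m)⁻¹ * (gen i ^ m * gen j ^ k)) := by
    intro x
    have := DFunLike.congr_fun hc' x
    simp only [MulAut.conj_apply] at this
    generalize (gen i : F) ^ m * gen j ^ k = p at this ⊢
    generalize (gen j : F) ^ k * gen i ^ m = q at this ⊢
    calc q⁻¹ * p * x = q⁻¹ * (p * x * p⁻¹) * p := by group
      _ = _ := by rw [this]; group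
  have h1 : ((gen j ^ k * gen i ^ m)⁻¹ * (gen i ^ m * gen j ^ k) : F) = 1 := by
    by_contra hne
    exact hnc (comm_trans hnc.ne1 hne hnc.ne2 (hcen _).symm (hcen _))
  have h2 : (gen i ^ m * gen j ^ k : F) = gen j ^ k * gen i ^ m := by
    rw [inv_mul_eq_one] at h1; exact h1.symm
  have ne1 : (gen i ^ m : F) ≠ 1 := pow_ne_one' hnc.ne1 hm
  have ne2 : (gen j ^ k : F) ≠ 1 := pow_ne_one' hnc.ne2 hk
  have h3 := comm_trans hnc.ne1 ne1 ne2 (Commute.self_pow (gen i) m) h2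
  exact hnc (comm_trans hnc.ne1 ne2 hnc.ne2 h3 (Commute.self_pow (gen j : F) k).symm)
end AH

/-- For every `n ≥ 2`, the automorphism group of the free group of rank `n` is
acylindrically hyperbolic. -/
theorem autFreeGroup_acylindricallyHyperbolic (n : ℕ) (hn : 2 ≤ n) :
    AcylindricallyHyperbolic (MulAut (FreeGroup (Fin n))) := by
  exact AH.HS.main (AH.SP.toHS (AH.PS.toSP (AH.thePS n hn (FreeGroup (Fin n))))) (AH.not_vc hn)
    (by change (0:ℝ) ≤ 15; norm_num)
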